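/- Let n̂ ∈ C⁰(P̂) be continuously differentiable on P̂, and let Ĉ^a be a cleaved face parameterized with a piecewise-C¹ positively oriented boundary. Then the wrapping number is given by the integral formula w^a(n̂) = (1/4π)( ∫_{Ĉ^a} n̂*ω − ∫_{∂Ĉ^a} n̂*γ ), where n̂*ω and n̂*γ denote pullbacks under n̂. -/

import Mathlib

open Matrix Set MeasureTheory
open scoped Classical

noncomputable section

/-- Points of `ℝ³`. -/
abbrev V3 := Fin 3 → ℝ

/-- The unit sphere `S² ⊂ ℝ³`. -/
def sphereS : Set V3 := {x | x ⬝ᵥ x = 1}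

/-- Rodrigues rotation of `v` by angle `θ` about the unit axis `F`. -/
def rot3 (F : V3) (θ : ℝ) (v : V3) : V3 :=
  Real.cos θ • v + Real.sin θ • (crossProduct F v) + ((1 - Real.cos θ) * (F ⬝ᵥ v)) • F

/-- The point at fraction `ρ` of arclength along the shortest geodesic on the
unit sphere from `p` to `a` (for `a ≠ -p`). -/
def geo (p a : V3) (ρ : ℝ) : V3 :=
  if p = a then p
  else (Real.sin ((1 - ρ) * Real.arccos (p ⬝ᵥ a)) / Real.sin (Real.arccos (p ⬝ᵥ a))) • p +
       (Real.sin (ρ * Real.arccos (p ⬝ᵥ a)) / Real.sin (Real.arccos (p ⬝ᵥ a))) • a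

/-- `ξ` is the continuous angle lift of the tangent field `n` along the path `z`
(defined on `[0,1]`), `η ∈ (-π,π)` the smallest-magnitude angle between the endpoint
values, and `κ` the resulting kink number: `2πκ = ξ(1) - η`. -/
def IsKinkAlong (Fn : V3) (n : V3 → V3) (z : ℝ → V3) (κ : ℤ) : Prop :=
  ∃ ξ : ℝ → ℝ, ContinuousOn ξ (Set.Icc 0 1) ∧ ξ 0 = 0 ∧
    (∀ t ∈ Set.Icc (0:ℝ) 1, n (z t) = rot3 Fn (ξ t) (n (z 0))) ∧
    ∃ η : ℝ, η ∈ Set.Ioo (-Real.pi) Real.pi ∧ n (z 1) = rot3 Fn η (n (z 0)) ∧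
      2 * Real.pi * (κ : ℝ) = ξ 1 - η

/-- `z` is a `2π`-periodic parameterization of a loop around the centre `ctr`, lying in the
plane through `ctr` with normal `N`, positively oriented with respect to `N` (the angle
`θ` increases by `2π` over a period). -/
def PosLoopParam (N ctr : V3) (z : ℝ → V3) : Prop :=
  Continuous z ∧ (∀ φ, z (φ + 2 * Real.pi) = z φ) ∧
  ∃ e₁ e₂ : V3, e₁ ⬝ᵥ e₁ = 1 ∧ e₂ ⬝ᵥ e₂ = 1 ∧ e₁ ⬝ᵥ e₂ = 0 ∧ crossProduct e₁ e₂ = N ∧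
    ∃ θ r : ℝ → ℝ, Continuous θ ∧ Monotone θ ∧ (∀ φ, θ (φ + 2 * Real.pi) = θ φ + 2 * Real.pi) ∧
      (∀ φ, 0 < r φ) ∧
      ∀ φ, z φ = ctr + r φ • (Real.cos (θ φ) • e₁ + Real.sin (θ φ) • e₂)

/-- The map `S² → S²` obtained by gluing, along the equator, the map
`ν(ρ,φ) = n(ρ z(φ) + (1-ρ) ctr)` (on the upper hemisphere) with the map
`ν₀(ρ,φ) = g_ρ(-s, n(z(φ)))` (on the lower hemisphere), where `(ρ,φ)` are the polar
coordinates of the first two coordinates. -/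
def wrapMap (n : V3 → V3) (z : ℝ → V3) (ctr s : V3) : V3 → V3 := fun x =>
  if 0 ≤ x 2 then
    n ((Real.sqrt ((x 0) ^ 2 + (x 1) ^ 2)) • z (Complex.arg ((x 0 : ℂ) + (x 1 : ℂ) * Complex.I))
      + (1 - Real.sqrt ((x 0) ^ 2 + (x 1) ^ 2)) • ctr)
  else
    geo (-s) (n (z (Complex.arg ((x 0 : ℂ) + (x 1 : ℂ) * Complex.I))))
      (Real.sqrt ((x 0) ^ 2 + (x 1) ^ 2))

/-- Homotopy of maps of the unit sphere `S²` to itself. -/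
def SphHomotopic (f g : V3 → V3) : Prop :=
  ∃ H : ℝ → V3 → V3,
    ContinuousOn (fun q : ℝ × V3 => H q.1 q.2) (Set.Icc (0:ℝ) 1 ×ˢ sphereS) ∧
    (∀ t ∈ Set.Icc (0:ℝ) 1, Set.MapsTo (H t) sphereS sphereS) ∧
    (∀ x ∈ sphereS, H 0 x = f x) ∧ (∀ x ∈ sphereS, H 1 x = g x)

/-- The standard degree-`k` self-map of `S²`: in cylindrical coordinates it multiplies
the azimuthal angle by `k`, fixing the vertical coordinate. -/
def powMap (k : ℤ) : V3 → V3 := fun x =>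
  if ((x 0 : ℂ) + (x 1 : ℂ) * Complex.I) = 0 then x
  else
    ![‖(x 0 : ℂ) + (x 1 : ℂ) * Complex.I‖ *
        ((((x 0 : ℂ) + (x 1 : ℂ) * Complex.I) /
          (‖(x 0 : ℂ) + (x 1 : ℂ) * Complex.I‖ : ℂ)) ^ k).re,
      ‖(x 0 : ℂ) + (x 1 : ℂ) * Complex.I‖ *
        ((((x 0 : ℂ) + (x 1 : ℂ) * Complex.I) /
          (‖(x 0 : ℂ) + (x 1 : ℂ) * Complex.I‖ : ℂ)) ^ k).im,
      x 2]

/-- `deg` is a Brouwer degree for self-maps of `S²`: it is invariant under homotopy of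
continuous self-maps of the sphere, and assigns degree `k` to the standard map `powMap k`.
(These axioms determine `deg` uniquely on continuous self-maps of `S²`, by Hopf's theorem.) -/
def DegreeTheory (deg : (V3 → V3) → ℤ) : Prop :=
  (∀ f g : V3 → V3, ContinuousOn f sphereS → Set.MapsTo f sphereS sphereS →
      ContinuousOn g sphereS → Set.MapsTo g sphereS sphereS →
      SphHomotopic f g → deg f = deg g) ∧
  (∀ k : ℤ, deg (powMap k) = k)

/-- The pullback under `u : ℝ² → S²` of the (normalized) area 2-form of `S²`,
evaluated on the standard basis of `ℝ²`: `u ⋅ (∂₁ u × ∂₂ u)`. -/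
def pullA (u : ℝ × ℝ → V3) (p : ℝ × ℝ) : ℝ :=
  u p ⬝ᵥ crossProduct (fderiv ℝ u p (1, 0)) (fderiv ℝ u p (0, 1))

/-- The integral `∫_A n*ω` of the pullback under `n` of the area form `ω` of `S²`, over a
planar region `A` lying in the plane through `o` spanned by the orthonormal pair `e₁, e₂`
(the pair orienting the plane). -/
def faceInt (n : V3 → V3) (o e₁ e₂ : V3) (A : Set V3) : ℝ :=
  ∫ p : ℝ × ℝ in {q : ℝ × ℝ | o + q.1 • e₁ + q.2 • e₂ ∈ A},
    pullA (fun q : ℝ × ℝ => n (o + q.1 • e₁ + q.2 • e₂)) p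

/-- The 1-form `γ = (1 - cos α) dβ` on `S² - {s}` (where `(α,β)` are spherical polar
coordinates with south pole at `s`, and `e₁, e₂` is an orthonormal azimuthal frame with
`e₁ ×₃ e₂ = -s`), evaluated at the point `v` on the tangent vector `w`. -/
def gammaForm (s e₁ e₂ : V3) (v w : V3) : ℝ :=
  if (v ⬝ᵥ e₁) ^ 2 + (v ⬝ᵥ e₂) ^ 2 = 0 then 0
  else (1 + v ⬝ᵥ s) *
    (((v ⬝ᵥ e₁) * (w ⬝ᵥ e₂) - (v ⬝ᵥ e₂) * (w ⬝ᵥ e₁)) / ((v ⬝ᵥ e₁) ^ 2 + (v ⬝ᵥ e₂) ^ 2))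

/-- The closed spherical geodesic triangle with vertices `a`, `b`, `c` (pairwise
non-antipodal): the radial projection to the sphere of the planar triangle with these
vertices. Its sides are the shortest geodesic arcs joining consecutive vertices. -/
def sphTri (a b c : V3) : Set V3 :=
  {x | ∃ α β γ : ℝ, 0 ≤ α ∧ 0 ≤ β ∧ 0 ≤ γ ∧ α • a + β • b + γ • c ≠ 0 ∧
    x = (Real.sqrt ((α • a + β • b + γ • c) ⬝ᵥ (α • a + β • b + γ • c)))⁻¹ •
      (α • a + β • b + γ • c)}

/-- The shortest geodesic arc on the sphere from `a` to `b` (for `a ≠ -b`). -/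
def sphArc (a b : V3) : Set V3 :=
  {x | ∃ α β : ℝ, 0 ≤ α ∧ 0 ≤ β ∧ α • a + β • b ≠ 0 ∧
    x = (Real.sqrt ((α • a + β • b) ⬝ᵥ (α • a + β • b)))⁻¹ • (α • a + β • b)}

/-- The oriented area `A(a,b,c)` of the spherical geodesic triangle with vertices
`a`, `b`, `c`: `A = 2 arg((1 + a⋅b + b⋅c + c⋅a) + i (a×b)⋅c)`, with `arg ∈ (-π, π]`. -/
def sphA (a b c : V3) : ℝ :=
  2 * Complex.arg (((1 + a ⬝ᵥ b + b ⬝ᵥ c + c ⬝ᵥ a : ℝ) : ℂ) +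
    ((crossProduct a b ⬝ᵥ c : ℝ) : ℂ) * Complex.I)

/-- `σ(a,b,c)` relative to the point `s`: equal to `sgn((a×b)⋅s)` if `s` lies in the
spherical triangle with vertices `a`, `b`, `c`, and `0` otherwise. -/
def sphSigma (s a b c : V3) : ℝ :=
  if s ∈ sphTri a b c then Real.sign (crossProduct a b ⬝ᵥ s) else 0

/-- A compact convex polyhedron `P̄ ⊂ ℝ³` with nonempty interior: its vertices `vert`,
faces `face` (with outward unit normals `Fnormal` and supporting planes
`{x | x ⋅ Fnormal c = foffset c}`), edges `edge` (segments between vertices), together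
with the truncation data: for each vertex `a` a plane through `cpt a` with outward unit
normal `Cnormal a` separating `vert a` from the other vertices, the planes being pairwise
disjoint within `P̄`.  The combinatorial data records, for each face `c`, its `m c`
vertices `fvert c 0, fvert c 1, …` and edges `fedge c i` (from `fvert c i` to
`fvert c (i+1)`) in cyclic order, positively oriented with respect to the outward normal;
and, for each vertex `a`, its `vm a` incident edges `vedge a i` and faces `vface a i`
(with `vface a i` containing the consecutive edges `vedge a i` and `vedge a (i+1)`) in
cyclic order, positively oriented with respect to the outward normal of the cleaved face. -/
structure PolyCtx where
  nv : ℕ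
  ne : ℕ
  nf : ℕ
  Pbar : Set V3
  vert : Fin nv → V3
  face : Fin nf → Set V3
  Fnormal : Fin nf → V3
  foffset : Fin nf → ℝ
  edge : Fin ne → Set V3
  esrc : Fin ne → Fin nv
  etgt : Fin ne → Fin nv
  edgeDir : Fin ne → V3
  cpt : Fin nv → V3
  Cnormal : Fin nv → V3
  m : Fin nf → ℕ
  fvert : Fin nf → ℕ → Fin nv
  fedge : Fin nf → ℕ → Fin ne
  vm : Fin nv → ℕ
  vedge : Fin nv → ℕ → Fin ne
  vface : Fin nv → ℕ → Fin nf
  compact : IsCompact Pbar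
  convex : Convex ℝ Pbar
  int_nonempty : (interior Pbar).Nonempty
  hull : Pbar = convexHull ℝ (Set.range vert)
  vert_extreme : ∀ a, vert a ∉ convexHull ℝ (Set.range vert \ {vert a})
  vert_inj : Function.Injective vert
  Fnormal_unit : ∀ c, Fnormal c ⬝ᵥ Fnormal c = 1
  face_def : ∀ c, face c = {x ∈ Pbar | x ⬝ᵥ Fnormal c = foffset c}
  face_supp : ∀ c, ∀ x ∈ Pbar, x ⬝ᵥ Fnormal c ≤ foffset c
  frontier_eq : frontier Pbar = ⋃ c, face c
  edge_def : ∀ b, edge b = segment ℝ (vert (esrc b)) (vert (etgt b))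
  edge_proper : ∀ b, esrc b ≠ etgt b
  edgeDir_unit : ∀ b, edgeDir b ⬝ᵥ edgeDir b = 1
  edgeDir_dir : ∀ b, ∃ lam : ℝ, 0 < lam ∧ vert (etgt b) - vert (esrc b) = lam • edgeDir b
  edge_two_faces : ∀ b, ∃ c c', edge b ⊆ face c ∧ edge b ⊆ face c' ∧
    crossProduct (Fnormal c) (Fnormal c') ≠ 0
  Cnormal_unit : ∀ a, Cnormal a ⬝ᵥ Cnormal a = 1
  sep_vert : ∀ a, 0 < (vert a - cpt a) ⬝ᵥ Cnormal a
  sep_other : ∀ a a', a' ≠ a → (vert a' - cpt a) ⬝ᵥ Cnormal a < 0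
  cleave_sub : ∀ a a' : Fin nv, ∀ x ∈ Pbar, (x - cpt a) ⬝ᵥ Cnormal a = 0 →
    (x - cpt a') ⬝ᵥ Cnormal a' ≤ 0
  m_ge : ∀ c, 3 ≤ m c
  fvert_per : ∀ c i, fvert c (i + m c) = fvert c i
  fedge_per : ∀ c i, fedge c (i + m c) = fedge c i
  fvert_inj : ∀ c, ∀ i j : ℕ, i < j → j < m c → fvert c i ≠ fvert c j
  fedge_seg : ∀ c i, edge (fedge c i) = segment ℝ (vert (fvert c i)) (vert (fvert c (i + 1)))
  fedge_sub : ∀ c i, edge (fedge c i) ⊆ face c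
  vm_ge : ∀ a, 3 ≤ vm a
  vedge_per : ∀ a i, vedge a (i + vm a) = vedge a i
  vface_per : ∀ a i, vface a (i + vm a) = vface a i
  vedge_inj : ∀ a, ∀ i j : ℕ, i < j → j < vm a → vedge a i ≠ vedge a j
  vedge_mem : ∀ a i, vert a ∈ edge (vedge a i)
  vface_between : ∀ a i, edge (vedge a i) ⊆ face (vface a i) ∧
    edge (vedge a (i + 1)) ⊆ face (vface a i)

namespace PolyCtx

variable (P : PolyCtx)

/-- `P`: the polyhedron `P̄` with its vertices removed. -/
def Pset : Set V3 := P.Pbar \ Set.range P.vert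

/-- The closed half-space `R^a` cut off by the cleaving plane at the vertex `a`. -/
def Rhalf (a : Fin P.nv) : Set V3 := {x | (x - P.cpt a) ⬝ᵥ P.Cnormal a ≤ 0}

/-- The intersection of all the half-spaces `R^a`. -/
def Rall : Set V3 := ⋂ a, P.Rhalf a

/-- The truncated polyhedron `P̂ = P ∩ ⋂ₐ R^a`. -/
def PhatSet : Set V3 := P.Pset ∩ P.Rall

/-- The cleaved face `Ĉ^a = C^a ∩ P`. -/
def Chat (a : Fin P.nv) : Set V3 := {x | (x - P.cpt a) ⬝ᵥ P.Cnormal a = 0} ∩ P.Pset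

/-- The truncated face `F̂^c = F^c ∩ ⋂ₐ R^a`. -/
def Fhat (c : Fin P.nf) : Set V3 := P.face c ∩ P.Rall

/-- The cleaved edge `B̂^{ac} = Ĉ^a ∩ F̂^c`. -/
def Bhat (a : Fin P.nv) (c : Fin P.nf) : Set V3 := P.Chat a ∩ P.Fhat c

/-- The truncated edge `Ê^b = E^b ∩ ⋂ₐ R^a`. -/
def Ehat (b : Fin P.ne) : Set V3 := P.edge b ∩ P.Rall

/-- The boundary `∂Ĉ^a` of the cleaved face: the union of its cleaved edges. -/
def bdChat (a : Fin P.nv) : Set V3 := ⋃ c, P.Bhat a c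

/-- The boundary `∂F̂^c` of the truncated face: its truncated edges and cleaved edges. -/
def bdFhat (c : Fin P.nf) : Set V3 :=
  (⋃ i ∈ Finset.range (P.m c), P.Ehat (P.fedge c i)) ∪
    ⋃ i ∈ Finset.range (P.m c), P.Bhat (P.fvert c i) c

/-- The boundary `∂P̂` of the truncated polyhedron: cleaved faces and truncated faces. -/
def bdPhat : Set V3 := (⋃ a, P.Chat a) ∪ ⋃ c, P.Fhat c

/-- `n ∈ C⁰(P)`: a continuous unit-vector field on `P`, tangent to each face. -/
def MemC0P (n : V3 → V3) : Prop :=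
  ContinuousOn n P.Pset ∧ (∀ x ∈ P.Pset, n x ∈ sphereS) ∧
  ∀ c, ∀ x ∈ P.face c ∩ P.Pset, n x ⬝ᵥ P.Fnormal c = 0

/-- `n ∈ C⁰(P̂)`: a continuous unit-vector field on `P̂`, tangent to each truncated
face `F̂^c` (but not necessarily to the cleaved faces). -/
def MemC0Phat (n : V3 → V3) : Prop :=
  ContinuousOn n P.PhatSet ∧ (∀ x ∈ P.PhatSet, n x ∈ sphereS) ∧
  ∀ c, ∀ x ∈ P.Fhat c, n x ⬝ᵥ P.Fnormal c = 0

/-- Homotopy in `C⁰(P)`. -/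
def HomotopicP (n n' : V3 → V3) : Prop :=
  ∃ H : ℝ → V3 → V3,
    ContinuousOn (fun q : ℝ × V3 => H q.1 q.2) (Set.Icc (0:ℝ) 1 ×ˢ P.Pset) ∧
    (∀ t ∈ Set.Icc (0:ℝ) 1, P.MemC0P (H t)) ∧
    (∀ x ∈ P.Pset, H 0 x = n x) ∧ (∀ x ∈ P.Pset, H 1 x = n' x)

/-- Homotopy in `C⁰(P̂)`. -/
def HomotopicPhat (n n' : V3 → V3) : Prop :=
  ∃ H : ℝ → V3 → V3,
    ContinuousOn (fun q : ℝ × V3 => H q.1 q.2) (Set.Icc (0:ℝ) 1 ×ˢ P.PhatSet) ∧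
    (∀ t ∈ Set.Icc (0:ℝ) 1, P.MemC0Phat (H t)) ∧
    (∀ x ∈ P.PhatSet, H 0 x = n x) ∧ (∀ x ∈ P.PhatSet, H 1 x = n' x)

/-- The edge orientation `e^b(n) = ε`: `n` has the constant value `ε` on `Ê^b`. -/
def IsEdgeOrient (b : Fin P.ne) (n : V3 → V3) (ε : V3) : Prop :=
  ∀ x ∈ P.Ehat b, n x = ε

/-- `z : [0,1] → ℝ³` is a continuous injective parameterization of the cleaved edge
`B̂^{ac}`, positively oriented with respect to the outward normal `F^c` (the face
`F̂^c` lies on the positive side of `F^c × (z 1 - z 0)`). -/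
def IsPosParamSeg (a : Fin P.nv) (c : Fin P.nf) (z : ℝ → V3) : Prop :=
  ContinuousOn z (Set.Icc 0 1) ∧ z '' Set.Icc 0 1 = P.Bhat a c ∧
  Set.InjOn z (Set.Icc 0 1) ∧
  ∀ x ∈ P.Fhat c, 0 ≤ (x - z 0) ⬝ᵥ crossProduct (P.Fnormal c) (z 1 - z 0)

/-- The kink number `k^{ac}(n) = κ`. -/
def HasKink (a : Fin P.nv) (c : Fin P.nf) (n : V3 → V3) (κ : ℤ) : Prop :=
  ∃ z : ℝ → V3, P.IsPosParamSeg a c z ∧ IsKinkAlong (P.Fnormal c) n z κ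

/-- `s ∈ S²` is admissible: not orthogonal to any face normal. -/
def AdmissibleS (s : V3) : Prop := s ∈ sphereS ∧ ∀ c, s ⬝ᵥ P.Fnormal c ≠ 0

/-- The wrapping number `w^a(n) = w`, computed (relative to a Brouwer degree `deg` and
an admissible reference point `s`) as the degree of the map `S² → S²` glued from the
restriction of `n` to the cleaved face `Ĉ^a` and the geodesic contraction of its boundary
values to `-s`, using an interior point `ctr` of `Ĉ^a` and a positively oriented
`2π`-periodic parameterization `z` of `∂Ĉ^a`. -/
def HasWrap (deg : (V3 → V3) → ℤ) (s : V3) (a : Fin P.nv) (n : V3 → V3) (w : ℤ) : Prop :=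
  ∃ ctr z, ctr ∈ P.Chat a ∧ ctr ∉ P.bdChat a ∧
    PosLoopParam (P.Cnormal a) ctr z ∧ Set.range z = P.bdChat a ∧
    deg (wrapMap n z ctr s) = w

/-- `n` and `n'` have the same invariants: equal edge orientations, kink numbers and
wrapping numbers. -/
def SameInv (deg : (V3 → V3) → ℤ) (s : V3) (n n' : V3 → V3) : Prop :=
  (∀ b : Fin P.ne, Set.EqOn n n' (P.Ehat b)) ∧
  (∀ a c, ∀ κ : ℤ, P.HasKink a c n κ ↔ P.HasKink a c n' κ) ∧
  (∀ a, ∀ w : ℤ, P.HasWrap deg s a n w ↔ P.HasWrap deg s a n' w)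

end PolyCtx

open scoped NNReal Topology

/-- A function on the compact image is continuous if its pullback is. -/
theorem continuousOn_image_of_comp {X Y Z : Type*} [TopologicalSpace X] [TopologicalSpace Y]
    [T2Space Y] [TopologicalSpace Z] {K : Set X} (hK : IsCompact K) {G : X → Y}
    (hG : ContinuousOn G K) {H : Y → Z} (hH : ContinuousOn (H ∘ G) K) :
    ContinuousOn H (G '' K) := by
  rw [continuousOn_iff_isClosed]
  intro C hC
  obtain ⟨u, hu, huK⟩ := (continuousOn_iff_isClosed.1 hH) C hC
  refine ⟨G '' (u ∩ K), ?_, ?_⟩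
  · exact ((hK.inter_left hu).image_of_continuousOn (hG.mono inter_subset_right)).isClosed
  · ext y
    constructor
    · rintro ⟨h1, x, hx, rfl⟩
      refine ⟨⟨x, ?_, rfl⟩, ⟨x, hx, rfl⟩⟩
      rw [← huK]
      exact ⟨h1, hx⟩
    · rintro ⟨⟨x, hx, rfl⟩, h2⟩
      rw [← huK] at hx
      exact ⟨hx.1, h2⟩

/-- Cylindrical parameterization of the sphere. -/
def cyl (y φ : ℝ) : V3 := ![Real.sqrt (1 - y ^ 2) * Real.cos φ, Real.sqrt (1 - y ^ 2) * Real.sin φ, y]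

/-- The longitude of a point. -/
def lon (x : V3) : ℝ := Complex.arg ((x 0 : ℂ) + (x 1 : ℂ) * Complex.I)

theorem cyl_sq {y : ℝ} (hy : y ∈ Icc (-1 : ℝ) 1) : Real.sqrt (1 - y ^ 2) ^ 2 = 1 - y ^ 2 :=
  Real.sq_sqrt (by nlinarith [hy.1, hy.2])

theorem cyl_mem {y : ℝ} (hy : y ∈ Icc (-1 : ℝ) 1) (φ : ℝ) : cyl y φ ∈ sphereS := by
  have h := cyl_sq hy
  have h2 := Real.sin_sq_add_cos_sq φ
  simp only [sphereS, cyl, mem_ofPred_eq, dotProduct, Fin.sum_univ_three]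
  simp
  linear_combination (Real.cos φ ^ 2 + Real.sin φ ^ 2) * h + (1 - y ^ 2) * h2

theorem cyl_rho {y : ℝ} (φ : ℝ) :
    Real.sqrt ((cyl y φ 0) ^ 2 + (cyl y φ 1) ^ 2) = Real.sqrt (1 - y ^ 2) := by
  have h2 := Real.sin_sq_add_cos_sq φ
  rw [show (cyl y φ 0) ^ 2 + (cyl y φ 1) ^ 2 = Real.sqrt (1 - y ^ 2) ^ 2 by
    simp [cyl]; linear_combination (Real.sqrt (1 - y ^ 2) ^ 2) * h2]
  exact Real.sqrt_sq (Real.sqrt_nonneg _)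

theorem cyl_complex (y φ : ℝ) : ((cyl y φ 0 : ℂ) + (cyl y φ 1 : ℂ) * Complex.I) =
    (Real.sqrt (1 - y ^ 2) : ℂ) * (Complex.cos φ + Complex.sin φ * Complex.I) := by
  simp [cyl]; ring

theorem lon_cyl {y φ : ℝ} (hy : y ∈ Ioo (-1 : ℝ) 1) (hφ : φ ∈ Ioc (-Real.pi) Real.pi) :
    lon (cyl y φ) = φ := by
  unfold lon
  rw [cyl_complex]
  exact Complex.arg_mul_cos_add_sin_mul_I (Real.sqrt_pos.2 (by nlinarith [hy.1, hy.2])) hφ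

theorem cyl_lon {x : V3} (hx : x ∈ sphereS) : x = cyl (x 2) (lon x) := by
  have hx' : x 0 * x 0 + x 1 * x 1 + x 2 * x 2 = 1 := by
    simpa [sphereS, dotProduct, Fin.sum_univ_three] using hx
  have hr : Real.sqrt (1 - x 2 ^ 2) = ‖(x 0 : ℂ) + (x 1 : ℂ) * Complex.I‖ := by
    rw [Complex.norm_add_mul_I]; congr 1; linarith [hx']
  ext i
  fin_cases i
  · simp [cyl, hr, lon, Complex.norm_mul_cos_arg]
  · simp [cyl, hr, lon, Complex.norm_mul_sin_arg]
  · simp [cyl]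

theorem sph_z_mem {x : V3} (hx : x ∈ sphereS) : x 2 ∈ Icc (-1 : ℝ) 1 := by
  have hx' : x 0 * x 0 + x 1 * x 1 + x 2 * x 2 = 1 := by
    simpa [sphereS, dotProduct, Fin.sum_univ_three] using hx
  constructor <;> nlinarith [mul_self_nonneg (x 0), mul_self_nonneg (x 1)]

theorem lon_mem (x : V3) : lon x ∈ Ioc (-Real.pi) Real.pi := Complex.arg_mem_Ioc _

theorem deg_eq_of_hom {deg : (V3 → V3) → ℤ} (hdeg : DegreeTheory deg) (h : ℝ → ℝ → ℝ → V3)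
    (hc : ContinuousOn (fun q : ℝ × ℝ × ℝ => h q.1 q.2.1 q.2.2)
      (Icc 0 1 ×ˢ Icc (-1) 1 ×ˢ univ))
    (hper : ∀ τ ∈ Icc (0:ℝ) 1, ∀ y ∈ Icc (-1:ℝ) 1, ∀ φ, h τ y (φ + 2 * Real.pi) = h τ y φ)
    (hN : ∀ τ ∈ Icc (0:ℝ) 1, ∀ φ, h τ 1 φ = h τ 1 0)
    (hS : ∀ τ ∈ Icc (0:ℝ) 1, ∀ φ, h τ (-1) φ = h τ (-1) 0)
    (hu : ∀ τ ∈ Icc (0:ℝ) 1, ∀ y ∈ Icc (-1:ℝ) 1, ∀ φ, h τ y φ ∈ sphereS)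
    (f g : V3 → V3)
    (hf : ∀ x ∈ sphereS, f x = h 0 (x 2) (lon x))
    (hg : ∀ x ∈ sphereS, g x = h 1 (x 2) (lon x)) : deg f = deg g := by
  have pi0 := Real.pi_pos
  set H : ℝ → V3 → V3 := fun τ x => h τ (x 2) (lon x) with hHdef
  set K : Set (ℝ × ℝ × ℝ) := Icc 0 1 ×ˢ Icc (-1) 1 ×ˢ Icc (-Real.pi) Real.pi with hK
  set G : ℝ × ℝ × ℝ → ℝ × V3 := fun q => (q.1, cyl q.2.1 q.2.2) with hG
  have hKc : IsCompact K := isCompact_Icc.prod (isCompact_Icc.prod isCompact_Icc)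
  have hGc : Continuous G := by
    refine continuous_fst.prodMk (continuous_pi fun i => ?_)
    fin_cases i <;> simp [cyl] <;> fun_prop
  have hHG : ∀ q ∈ K, ((fun q : ℝ × V3 => H q.1 q.2) ∘ G) q = h q.1 q.2.1 q.2.2 := by
    rintro ⟨τ, y, φ⟩ ⟨hτ, hy, hφ⟩
    simp only [Function.comp, hHdef, hG]
    have e2 : cyl y φ 2 = y := by simp [cyl]
    simp only [] at hτ hy hφ
    rw [e2]
    rcases eq_or_lt_of_le hy.1 with h1 | h1
    · rw [← h1, hS τ hτ, hS τ hτ φ]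
    rcases eq_or_lt_of_le hy.2 with h2 | h2
    · rw [h2, hN τ hτ, hN τ hτ φ]
    rcases eq_or_lt_of_le hφ.1 with h3 | h3
    · have : cyl y φ = cyl y Real.pi := by rw [← h3]; simp [cyl]
      rw [this, lon_cyl ⟨h1, h2⟩ ⟨by linarith, le_rfl⟩, ← h3, ← hper τ hτ y hy (-Real.pi)]
      congr 1; ring
    · rw [lon_cyl ⟨h1, h2⟩ ⟨h3, hφ.2⟩]
  have hcont : ContinuousOn (fun q : ℝ × V3 => H q.1 q.2) (Icc (0:ℝ) 1 ×ˢ sphereS) := by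
    have := continuousOn_image_of_comp hKc hGc.continuousOn
      (H := fun q : ℝ × V3 => H q.1 q.2) ?_
    · refine this.mono ?_
      rintro ⟨τ, x⟩ ⟨hτ, hx⟩
      exact ⟨(τ, x 2, lon x), ⟨hτ, sph_z_mem hx, Ioc_subset_Icc_self (lon_mem x)⟩,
        Prod.ext rfl (cyl_lon hx).symm⟩
    · refine (hc.mono ?_).congr hHG
      rintro ⟨τ, y, φ⟩ ⟨hτ, hy, hφ⟩
      exact ⟨hτ, hy, mem_univ _⟩
  have hmt : ∀ t ∈ Icc (0:ℝ) 1, MapsTo (H t) sphereS sphereS :=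
    fun t ht x hx => hu t ht _ (sph_z_mem hx) _
  have hct : ∀ t ∈ Icc (0:ℝ) 1, ContinuousOn (H t) sphereS := fun t ht =>
    hcont.comp (f := fun x => (t, x)) (by fun_prop) (fun x hx => ⟨ht, hx⟩)
  have z0 : (0:ℝ) ∈ Icc (0:ℝ) 1 := by simp
  have z1 : (1:ℝ) ∈ Icc (0:ℝ) 1 := by simp
  refine hdeg.1 f g ((hct 0 z0).congr hf) ((hmt 0 z0).congr fun x hx => (hf x hx).symm)
    ((hct 1 z1).congr hg) ((hmt 1 z1).congr fun x hx => (hg x hx).symm)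
    ⟨H, hcont, hmt, fun x hx => (hf x hx).symm, fun x hx => (hg x hx).symm⟩

/-- The real quaternions. -/
abbrev HQ := Quaternion ℝ

@[simp] theorem hq_one_re : (1 : HQ).re = 1 := rfl
@[simp] theorem hq_one_imI : (1 : HQ).imI = 0 := rfl
@[simp] theorem hq_one_imJ : (1 : HQ).imJ = 0 := rfl
@[simp] theorem hq_one_imK : (1 : HQ).imK = 0 := rfl
@[simp] theorem hq_zero_re : (0 : HQ).re = 0 := rfl
@[simp] theorem hq_zero_imI : (0 : HQ).imI = 0 := rfl
@[simp] theorem hq_zero_imJ : (0 : HQ).imJ = 0 := rfl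
@[simp] theorem hq_zero_imK : (0 : HQ).imK = 0 := rfl

/-- Embedding of `ℝ³` as imaginary quaternions. -/
def qiL : V3 →ₗ[ℝ] HQ where
  toFun v := ⟨0, v 0, v 1, v 2⟩
  map_add' v w := by
    refine QuaternionAlgebra.ext ?_ ?_ ?_ ?_
    · show (0:ℝ) = 0 + 0; simp
    · rfl
    · rfl
    · rfl
  map_smul' r v := by
    refine QuaternionAlgebra.ext ?_ ?_ ?_ ?_
    · show (0:ℝ) = r * 0; simp
    · rfl
    · rfl
    · rfl

/-- Embedding of `ℝ³` as imaginary quaternions. -/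
def qi : V3 →L[ℝ] HQ := LinearMap.toContinuousLinearMap qiL

/-- Vector part of a quaternion. -/
def qvL : HQ →ₗ[ℝ] V3 where
  toFun x := ![x.imI, x.imJ, x.imK]
  map_add' v w := by ext i; fin_cases i <;> simp
  map_smul' r v := by ext i; fin_cases i <;> simp

/-- Vector part of a quaternion. -/
def qv : HQ →L[ℝ] V3 := LinearMap.toContinuousLinearMap qvL

@[simp] theorem qi_re (v : V3) : (qi v).re = 0 := rfl
@[simp] theorem qi_imI (v : V3) : (qi v).imI = v 0 := rfl
@[simp] theorem qi_imJ (v : V3) : (qi v).imJ = v 1 := rfl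
@[simp] theorem qi_imK (v : V3) : (qi v).imK = v 2 := rfl
theorem qv_apply (x : HQ) : qv x = ![x.imI, x.imJ, x.imK] := rfl

theorem qv_qi (v : V3) : qv (qi v) = v := by
  ext i; fin_cases i <;> simp [qv_apply]

theorem qi_qv {x : HQ} (hx : x.re = 0) : qi (qv x) = x := by
  ext <;> simp [qv_apply, hx]

theorem star_qi (v : V3) : star (qi v) = -qi v := by
  ext <;> simp

theorem dot3 (v w : V3) : v ⬝ᵥ w = v 0 * w 0 + v 1 * w 1 + v 2 * w 2 := by
  simp [dotProduct, Fin.sum_univ_three]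

theorem mem_sph {v : V3} : v ∈ sphereS ↔ v 0 * v 0 + v 1 * v 1 + v 2 * v 2 = 1 := by
  rw [← dot3]; rfl

theorem qi_mul_self {v : V3} (hv : v ∈ sphereS) : qi v * qi v = -1 := by
  rw [mem_sph] at hv
  ext <;> simp <;> linarith

theorem normSq_qi (v : V3) : Quaternion.normSq (qi v) = v ⬝ᵥ v := by
  simp [Quaternion.normSq_def', dot3]; ring

theorem qi_mul_re (v w : V3) : (qi v * qi w).re = -(v ⬝ᵥ w) := by
  simp [dot3]; ring

theorem qi_mul_flip (v w : V3) : qi v * qi w + qi w * qi v = ((-2 * (v ⬝ᵥ w) : ℝ) : HQ) := by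
  ext <;> simp [dot3] <;> ring

theorem conj_re (x y : HQ) : (x * y * x⁻¹).re = if x = 0 then 0 else y.re := by
  by_cases hx : x = 0
  · simp [hx]
  · rw [if_neg hx]
    have h : Quaternion.normSq x ≠ 0 := Quaternion.normSq_ne_zero.2 hx
    have e : x⁻¹ = (Quaternion.normSq x)⁻¹ • star x := rfl
    rw [e, mul_smul_comm, Quaternion.re_smul, smul_eq_mul]
    have : (x * y * star x).re = Quaternion.normSq x * y.re := by
      simp [Quaternion.normSq_def']; ring
    rw [this]; field_simp

/-- Rotation of the vector `v` by the nonzero quaternion `x`. -/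
def rotq (x : HQ) (v : V3) : V3 := qv (x * qi v * x⁻¹)

theorem qi_rotq (x : HQ) (v : V3) : qi (rotq x v) = x * qi v * x⁻¹ := by
  apply qi_qv
  rw [conj_re]; simp

theorem rotq_mem {x : HQ} (hx : x ≠ 0) {v : V3} (hv : v ∈ sphereS) : rotq x v ∈ sphereS := by
  have : Quaternion.normSq (qi (rotq x v)) = 1 := by
    rw [qi_rotq, map_mul, map_mul, normSq_qi, show v ⬝ᵥ v = 1 from hv, mul_one, ← map_mul,
      mul_inv_cancel₀ hx, map_one]
  rw [normSq_qi] at this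
  exact this

theorem rotq_one (v : V3) : rotq 1 v = v := by
  simp [rotq, qv_qi]

theorem rotq_mul (x y : HQ) (v : V3) : rotq (x * y) v = rotq x (rotq y v) := by
  conv_rhs => rw [rotq, qi_rotq]
  rw [rotq, _root_.mul_inv_rev]; simp only [mul_assoc]

theorem rotq_smul {r : ℝ} (hr : r ≠ 0) (x : HQ) (v : V3) : rotq (r • x) v = rotq x v := by
  by_cases hx : x = 0
  · simp [hx]
  have : (r • x)⁻¹ = r⁻¹ • x⁻¹ := by
    apply inv_eq_of_mul_eq_one_right
    rw [smul_mul_smul_comm, mul_inv_cancel₀ hr, mul_inv_cancel₀ hx, one_smul]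
  rw [rotq, rotq, this]
  rw [smul_mul_assoc, smul_mul_smul_comm, mul_inv_cancel₀ hr, one_smul]

theorem rotq_eq {x : HQ} (hx : x ≠ 0) {v w : V3} (h : x * qi v = qi w * x) : rotq x v = w := by
  rw [rotq, h, mul_assoc, mul_inv_cancel₀ hx, mul_one, qv_qi]

theorem rotq_eq' {x : HQ} (hx : x ≠ 0) {v w : V3} (h : rotq x v = w) : x * qi v = qi w * x := by
  rw [← h, qi_rotq, mul_assoc, inv_mul_cancel₀ hx, mul_one]

theorem ContinuousOn.rotq {X : Type*} [TopologicalSpace X] {s : Set X} {f : X → HQ} {g : X → V3}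
    (hf : ContinuousOn f s) (hg : ContinuousOn g s) (h : ∀ a ∈ s, f a ≠ 0) :
    ContinuousOn (fun a => rotq (f a) (g a)) s := by
  unfold _root_.rotq
  exact qv.continuous.comp_continuousOn
    ((hf.mul (qi.continuous.comp_continuousOn hg)).mul (hf.inv₀ h))

/-- `exp (t p)` for a unit imaginary quaternion `p`. -/
def ex (p : V3) (t : ℝ) : HQ := Real.cos t • (1 : HQ) + Real.sin t • qi p

theorem ex_add {p : V3} (hp : p ∈ sphereS) (a b : ℝ) : ex p (a + b) = ex p a * ex p b := by
  rw [mem_sph] at hp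
  unfold ex
  rw [Real.cos_add, Real.sin_add]
  ext <;> simp
  · linear_combination (Real.sin a * Real.sin b) * hp
  all_goals ring

theorem ex_zero (p : V3) : ex p 0 = 1 := by simp [ex]

theorem ex_normSq {p : V3} (hp : p ∈ sphereS) (a : ℝ) : Quaternion.normSq (ex p a) = 1 := by
  rw [mem_sph] at hp
  have := Real.sin_sq_add_cos_sq a
  simp [ex, Quaternion.normSq_def']
  linear_combination (Real.sin a ^ 2) * hp + this

theorem ex_ne {p : V3} (hp : p ∈ sphereS) (a : ℝ) : ex p a ≠ 0 := by
  intro h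
  have := ex_normSq hp a
  rw [h] at this; simp at this

theorem ex_neg_mul {p : V3} (hp : p ∈ sphereS) (a : ℝ) : ex p (-a) * ex p a = 1 := by
  rw [← ex_add hp]; simp [ex_zero]

theorem ex_comm (p : V3) (a : ℝ) : ex p a * qi p = qi p * ex p a := by
  simp [ex, add_mul, mul_add]

theorem rotq_ex {p : V3} (hp : p ∈ sphereS) (a : ℝ) : rotq (ex p a) p = p :=
  rotq_eq (ex_ne hp a) (ex_comm p a)

theorem ex_contDiff (p : V3) {n : WithTop ℕ∞} : ContDiff ℝ n (ex p) := by
  unfold ex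
  exact (Real.contDiff_cos.smul contDiff_const).add (Real.contDiff_sin.smul contDiff_const)

theorem ex_continuous (p : V3) : Continuous (ex p) := (ex_contDiff p (n := 0)).continuous

theorem ex_int_period (p : V3) (m : ℤ) (a : ℝ) :
    ex p (m * (a + 2 * Real.pi)) = ex p (m * a) := by
  have : (m : ℝ) * (a + 2 * Real.pi) = m * a + m * (2 * Real.pi) := by ring
  simp [ex, this, Real.cos_add_int_mul_two_pi, Real.sin_add_int_mul_two_pi]

/-- Unit quaternions commuting with `p` are of the form `ex p κ`. -/
theorem exists_ex {p : V3} (hp : p ∈ sphereS) {x : HQ} (hx : Quaternion.normSq x = 1)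
    (hc : x * qi p = qi p * x) : ∃ κ, x = ex p κ := by
  have hp' := hp
  rw [mem_sph] at hp
  have h1 := congrArg (fun q : HQ => q.imI) hc
  have h2 := congrArg (fun q : HQ => q.imJ) hc
  have h3 := congrArg (fun q : HQ => q.imK) hc
  simp at h1 h2 h3
  set y := x.imI * p 0 + x.imJ * p 1 + x.imK * p 2 with hy
  have k1 : x.imI = y * p 0 := by
    rw [hy]; linear_combination (-x.imI) * hp + (p 1 / 2) * h3 - (p 2 / 2) * h2
  have k2 : x.imJ = y * p 1 := by
    rw [hy]; linear_combination (-x.imJ) * hp + (p 2 / 2) * h1 - (p 0 / 2) * h3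
  have k3 : x.imK = y * p 2 := by
    rw [hy]; linear_combination (-x.imK) * hp + (p 0 / 2) * h2 - (p 1 / 2) * h1
  have hn : x.re ^ 2 + y ^ 2 = 1 := by
    rw [Quaternion.normSq_def', k1, k2, k3] at hx
    linear_combination hx - y ^ 2 * hp
  have hnorm : ‖(x.re : ℂ) + (y : ℂ) * Complex.I‖ = 1 := by
    rw [Complex.norm_add_mul_I, hn, Real.sqrt_one]
  refine ⟨Complex.arg ((x.re : ℂ) + (y : ℂ) * Complex.I), ?_⟩
  have hc1 := Complex.norm_mul_cos_arg ((x.re : ℂ) + (y : ℂ) * Complex.I)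
  have hc2 := Complex.norm_mul_sin_arg ((x.re : ℂ) + (y : ℂ) * Complex.I)
  rw [hnorm] at hc1 hc2
  simp at hc1 hc2
  ext
  · simp [ex, hc1]
  · simp [ex, hc2, k1]
  · simp [ex, hc2, k2]
  · simp [ex, hc2, k3]

/-- dot product bounds -/
theorem dot_gt {v w : V3} (hv : v ∈ sphereS) (hw : w ∈ sphereS) (h : v ≠ -w) : 0 < 1 + v ⬝ᵥ w := by
  by_contra hlt
  push Not at hlt
  apply h
  rw [mem_sph] at hv hw
  rw [dot3] at hlt
  have : (v 0 + w 0) ^ 2 + (v 1 + w 1) ^ 2 + (v 2 + w 2) ^ 2 ≤ 0 := by nlinarith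
  have h0 : v 0 + w 0 = 0 := by nlinarith [sq_nonneg (v 0 + w 0), sq_nonneg (v 1 + w 1), sq_nonneg (v 2 + w 2)]
  have h1 : v 1 + w 1 = 0 := by nlinarith [sq_nonneg (v 0 + w 0), sq_nonneg (v 1 + w 1), sq_nonneg (v 2 + w 2)]
  have h2 : v 2 + w 2 = 0 := by nlinarith [sq_nonneg (v 0 + w 0), sq_nonneg (v 1 + w 1), sq_nonneg (v 2 + w 2)]
  ext i; fin_cases i <;> simp <;> linarith

/-- The quaternion `1 - ρ v p`, rotating `p` towards `v`. -/
def Lam (p : V3) (ρ : ℝ) (v : V3) : HQ := 1 - ρ • (qi v * qi p)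

theorem Lam_re (p : V3) (ρ : ℝ) (v : V3) : (Lam p ρ v).re = 1 + ρ * (v ⬝ᵥ p) := by
  rw [Lam, Quaternion.re_sub, Quaternion.re_smul, qi_mul_re]; simp

theorem Lam_re_pos {p v : V3} (hp : p ∈ sphereS) (hv : v ∈ sphereS) (h : v ≠ -p) {ρ : ℝ}
    (hρ : ρ ∈ Icc (0:ℝ) 1) : 0 < (Lam p ρ v).re := by
  rw [Lam_re]
  have := dot_gt hv hp h
  obtain ⟨h0, h1⟩ := hρ
  rcases eq_or_lt_of_le h0 with h0 | h0
  · rw [← h0]; simp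
  · nlinarith

theorem ne_zero_of_re {x : HQ} (h : 0 < x.re) : x ≠ 0 := by
  rintro rfl; simp at h

theorem Lam_one_rot {p v : V3} (hp : p ∈ sphereS) (hv : v ∈ sphereS) (h : v ≠ -p) :
    rotq (Lam p 1 v) p = v := by
  refine rotq_eq (ne_zero_of_re (Lam_re_pos hp hv h (by simp))) ?_
  rw [Lam, one_smul, sub_mul, mul_sub, mul_assoc, qi_mul_self hp, ← mul_assoc, qi_mul_self hv]
  simp [add_comm]

theorem Lam_zero (p v : V3) : Lam p 0 v = 1 := by simp [Lam]

/-- `rotq (Lam p ρ v) p` is a nonnegative combination of `p` and `v`. -/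
theorem Lam_rot {p v : V3} (hp : p ∈ sphereS) (hv : v ∈ sphereS) (h : v ≠ -p) {ρ : ℝ}
    (hρ : ρ ∈ Icc (0:ℝ) 1) : ∃ a b : ℝ, 0 ≤ a ∧ 0 ≤ b ∧ rotq (Lam p ρ v) p = a • p + b • v := by
  have hre := Lam_re_pos hp hv h hρ
  have hne := ne_zero_of_re hre
  have hN : 0 < Quaternion.normSq (Lam p ρ v) :=
    lt_of_le_of_ne Quaternion.normSq_nonneg (Quaternion.normSq_ne_zero.2 hne).symm
  set N := Quaternion.normSq (Lam p ρ v) with hNd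
  refine ⟨N⁻¹ * (1 - ρ ^ 2), N⁻¹ * (2 * ρ * (Lam p ρ v).re), ?_, ?_, ?_⟩
  · have : 0 ≤ 1 - ρ ^ 2 := by nlinarith [hρ.1, hρ.2]
    positivity
  · have := hρ.1
    positivity
  · refine rotq_eq hne ?_
    have hNe : ((N : ℝ) : HQ) = Lam p ρ v * star (Lam p ρ v) := by
      rw [Quaternion.self_mul_star]
    have e : qi ((N⁻¹ * (1 - ρ ^ 2)) • p + (N⁻¹ * (2 * ρ * (Lam p ρ v).re)) • v)
        = N⁻¹ • qi ((1 - ρ ^ 2) • p + (2 * ρ * (Lam p ρ v).re) • v) := by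
      rw [← map_smul, smul_add, smul_smul, smul_smul]
    have key : Lam p ρ v * qi p * star (Lam p ρ v) =
        qi ((1 - ρ ^ 2) • p + (2 * ρ * (Lam p ρ v).re) • v) := by
      rw [Lam_re, dot3]
      rw [mem_sph] at hp hv
      ext
      · simp [Lam]; ring
      · simp [Lam]
        grobner
      · simp [Lam]
        grobner
      · simp [Lam]
        grobner
    rw [e, ← key]
    rw [smul_mul_assoc, mul_assoc _ (star _), Quaternion.star_mul_self, ← hNd,
      Quaternion.mul_coe_eq_smul, smul_smul, inv_mul_cancel₀ hN.ne', one_smul]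

/-- A nonzero quaternion rotating `b` to `p` with nonnegative real part. -/
theorem exists_rot {b p : V3} (hb : b ∈ sphereS) (hp : p ∈ sphereS) :
    ∃ c : HQ, c ≠ 0 ∧ 0 ≤ c.re ∧ rotq c b = p := by
  by_cases h : p = -b
  · have : ∃ q : V3, q ≠ 0 ∧ q ⬝ᵥ b = 0 := by
      by_cases h0 : b 0 = 0
      · exact ⟨![1, 0, 0], fun h => by simpa using congrFun h 0, by rw [dot3]; simp [h0]⟩
      · exact ⟨![b 1, -b 0, 0], fun h => h0 (by simpa using congrFun h 1), by rw [dot3]; simp; ring⟩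
    obtain ⟨q, hq, hqb⟩ := this
    have hq' : qi q ≠ 0 := fun h => hq (by rw [← qv_qi q, h, map_zero])
    refine ⟨qi q, hq', by simp, rotq_eq hq' ?_⟩
    have := qi_mul_flip q b
    rw [hqb] at this
    simp at this
    rw [h, map_neg, neg_mul]
    exact eq_neg_of_add_eq_zero_left this
  · exact ⟨Lam b 1 p, ne_zero_of_re (Lam_re_pos hb hp h (by simp)),
      (Lam_re_pos hb hp h (by simp)).le, Lam_one_rot hb hp h⟩

/-- Map of the sphere glued from maps of the upper and lower hemispheres in polar coordinates. -/
def glue (U L : ℝ → ℝ → V3) : V3 → V3 := fun x =>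
  if 0 ≤ x 2 then U (√(1 - x 2 ^ 2)) (lon x) else L (√(1 - x 2 ^ 2)) (lon x)

/-- The domain of the homotopies. -/
def dom3 : Set (ℝ × ℝ × ℝ) := Icc 0 1 ×ˢ Icc 0 1 ×ˢ univ

theorem deg_glue {deg : (V3 → V3) → ℤ} (hdeg : DegreeTheory deg) (U L : ℝ → ℝ → ℝ → V3)
    (hU : ContinuousOn (fun q : ℝ × ℝ × ℝ => U q.1 q.2.1 q.2.2) dom3)
    (hL : ContinuousOn (fun q : ℝ × ℝ × ℝ => L q.1 q.2.1 q.2.2) dom3)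
    (hUp : ∀ τ ρ φ, U τ ρ (φ + 2 * Real.pi) = U τ ρ φ)
    (hLp : ∀ τ ρ φ, L τ ρ (φ + 2 * Real.pi) = L τ ρ φ)
    (hU0 : ∀ τ ∈ Icc (0:ℝ) 1, ∀ φ, U τ 0 φ = U τ 0 0)
    (hL0 : ∀ τ ∈ Icc (0:ℝ) 1, ∀ φ, L τ 0 φ = L τ 0 0)
    (hUL : ∀ τ ∈ Icc (0:ℝ) 1, ∀ φ, U τ 1 φ = L τ 1 φ)
    (hUs : ∀ τ ∈ Icc (0:ℝ) 1, ∀ ρ ∈ Icc (0:ℝ) 1, ∀ φ, U τ ρ φ ∈ sphereS)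
    (hLs : ∀ τ ∈ Icc (0:ℝ) 1, ∀ ρ ∈ Icc (0:ℝ) 1, ∀ φ, L τ ρ φ ∈ sphereS)
    {f g : V3 → V3} (hf : ∀ x ∈ sphereS, f x = glue (U 0) (L 0) x)
    (hg : ∀ x ∈ sphereS, g x = glue (U 1) (L 1) x) : deg f = deg g := by
  have hρ : ∀ y ∈ Icc (-1:ℝ) 1, √(1 - y ^ 2) ∈ Icc (0:ℝ) 1 := by
    intro y hy
    refine ⟨Real.sqrt_nonneg _, ?_⟩
    rw [Real.sqrt_le_left (by norm_num)]
    nlinarith [sq_nonneg y]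
  refine deg_eq_of_hom hdeg
    (fun τ y φ => if 0 ≤ y then U τ (√(1 - y ^ 2)) φ else L τ (√(1 - y ^ 2)) φ)
    ?_ ?_ ?_ ?_ ?_ f g hf hg
  · have hmap : ContinuousOn (fun q : ℝ × ℝ × ℝ => ((q.1, √(1 - q.2.1 ^ 2), q.2.2) : ℝ × ℝ × ℝ))
        (Icc 0 1 ×ˢ Icc (-1) 1 ×ˢ univ) := by fun_prop
    have hmt : MapsTo (fun q : ℝ × ℝ × ℝ => ((q.1, √(1 - q.2.1 ^ 2), q.2.2) : ℝ × ℝ × ℝ))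
        (Icc 0 1 ×ˢ Icc (-1) 1 ×ˢ univ) dom3 := fun q hq => ⟨hq.1, hρ _ hq.2.1, trivial⟩
    have h1 := hU.comp hmap hmt
    have h2 := hL.comp hmap hmt
    have hcl : IsClosed (Icc (0:ℝ) 1 ×ˢ Icc (-1:ℝ) 1 ×ˢ (univ : Set ℝ)) :=
      isClosed_Icc.prod (isClosed_Icc.prod isClosed_univ)
    have hA : IsClosed ((Icc (0:ℝ) 1 ×ˢ Icc (-1:ℝ) 1 ×ˢ (univ : Set ℝ)) ∩ {q | 0 ≤ q.2.1}) :=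
      hcl.inter (isClosed_le continuous_const (by fun_prop))
    have hB : IsClosed ((Icc (0:ℝ) 1 ×ˢ Icc (-1:ℝ) 1 ×ˢ (univ : Set ℝ)) ∩ {q | q.2.1 ≤ 0}) :=
      hcl.inter (isClosed_le (by fun_prop) continuous_const)
    have hun : (Icc (0:ℝ) 1 ×ˢ Icc (-1:ℝ) 1 ×ˢ (univ : Set ℝ)) =
        ((Icc (0:ℝ) 1 ×ˢ Icc (-1:ℝ) 1 ×ˢ (univ : Set ℝ)) ∩ {q | 0 ≤ q.2.1}) ∪
        ((Icc (0:ℝ) 1 ×ˢ Icc (-1:ℝ) 1 ×ˢ (univ : Set ℝ)) ∩ {q | q.2.1 ≤ 0}) := by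
      ext q
      constructor
      · intro h
        rcases le_total 0 q.2.1 with h' | h'
        · exact Or.inl ⟨h, h'⟩
        · exact Or.inr ⟨h, h'⟩
      · rintro (h | h)
        · exact h.1
        · exact h.1
    rw [hun]
    refine ContinuousOn.union_of_isClosed ?_ ?_ hA hB
    · refine (h1.mono inter_subset_left).congr ?_
      intro q hq
      have : 0 ≤ q.2.1 := hq.2
      simp [this]
    · refine (h2.mono inter_subset_left).congr ?_
      intro q hq
      have h0 : q.2.1 ≤ 0 := hq.2
      by_cases h : 0 ≤ q.2.1
      · have : q.2.1 = 0 := le_antisymm h0 h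
        simp [this, hUL q.1 hq.1.1]
      · simp [h]
  · intro τ _ y _ φ; simp only [hUp, hLp]
  · intro τ hτ φ
    simp [hU0 τ hτ φ]
  · intro τ hτ φ
    have h : ¬ (0:ℝ) ≤ -1 := by norm_num
    simp only [h, if_false]
    simp [hL0 τ hτ φ]
  · intro τ hτ y hy φ
    split_ifs
    · exact hUs τ hτ _ (hρ y hy) φ
    · exact hLs τ hτ _ (hρ y hy) φ

theorem deg_rot {deg : (V3 → V3) → ℤ} (hdeg : DegreeTheory deg) {p : V3} (hp : p ∈ sphereS)
    (K N : ℝ → ℝ → ℝ → HQ)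
    (hK : ContinuousOn (fun q : ℝ × ℝ × ℝ => K q.1 q.2.1 q.2.2) dom3)
    (hN : ContinuousOn (fun q : ℝ × ℝ × ℝ => N q.1 q.2.1 q.2.2) dom3)
    (hKp : ∀ τ ρ φ, K τ ρ (φ + 2 * Real.pi) = K τ ρ φ)
    (hNp : ∀ τ ρ φ, N τ ρ (φ + 2 * Real.pi) = N τ ρ φ)
    (hK0 : ∀ τ ∈ Icc (0:ℝ) 1, ∀ φ, rotq (K τ 0 φ) p = rotq (K τ 0 0) p)
    (hN0 : ∀ τ ∈ Icc (0:ℝ) 1, ∀ φ, rotq (N τ 0 φ) p = rotq (N τ 0 0) p)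
    (hKN : ∀ τ ∈ Icc (0:ℝ) 1, ∀ φ, rotq (K τ 1 φ) p = rotq (N τ 1 φ) p)
    (hKs : ∀ τ ∈ Icc (0:ℝ) 1, ∀ ρ ∈ Icc (0:ℝ) 1, ∀ φ, K τ ρ φ ≠ 0)
    (hNs : ∀ τ ∈ Icc (0:ℝ) 1, ∀ ρ ∈ Icc (0:ℝ) 1, ∀ φ, N τ ρ φ ≠ 0)
    {f g : V3 → V3}
    (hf : ∀ x ∈ sphereS, f x = glue (fun ρ φ => rotq (K 0 ρ φ) p) (fun ρ φ => rotq (N 0 ρ φ) p) x)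
    (hg : ∀ x ∈ sphereS, g x = glue (fun ρ φ => rotq (K 1 ρ φ) p) (fun ρ φ => rotq (N 1 ρ φ) p) x) :
    deg f = deg g := by
  refine deg_glue hdeg (fun τ ρ φ => rotq (K τ ρ φ) p) (fun τ ρ φ => rotq (N τ ρ φ) p)
    (hK.rotq continuousOn_const fun q hq => hKs _ hq.1 _ hq.2.1 _)
    (hN.rotq continuousOn_const fun q hq => hNs _ hq.1 _ hq.2.1 _)
    (fun τ ρ φ => by rw [hKp]) (fun τ ρ φ => by rw [hNp]) hK0 hN0 hKN
    (fun τ hτ ρ hρ φ => rotq_mem (hKs τ hτ ρ hρ φ) hp)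
    (fun τ hτ ρ hρ φ => rotq_mem (hNs τ hτ ρ hρ φ) hp) hf hg

theorem glue_congr {U U' L L' : ℝ → ℝ → V3} (hU : ∀ ρ ∈ Icc (0:ℝ) 1, ∀ φ, U ρ φ = U' ρ φ)
    (hL : ∀ ρ ∈ Icc (0:ℝ) 1, ∀ φ, L ρ φ = L' ρ φ) : ∀ x ∈ sphereS, glue U L x = glue U' L' x := by
  intro x hx
  have : √(1 - x 2 ^ 2) ∈ Icc (0:ℝ) 1 := by
    refine ⟨Real.sqrt_nonneg _, ?_⟩
    rw [Real.sqrt_le_left (by norm_num)]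
    nlinarith [sq_nonneg (x 2)]
  unfold glue
  rw [hU _ this, hL _ this]

/-- south pole -/
def bS : V3 := ![0, 0, -1]
/-- horizontal vector -/
def cS : V3 := ![0, -1, 0]

theorem bS_mem : bS ∈ sphereS := by rw [mem_sph]; simp [bS]

theorem powMap_cyl (k : ℤ) {x : V3} (hx : x ∈ sphereS) :
    powMap k x = cyl (x 2) (k * lon x) := by
  have hx2 := mem_sph.1 hx
  have hnorm : ‖(x 0 : ℂ) + (x 1 : ℂ) * Complex.I‖ = √(1 - x 2 ^ 2) := by
    rw [Complex.norm_add_mul_I]; congr 1; linear_combination hx2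
  unfold powMap
  split_ifs with h
  · rw [h] at hnorm
    simp only [norm_zero] at hnorm
    have h0 : x 0 = 0 := by simpa using congrArg Complex.re h
    have h1 : x 1 = 0 := by simpa using congrArg Complex.im h
    ext i; fin_cases i <;> simp [cyl, ← hnorm, h0, h1]
  · have e : ((x 0 : ℂ) + (x 1 : ℂ) * Complex.I) /
          (‖(x 0 : ℂ) + (x 1 : ℂ) * Complex.I‖ : ℂ) = Complex.exp (lon x * Complex.I) := by
      rw [lon, div_eq_iff (by simpa using h)]
      exact ((mul_comm _ _).trans (Complex.norm_mul_exp_arg_mul_I _)).symm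
    rw [e, ← Complex.exp_int_mul, hnorm]
    have e2 : (k : ℂ) * ((lon x : ℂ) * Complex.I) = ((k * lon x : ℝ) : ℂ) * Complex.I := by
      push_cast; ring
    rw [e2, Complex.exp_ofReal_mul_I_re, Complex.exp_ofReal_mul_I_im]
    rfl

theorem cyl_one (φ : ℝ) : cyl 1 φ = ![0, 0, 1] := by simp [cyl]
theorem cyl_neg_one (φ : ℝ) : cyl (-1) φ = ![0, 0, -1] := by simp [cyl]

/-- height function -/
def gh (ρ : ℝ) : ℝ := (1 - 2 * ρ) / (ρ ^ 2 + (1 - ρ) ^ 2)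

theorem gh_den (ρ : ℝ) : 0 < ρ ^ 2 + (1 - ρ) ^ 2 := by nlinarith [sq_nonneg (2 * ρ - 1)]

theorem gh_cont : Continuous gh := by
  unfold gh
  exact (by fun_prop : Continuous fun ρ : ℝ => 1 - 2 * ρ).div (by fun_prop) fun ρ => (gh_den ρ).ne'

theorem gh_sq {ρ : ℝ} (h : ρ ∈ Icc (0:ℝ) 1) :
    √(1 - gh ρ ^ 2) = 2 * ρ * (1 - ρ) / (ρ ^ 2 + (1 - ρ) ^ 2) := by
  have hd := gh_den ρ
  have : 1 - gh ρ ^ 2 = (2 * ρ * (1 - ρ) / (ρ ^ 2 + (1 - ρ) ^ 2)) ^ 2 := by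
    unfold gh; field_simp; ring
  rw [this, Real.sqrt_sq]
  have h1 := h.1
  have h2 : 0 ≤ 1 - ρ := by linarith [h.2]
  positivity

theorem gh_mem {ρ : ℝ} (h : ρ ∈ Icc (0:ℝ) 1) : gh ρ ∈ Icc (-1 : ℝ) 1 := by
  have hd := gh_den ρ
  unfold gh
  constructor
  · rw [le_div_iff₀ hd]; nlinarith [h.1, h.2]
  · rw [div_le_iff₀ hd]; nlinarith [h.1, h.2]

theorem rot_final (m : ℤ) {ρ : ℝ} (h : ρ ∈ Icc (0:ℝ) 1) (φ : ℝ) :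
    rotq (ρ • ex bS (m * φ) + (1 - ρ) • qi cS) bS = cyl (gh ρ) ((-m : ℤ) * φ) := by
  have hd := gh_den ρ
  have e : ((-m : ℤ) : ℝ) * φ = -(m * φ) := by push_cast; ring
  rw [e]
  have hsc := Real.sin_sq_add_cos_sq (m * φ)
  have hne : ρ • ex bS (m * φ) + (1 - ρ) • qi cS ≠ 0 := by
    intro h0
    have h1 := congrArg (fun q : HQ => q.re) h0
    have h2 := congrArg (fun q : HQ => q.imJ) h0
    have h3 := congrArg (fun q : HQ => q.imK) h0
    simp [ex, bS, cS] at h1 h2 h3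
    have : ρ = 1 := by linarith
    subst this
    simp at h1 h3
    rw [h1, h3] at hsc
    norm_num at hsc
  refine rotq_eq hne ?_
  unfold cyl
  rw [gh_sq h, Real.cos_neg, Real.sin_neg]
  unfold gh
  have hd' := hd.ne'
  clear hne
  unfold ex
  generalize Real.sin (m * φ) = S at *
  generalize Real.cos (m * φ) = C at *
  ext
  · simp [ex, bS, cS]; field_simp; first | (ring; done) | grind
  · simp [ex, bS, cS]; field_simp; first | (ring; done) | grind
  · simp [ex, bS, cS]; field_simp; first | (ring; done) | grind
  · simp [ex, bS, cS]; field_simp; first | (ring; done) | grind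

theorem deg_final {deg : (V3 → V3) → ℤ} (hdeg : DegreeTheory deg) (m : ℤ) :
    deg (glue (fun ρ φ => rotq (ρ • ex bS (m * φ) + (1 - ρ) • qi cS) bS) (fun _ _ => bS)) = -m := by
  have hpow := hdeg.2 (-m)
  rw [← hpow]
  have hg0 : ∀ y ∈ Icc (-1 : ℝ) 1, √(1 - (max y 0) ^ 2) ∈ Icc (0:ℝ) 1 := by
    intro y _
    refine ⟨Real.sqrt_nonneg _, ?_⟩
    rw [Real.sqrt_le_left (by norm_num)]
    nlinarith [sq_nonneg (max y 0)]
  refine deg_eq_of_hom hdeg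
    (fun τ y φ => cyl ((1 - τ) * gh (√(1 - (max y 0) ^ 2)) + τ * y) ((-m : ℤ) * φ))
    ?_ ?_ ?_ ?_ ?_ _ _ ?_ ?_
  · apply Continuous.continuousOn
    have h1 : Continuous fun q : ℝ × ℝ × ℝ =>
        (1 - q.1) * gh (√(1 - (max q.2.1 0) ^ 2)) + q.1 * q.2.1 := by
      have : Continuous fun q : ℝ × ℝ × ℝ => gh (√(1 - (max q.2.1 0) ^ 2)) :=
        gh_cont.comp (by fun_prop)
      fun_prop
    refine continuous_pi fun i => ?_
    fin_cases i
    · simp only [cyl]; simp; fun_prop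
    · simp only [cyl]; simp; fun_prop
    · exact h1
  · intro τ _ y _ φ
    have : ((-m : ℤ) : ℝ) * (φ + 2 * Real.pi) = (-m : ℤ) * φ + (-m : ℤ) * (2 * Real.pi) := by ring
    unfold cyl
    rw [this, Real.cos_add_int_mul_two_pi, Real.sin_add_int_mul_two_pi]
  · intro τ _ φ
    have : (1 - τ) * gh (√(1 - (max 1 0) ^ 2)) + τ * 1 = 1 := by simp [gh]
    simp only [this, cyl_one]
  · intro τ _ φ
    have : (1 - τ) * gh (√(1 - (max (-1) 0) ^ 2)) + τ * (-1) = -1 := by simp [gh]; ring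
    simp only [this, cyl_neg_one]
  · intro τ hτ y hy φ
    apply cyl_mem
    have h := gh_mem (hg0 y hy)
    obtain ⟨t0, t1⟩ := hτ
    constructor
    · nlinarith [h.1, hy.1]
    · nlinarith [h.2, hy.2]
  · intro x hx
    have hy := sph_z_mem hx
    have := hg0 _ hy
    simp only [glue]
    split_ifs with h
    · rw [max_eq_left h] at this ⊢
      rw [rot_final m this]; simp
    · rw [max_eq_right (le_of_not_ge h)]
      have e : (1 - (0:ℝ)) * gh (√(1 - 0 ^ 2)) + 0 * x 2 = -1 := by simp [gh]; norm_num
      rw [e, cyl_neg_one]; rfl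
  · intro x hx
    rw [powMap_cyl _ hx]; simp

theorem z_mem : (0:ℝ) ∈ Icc (0:ℝ) 1 := by simp
theorem o_mem : (1:ℝ) ∈ Icc (0:ℝ) 1 := by simp

theorem sum_ne {p q : V3} (hp : p ∈ sphereS) (hpq : p ⬝ᵥ q = 0) {Y : HQ}
    (hY : 0 < inner ℝ Y (qi q)) {ρ : ℝ} (hρ : ρ ∈ Icc (0:ℝ) 1) (a : ℝ) :
    ρ • ex p a + (1 - ρ) • Y ≠ 0 := by
  have hi : inner ℝ (ex p a) (qi q) = 0 := by
    rw [dot3] at hpq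
    rw [Quaternion.inner_def]
    simp [ex]
    linear_combination Real.sin a * hpq
  intro h
  have h2 : inner ℝ (ρ • ex p a + (1 - ρ) • Y) (qi q) = 0 := by rw [h, inner_zero_left]
  rw [inner_add_left, real_inner_smul_left, real_inner_smul_left, hi, mul_zero, zero_add] at h2
  have : ρ = 1 := by
    rcases mul_eq_zero.1 h2 with h | h
    · linarith
    · exact absurd h hY.ne'
  subst this
  simp at h
  exact ex_ne hp a h

theorem deg_H5 {deg : (V3 → V3) → ℤ} (hdeg : DegreeTheory deg) {p : V3} (hp : p ∈ sphereS) (m : ℤ) :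
    ∃ q : V3, q ∈ sphereS ∧ p ⬝ᵥ q = 0 ∧
    deg (glue (fun ρ φ => rotq (ρ • ex p (m * φ) + (1 - ρ) • qi q) p) (fun _ _ => p)) = -m := by
  obtain ⟨c, hc, hcre, hcp⟩ := exists_rot bS_mem hp
  have hcS : cS ∈ sphereS := by rw [mem_sph]; simp [cS]
  have hqs := rotq_mem hc hcS
  have hpq : p ⬝ᵥ rotq c cS = 0 := by
    have h1 := qi_mul_re (rotq c bS) (rotq c cS)
    have h2 : qi (rotq c bS) * qi (rotq c cS) = c * (qi bS * qi cS) * c⁻¹ := by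
      rw [qi_rotq, qi_rotq]
      calc _ = c * qi bS * (c⁻¹ * c) * qi cS * c⁻¹ := by simp only [mul_assoc]
        _ = _ := by rw [inv_mul_cancel₀ hc]; simp only [mul_assoc, mul_one]
    rw [h2, conj_re, if_neg hc, qi_mul_re, hcp] at h1
    have h3 : bS ⬝ᵥ cS = 0 := by rw [dot3]; simp [bS, cS]
    linarith
  refine ⟨rotq c cS, hqs, hpq, ?_⟩
  rw [← deg_final hdeg m]
  have hci : 0 ≤ (c⁻¹).re := by
    have : c⁻¹ = (Quaternion.normSq c)⁻¹ • star c := rfl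
    rw [this, Quaternion.re_smul, Quaternion.re_star, smul_eq_mul]
    exact mul_nonneg (inv_nonneg.2 Quaternion.normSq_nonneg) hcre
  have hX : ∀ τ ∈ Icc (0:ℝ) 1, ((1 - τ) • (1:HQ) + τ • c⁻¹) ≠ 0 := by
    intro τ hτ h
    have h1 := congrArg (fun q : HQ => q.re) h
    simp at h1
    have : τ = 1 := by nlinarith [hτ.1, hτ.2, mul_nonneg hτ.1 hci]
    subst this
    simp at h
    exact hc h
  have hYn : ∀ ρ ∈ Icc (0:ℝ) 1, ∀ φ : ℝ, ρ • ex p (m * φ) + (1 - ρ) • qi (rotq c cS) ≠ 0 := by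
    intro ρ hρ φ
    refine sum_ne hp hpq ?_ hρ _
    rw [real_inner_self_eq_norm_mul_norm, ← Quaternion.normSq_eq_norm_mul_self, normSq_qi,
      show _ = (1:ℝ) from hqs]
    norm_num
  have hec := ex_continuous p
  refine deg_rot hdeg hp
    (fun τ ρ φ => ((1 - τ) • (1:HQ) + τ • c⁻¹) * (ρ • ex p (m * φ) + (1 - ρ) • qi (rotq c cS)))
    (fun τ ρ φ => ((1 - τ) • (1:HQ) + τ • c⁻¹)) ?_ ?_ ?_ ?_ ?_ ?_ ?_ ?_ ?_ ?_ ?_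
  · apply Continuous.continuousOn; fun_prop
  · apply Continuous.continuousOn; fun_prop
  · intro τ ρ φ; simp only [ex_int_period]
  · intro τ ρ φ; rfl
  · intro τ hτ φ; simp
  · intro τ hτ φ; simp
  · intro τ hτ φ
    simp only [one_smul, sub_self, zero_smul, add_zero]
    rw [rotq_mul, rotq_ex hp]
  · intro τ hτ ρ hρ φ
    exact mul_ne_zero (hX τ hτ) (hYn ρ hρ φ)
  · intro τ hτ ρ hρ φ
    exact hX τ hτ
  · apply glue_congr
    · intro ρ hρ φ; simp
    · intro ρ hρ φ; simp [rotq_one]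
  · have hcb : rotq c⁻¹ p = bS := by
      rw [← hcp, ← rotq_mul, inv_mul_cancel₀ hc, rotq_one]
    apply glue_congr
    · intro ρ hρ φ
      have e : ex p (m * φ) = c * ex bS (m * φ) * c⁻¹ := by
        rw [ex, ex, mul_add, add_mul, mul_smul_comm, smul_mul_assoc, mul_one,
          mul_inv_cancel₀ hc, mul_smul_comm, smul_mul_assoc, ← qi_rotq, hcp]
      have e2 : ((1 - (1:ℝ)) • (1:HQ) + (1:ℝ) • c⁻¹) *
          (ρ • ex p (m * φ) + (1 - ρ) • qi (rotq c cS)) =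
          (ρ • ex bS (m * φ) + (1 - ρ) • qi cS) * c⁻¹ := by
        rw [e, qi_rotq]
        simp only [sub_self, zero_smul, one_smul, zero_add, mul_add, add_mul, mul_smul_comm,
          smul_mul_assoc, ← mul_assoc, inv_mul_cancel₀ hc, one_mul]
      rw [e2, rotq_mul, hcb]
    · intro ρ hρ φ; simp [hcb]

theorem deg_H3 {deg : (V3 → V3) → ℤ} (hdeg : DegreeTheory deg) {p : V3} (hp : p ∈ sphereS) (m : ℤ)
    (W : ℝ → ℝ → HQ) (hW : ContinuousOn (fun q : ℝ × ℝ => W q.1 q.2) (Icc 0 1 ×ˢ univ))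
    (hWn : ∀ t ∈ Icc (0:ℝ) 1, ∀ φ, ‖W t φ‖ = 1)
    (hWp : ∀ t φ, W t (φ + 2 * Real.pi) = W t φ)
    (hW0 : ∀ φ, W 0 φ = W 0 0) (hW1 : ∀ φ, W 1 φ = ex p (m * φ))
    (hdense : Dense {P : HQ | ∀ r : ℝ, ∀ t ∈ Icc (0:ℝ) 1, ∀ φ, r • W t φ ≠ P}) :
    deg (glue (fun ρ φ => rotq (W ρ φ) p) (fun _ _ => p)) = -m := by
  obtain ⟨q, hq, hpq, hdegq⟩ := deg_H5 hdeg hp m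
  rw [← hdegq]
  have hqq : inner ℝ (qi q) (qi q) = 1 := by
    rw [real_inner_self_eq_norm_mul_norm, ← Quaternion.normSq_eq_norm_mul_self, normSq_qi]
    exact hq
  obtain ⟨P, hPn, hPd⟩ := hdense.exists_mem_open (U := {P : HQ | inner ℝ P (qi q) < 0})
    (isOpen_lt (by fun_prop) continuous_const) ⟨-qi q, by
      show inner ℝ (-qi q) (qi q) < 0
      rw [inner_neg_left, hqq]; norm_num⟩
  have hPn : 0 < inner ℝ (-P) (qi q) := by
    rw [inner_neg_left]; linarith [show inner ℝ P (qi q) < 0 from by assumption]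
  have hec := ex_continuous p
  have hWne : ∀ t ∈ Icc (0:ℝ) 1, ∀ φ, W t φ ≠ 0 := by
    intro t ht φ h
    have := hWn t ht φ
    rw [h, norm_zero] at this
    norm_num at this
  -- the cone homotopy
  have hMpos : ∀ τ ∈ Icc (0:ℝ) 1, ∀ ρ ∈ Icc (0:ℝ) 1, 0 ≤ max ρ (1 - τ) ∧ max ρ (1 - τ) ≤ 1 ∧
      ρ / max ρ (1 - τ) ∈ Icc (0:ℝ) 1 := by
    intro τ hτ ρ hρ
    have h1 : 0 ≤ max ρ (1 - τ) := le_max_of_le_left hρ.1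
    refine ⟨h1, max_le hρ.2 (by linarith [hτ.1]), div_nonneg hρ.1 h1, ?_⟩
    exact div_le_one_of_le₀ (le_max_left _ _) h1
  have step1 : deg (glue (fun ρ φ => rotq (W ρ φ) p) (fun _ _ => p)) =
      deg (glue (fun ρ φ => rotq (ρ • ex p (m * φ) + (1 - ρ) • (-P)) p) (fun _ _ => p)) := by
    refine deg_rot hdeg hp
      (fun τ ρ φ => max ρ (1 - τ) • W (ρ / max ρ (1 - τ)) φ + (1 - max ρ (1 - τ)) • (-P))
      (fun τ ρ φ => 1) ?_ continuousOn_const ?_ ?_ ?_ ?_ ?_ ?_ ?_ ?_ ?_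
    · have h2 : ContinuousOn (fun q : ℝ × ℝ × ℝ =>
          max q.2.1 (1 - q.1) • W (q.2.1 / max q.2.1 (1 - q.1)) q.2.2) dom3 := by
        rintro ⟨τ, ρ, φ⟩ hx
        have hM := hMpos τ hx.1 ρ hx.2.1
        have hMc : Continuous (fun q : ℝ × ℝ × ℝ => max q.2.1 (1 - q.1)) := by fun_prop
        by_cases h0 : max ρ (1 - τ) = 0
        · have e : max ρ (1 - τ) • W (ρ / max ρ (1 - τ)) φ = 0 := by rw [h0, zero_smul]
          unfold ContinuousWithinAt
          simp only [e]
          refine squeeze_zero_norm' (a := fun q : ℝ × ℝ × ℝ => max q.2.1 (1 - q.1)) ?_ ?_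
          · filter_upwards [self_mem_nhdsWithin] with y hy
            have hMy := hMpos y.1 hy.1 y.2.1 hy.2.1
            rw [norm_smul, hWn _ hMy.2.2, mul_one, Real.norm_eq_abs, abs_of_nonneg hMy.1]
          · have := hMc.continuousWithinAt (s := dom3) (x := (τ, ρ, φ))
            unfold ContinuousWithinAt at this
            simpa only [h0] using this
        · refine (hMc.continuousWithinAt).smul ?_
          have hd : ContinuousWithinAt (fun q : ℝ × ℝ × ℝ =>
              ((q.2.1 / max q.2.1 (1 - q.1), q.2.2) : ℝ × ℝ)) dom3 (τ, ρ, φ) := by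
            refine ContinuousWithinAt.prodMk ?_ (by fun_prop)
            exact ContinuousWithinAt.div (by fun_prop) hMc.continuousWithinAt h0
          refine ContinuousWithinAt.comp (t := Icc 0 1 ×ˢ univ)
            (g := fun q : ℝ × ℝ => W q.1 q.2) (hW _ ⟨hM.2.2, trivial⟩) hd ?_
          intro y hy
          exact ⟨(hMpos y.1 hy.1 y.2.1 hy.2.1).2.2, trivial⟩
      exact h2.add (Continuous.continuousOn (by fun_prop))
    · intro τ ρ φ; simp only [hWp]
    · intro τ ρ φ; rfl
    · intro τ hτ φ; simp only [zero_div, hW0 φ]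
    · intro τ hτ φ; rfl
    · intro τ hτ φ
      have : max 1 (1 - τ) = 1 := max_eq_left (by linarith [hτ.1])
      simp only [this, div_one, hW1, one_smul, sub_self, zero_smul, add_zero]
      rw [rotq_ex hp, rotq_one]
    · intro τ hτ ρ hρ φ
      have hM := hMpos τ hτ ρ hρ
      generalize max ρ (1 - τ) = M at *
      intro h
      rcases eq_or_lt_of_le hM.2.1 with h1 | h1
      · subst h1
        simp only [one_smul, sub_self, zero_smul, add_zero] at h
        exact hWne _ hM.2.2 _ h
      · have hpos : 0 < 1 - M := by linarith
        refine (by assumption : ∀ r : ℝ, ∀ t ∈ Icc (0:ℝ) 1, ∀ φ, r • W t φ ≠ P)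
          ((1 - M)⁻¹ * M) _ hM.2.2 φ ?_
        rw [smul_neg, add_neg_eq_zero] at h
        rw [mul_smul, h, smul_smul, inv_mul_cancel₀ hpos.ne', one_smul]
    · intro τ hτ ρ hρ φ; exact one_ne_zero
    · apply glue_congr
      · intro ρ hρ φ
        have : max ρ (1 - 0) = 1 := by rw [sub_zero]; exact max_eq_right hρ.2
        simp only [this, div_one, one_smul, sub_self, zero_smul, add_zero]
      · intro ρ hρ φ; rw [rotq_one]
    · apply glue_congr
      · intro ρ hρ φ
        have : max ρ (1 - 1) = ρ := by rw [sub_self]; exact max_eq_left hρ.1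
        simp only [this]
        rcases eq_or_ne ρ 0 with h | h
        · simp [h]
        · rw [div_self h, hW1]
      · intro ρ hρ φ; rw [rotq_one]
  rw [step1]
  have hYpos : ∀ τ ∈ Icc (0:ℝ) 1, 0 < inner ℝ ((1 - τ) • (-P) + τ • qi q) (qi q) := by
    intro τ hτ
    rw [inner_add_left, real_inner_smul_left, real_inner_smul_left, hqq]
    rcases eq_or_lt_of_le hτ.1 with h | h
    · rw [← h]; simpa using hPn
    · nlinarith [hτ.2]
  refine deg_rot hdeg hp
      (fun τ ρ φ => ρ • ex p (m * φ) + (1 - ρ) • ((1 - τ) • (-P) + τ • qi q))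
      (fun τ ρ φ => 1) ?_ continuousOn_const ?_ ?_ ?_ ?_ ?_ ?_ ?_ ?_ ?_
  · apply Continuous.continuousOn; fun_prop
  · intro τ ρ φ; simp only [ex_int_period]
  · intro τ ρ φ; rfl
  · intro τ hτ φ; simp
  · intro τ hτ φ; rfl
  · intro τ hτ φ
    simp only [one_smul, sub_self, zero_smul, add_zero]
    rw [rotq_ex hp, rotq_one]
  · intro τ hτ ρ hρ φ
    exact sum_ne hp hpq (hYpos τ hτ) hρ _
  · intro τ hτ ρ hρ φ; exact one_ne_zero
  · apply glue_congr
    · intro ρ hρ φ; simp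
    · intro ρ hρ φ; rw [rotq_one]
  · apply glue_congr
    · intro ρ hρ φ; simp
    · intro ρ hρ φ; rw [rotq_one]

theorem star_Lam (p : V3) (t : ℝ) (v : V3) : star (Lam p t v) = 1 - t • (qi p * qi v) := by
  rw [Lam, star_sub, star_one, Quaternion.star_smul, star_mul, star_qi, star_qi]; simp

/-- conjugating `p` by `a - b v p`. -/
theorem slerp_conj {p v : V3} (hp : p ∈ sphereS) (hv : v ∈ sphereS) (a b : ℝ) :
    (a • (1:HQ) - b • (qi v * qi p)) * qi p * star (a • (1:HQ) - b • (qi v * qi p)) =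
      qi ((a ^ 2 - b ^ 2) • p + (2 * b * (a + b * (v ⬝ᵥ p))) • v) := by
  have h1 : (a • (1:HQ) - b • (qi v * qi p)) * qi p = a • qi p + b • qi v := by
    rw [sub_mul, smul_mul_assoc, smul_mul_assoc, mul_assoc, qi_mul_self hp]; simp
  have h2 : star (a • (1:HQ) - b • (qi v * qi p)) = a • (1:HQ) - b • (qi p * qi v) := by
    rw [star_sub, Quaternion.star_smul, Quaternion.star_smul, star_one, star_mul, star_qi, star_qi]; simp
  have h3 : qi p * (qi p * qi v) = - qi v := by rw [← mul_assoc, qi_mul_self hp]; simp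
  have h4 : qi v * (qi p * qi v) = qi p - (2 * (v ⬝ᵥ p)) • qi v := by
    have := qi_mul_flip v p
    have h5 : qi v * qi p = ((-2 * (v ⬝ᵥ p) : ℝ) : HQ) - qi p * qi v := by rw [← this]; abel
    rw [← mul_assoc, h5, sub_mul, mul_assoc, qi_mul_self hv, Quaternion.coe_mul_eq_smul]
    rw [mul_neg, mul_one, sub_neg_eq_add, neg_mul, neg_smul]; abel
  rw [h1, h2, add_mul, mul_sub, mul_sub, map_add, map_smul, map_smul]
  simp only [smul_mul_assoc, mul_smul_comm, mul_one, h3, h4]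
  module

theorem slerp_normSq {p v : V3} (hp : p ∈ sphereS) (hv : v ∈ sphereS) (a b : ℝ) :
    Quaternion.normSq (a • (1:HQ) - b • (qi v * qi p)) = a ^ 2 + b ^ 2 + 2 * a * b * (v ⬝ᵥ p) := by
  rw [mem_sph] at hp hv
  rw [Quaternion.normSq_def', dot3]
  simp
  have : (v 0 * v 0 + v 1 * v 1 + v 2 * v 2) * (p 0 * p 0 + p 1 * p 1 + p 2 * p 2) = 1 := by
    rw [hp, hv]; norm_num
  linear_combination b ^ 2 * this

theorem rotq_of_conj {x : HQ} (hx : x ≠ 0) {p w : V3}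
    (h : x * qi p * star x = qi (Quaternion.normSq x • w)) : rotq x p = w := by
  have e : x⁻¹ = (Quaternion.normSq x)⁻¹ • star x := rfl
  have hN : Quaternion.normSq x ≠ 0 := Quaternion.normSq_ne_zero.2 hx
  rw [rotq, e, mul_smul_comm, h, map_smul, qv_qi, smul_smul, inv_mul_cancel₀ hN, one_smul]

/-- quaternion rotating `p` to `geo p v ρ`. -/
def geoq (p v : V3) (ρ : ℝ) : HQ :=
  ((1 - ρ / 2) * Real.sinc ((1 - ρ / 2) * Real.arccos (p ⬝ᵥ v))) • (1:HQ) -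
    (ρ / 2 * Real.sinc (ρ / 2 * Real.arccos (p ⬝ᵥ v))) • (qi v * qi p)

theorem mul_sinc (x y : ℝ) : y * (x * Real.sinc (x * y)) = Real.sin (x * y) := by
  by_cases h : x * y = 0
  · rw [h]; simp; rcases mul_eq_zero.1 h with h | h <;> simp [h]
  · rw [Real.sinc_of_ne_zero h]
    have hx := left_ne_zero_of_mul h
    have hy := right_ne_zero_of_mul h
    field_simp

theorem geoq_re_pos {p v : V3} (hp : p ∈ sphereS) (hv : v ∈ sphereS) (h : v ≠ -p) {ρ : ℝ}
    (hρ : ρ ∈ Icc (0:ℝ) 1) : 0 < (geoq p v ρ).re := by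
  have hd : 0 < 1 + v ⬝ᵥ p := dot_gt hv hp h
  rw [dotProduct_comm] at hd
  have hle : p ⬝ᵥ v ≤ 1 := by
    rw [mem_sph] at hp hv
    rw [dot3]
    nlinarith [sq_nonneg (p 0 - v 0), sq_nonneg (p 1 - v 1), sq_nonneg (p 2 - v 2)]
  have hcos : Real.cos (Real.arccos (p ⬝ᵥ v)) = p ⬝ᵥ v := Real.cos_arccos (by linarith) hle
  have hα0 : 0 ≤ Real.arccos (p ⬝ᵥ v) := Real.arccos_nonneg _
  have hαπ : Real.arccos (p ⬝ᵥ v) < Real.pi := by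
    rcases lt_or_eq_of_le (Real.arccos_le_pi (p ⬝ᵥ v)) with h | h
    · exact h
    · rw [h, Real.cos_pi] at hcos; linarith
  have hre : (geoq p v ρ).re = (1 - ρ / 2) * Real.sinc ((1 - ρ / 2) * Real.arccos (p ⬝ᵥ v)) +
      (ρ / 2 * Real.sinc (ρ / 2 * Real.arccos (p ⬝ᵥ v))) * (p ⬝ᵥ v) := by
    rw [geoq, Quaternion.re_sub, Quaternion.re_smul, Quaternion.re_smul, qi_mul_re,
      dotProduct_comm v p]; simp
  rw [hre]
  rcases eq_or_lt_of_le hα0 with h0 | h0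
  · rw [← h0] at hcos ⊢
    rw [Real.cos_zero] at hcos
    rw [← hcos]; simp
  · set α := Real.arccos (p ⬝ᵥ v)
    have h1 := mul_sinc (1 - ρ / 2) α
    have h2 := mul_sinc (ρ / 2) α
    have key : α * ((1 - ρ / 2) * Real.sinc ((1 - ρ / 2) * α) +
      (ρ / 2 * Real.sinc (ρ / 2 * α)) * (p ⬝ᵥ v)) = Real.sin α * Real.cos (ρ / 2 * α) := by
      rw [mul_add, ← mul_assoc α (ρ / 2 * _), h1, h2, ← hcos]
      have : (1 - ρ / 2) * α = α - ρ / 2 * α := by ring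
      rw [this, Real.sin_sub]; ring
    have hpos : 0 < Real.sin α * Real.cos (ρ / 2 * α) := by
      refine mul_pos (Real.sin_pos_of_pos_of_lt_pi h0 hαπ) (Real.cos_pos_of_mem_Ioo ⟨?_, ?_⟩)
      · have := mul_nonneg (by linarith [hρ.1] : 0 ≤ ρ / 2) h0.le
        linarith [Real.pi_pos]
      · nlinarith [hρ.1, hρ.2]
    rw [← key] at hpos
    exact pos_of_mul_pos_right hpos h0.le

theorem geoq_rot {p v : V3} (hp : p ∈ sphereS) (hv : v ∈ sphereS) (h : v ≠ -p) {ρ : ℝ}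
    (hρ : ρ ∈ Icc (0:ℝ) 1) : rotq (geoq p v ρ) p = geo p v ρ := by
  have hne := ne_zero_of_re (geoq_re_pos hp hv h hρ)
  unfold geo
  split_ifs with hpv
  · refine rotq_eq hne ?_
    rw [← hpv]
    unfold geoq
    rw [qi_mul_self hp]; simp [sub_mul, mul_sub, add_mul, mul_add]
  · have hd : 0 < 1 + v ⬝ᵥ p := dot_gt hv hp h
    have hd2 : 0 < 1 + p ⬝ᵥ (-v) := by
      refine dot_gt hp ?_ (by simpa using hpv)
      rw [mem_sph] at hv ⊢; simpa using hv
    rw [dotProduct_neg] at hd2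
    rw [dotProduct_comm] at hd
    have hcos : Real.cos (Real.arccos (p ⬝ᵥ v)) = p ⬝ᵥ v :=
      Real.cos_arccos (by linarith) (by linarith)
    have h0 : 0 < Real.arccos (p ⬝ᵥ v) := Real.arccos_pos.2 (by linarith)
    have hs : 0 < Real.sin (Real.arccos (p ⬝ᵥ v)) := by
      rw [Real.sin_arccos]; apply Real.sqrt_pos.2; nlinarith
    apply rotq_of_conj hne
    have hns : Quaternion.normSq (geoq p v ρ) =
      (Real.sin (Real.arccos (p ⬝ᵥ v)) / Real.arccos (p ⬝ᵥ v)) ^ 2 := ?_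
    · rw [hns, geoq, slerp_conj hp hv, dotProduct_comm v p]
      congr 1
      set α := Real.arccos (p ⬝ᵥ v)
      have h1 := mul_sinc (1 - ρ / 2) α
      have h2 := mul_sinc (ρ / 2) α
      rw [smul_add, smul_smul, smul_smul]
      have e1 : (1 - ρ / 2) * Real.sinc ((1 - ρ / 2) * α) = Real.sin ((1 - ρ / 2) * α) / α := by
        rw [← h1]; field_simp
      have e2 : (ρ / 2) * Real.sinc ((ρ / 2) * α) = Real.sin ((ρ / 2) * α) / α := by
        rw [← h2]; field_simp
      rw [e1, e2, ← hcos]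
      have a1 : (1 - ρ / 2) * α = α - ρ / 2 * α := by ring
      have a2 : (1 - ρ) * α = α - 2 * (ρ / 2 * α) := by ring
      have a3 : ρ * α = 2 * (ρ / 2 * α) := by ring
      have hx := Real.sin_sq_add_cos_sq (ρ / 2 * α)
      have hy := Real.sin_sq_add_cos_sq α
      rw [a1, a2, a3, Real.sin_sub, Real.sin_sub, Real.sin_two_mul, Real.cos_two_mul]
      generalize Real.sin (ρ / 2 * α) = S at *
      generalize Real.cos (ρ / 2 * α) = C at *
      generalize Real.sin α = T at *
      generalize Real.cos α = D at *
      congr 1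
      · congr 1
        field_simp
        first | linear_combination S ^ 2 * hy - T ^ 2 * hx | linear_combination T ^ 2 * hx - S ^ 2 * hy
      · congr 1
        field_simp
        ring
    · rw [geoq, slerp_normSq hp hv, dotProduct_comm v p]
      set α := Real.arccos (p ⬝ᵥ v)
      have h1 := mul_sinc (1 - ρ / 2) α
      have h2 := mul_sinc (ρ / 2) α
      have e1 : (1 - ρ / 2) * Real.sinc ((1 - ρ / 2) * α) = Real.sin ((1 - ρ / 2) * α) / α := by
        rw [← h1]; field_simp
      have e2 : (ρ / 2) * Real.sinc ((ρ / 2) * α) = Real.sin ((ρ / 2) * α) / α := by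
        rw [← h2]; field_simp
      rw [e1, e2, ← hcos]
      have a1 : (1 - ρ / 2) * α = α - ρ / 2 * α := by ring
      have hx := Real.sin_sq_add_cos_sq (ρ / 2 * α)
      have hy := Real.sin_sq_add_cos_sq α
      rw [a1, Real.sin_sub]
      generalize Real.sin (ρ / 2 * α) = S at *
      generalize Real.cos (ρ / 2 * α) = C at *
      generalize Real.sin α = T at *
      generalize Real.cos α = D at *
      field_simp
      linear_combination T ^ 2 * hx - S ^ 2 * hy

theorem geoq_cont {X : Type*} [TopologicalSpace X] {s : Set X} {p : V3} {v : X → V3} {r : X → ℝ}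
    (hv : ContinuousOn v s) (hr : ContinuousOn r s) :
    ContinuousOn (fun x => geoq p (v x) (r x)) s := by
  have hd : ContinuousOn (fun x => Real.arccos (p ⬝ᵥ v x)) s := by
    refine Real.continuous_arccos.comp_continuousOn ?_
    have : Continuous fun w : V3 => p ⬝ᵥ w := by
      simp only [dot3]; fun_prop
    exact this.comp_continuousOn hv
  have hq : ContinuousOn (fun x => qi (v x)) s := qi.continuous.comp_continuousOn hv
  have hsc := Real.continuous_sinc
  have h1 : ContinuousOn (fun x => Real.sinc ((1 - r x / 2) * Real.arccos (p ⬝ᵥ v x))) s :=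
    hsc.comp_continuousOn (by fun_prop)
  have h2 : ContinuousOn (fun x => Real.sinc (r x / 2 * Real.arccos (p ⬝ᵥ v x))) s :=
    hsc.comp_continuousOn (by fun_prop)
  unfold geoq
  fun_prop

/-- the smooth outer map used in the dimension argument -/
def Psi (p : V3) (x : ℝ × ℝ × V3 × HQ × ℝ) : HQ :=
  x.1 • ((1 - x.2.1 • (qi p * qi x.2.2.1)) * x.2.2.2.1 * ex p (-(x.2.1 * x.2.2.2.2)))

theorem Psi_contDiff (p : V3) : ContDiff ℝ 1 (Psi p) := by
  have h := ex_contDiff p (n := 1)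
  have h2 : ContDiff ℝ 1 fun v => qi v := qi.contDiff
  unfold Psi
  have hx1 : ContDiff ℝ 1 fun x : ℝ × ℝ × V3 × HQ × ℝ => x.2.1 := by fun_prop
  have hx0 : ContDiff ℝ 1 fun x : ℝ × ℝ × V3 × HQ × ℝ => x.1 := by fun_prop
  have h3 : ContDiff ℝ 1 fun x : ℝ × ℝ × V3 × HQ × ℝ => ex p (-(x.2.1 * x.2.2.2.2)) :=
    h.comp (by fun_prop)
  have h4 : ContDiff ℝ 1 fun x : ℝ × ℝ × V3 × HQ × ℝ => qi p * qi x.2.2.1 :=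
    contDiff_const.mul (h2.comp (by fun_prop))
  have h5 : ContDiff ℝ 1 fun x : ℝ × ℝ × V3 × HQ × ℝ =>
      (1 - x.2.1 • (qi p * qi x.2.2.1)) * x.2.2.2.1 := by
    refine ContDiff.mul (contDiff_const.sub ?_) (by fun_prop)
    exact hx1.smul h4
  exact hx0.smul (h5.mul h3)

theorem dense_cone (p : V3) (F : ℝ → ℝ → HQ) (v : ℝ → V3) (δ : ℝ → ℝ) {C1 C2 C3 : ℝ≥0}
    (hF : LipschitzOnWith C1 (fun q : ℝ × ℝ => F q.1 q.2) (Icc 0 1 ×ˢ univ))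
    (hv : LipschitzWith C2 v) (hδ : LipschitzWith C3 δ) :
    Dense {P : HQ | ∀ r : ℝ, ∀ t ∈ Icc (0:ℝ) 1, ∀ φ, Psi p (r, t, v φ, F t φ, δ φ) ≠ P} := by
  set S : Set (ℝ × ℝ × ℝ) := univ ×ˢ Icc 0 1 ×ˢ univ with hS
  set I : ℝ × ℝ × ℝ → ℝ × ℝ × V3 × HQ × ℝ :=
    fun x => (x.1, x.2.1, v x.2.2, F x.2.1 x.2.2, δ x.2.2) with hI
  have l1 : LipschitzWith 1 (fun x : ℝ × ℝ × ℝ => x.1) := LipschitzWith.prod_fst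
  have l2 : LipschitzWith (1 * 1) (fun x : ℝ × ℝ × ℝ => x.2.1) :=
    LipschitzWith.prod_fst.comp LipschitzWith.prod_snd
  have l3 : LipschitzWith (1 * 1) (fun x : ℝ × ℝ × ℝ => x.2.2) :=
    LipschitzWith.prod_snd.comp LipschitzWith.prod_snd
  have l4 : LipschitzOnWith (C1 * 1) (fun x : ℝ × ℝ × ℝ => F x.2.1 x.2.2) S := by
    refine hF.comp (LipschitzWith.prod_snd.lipschitzOnWith) ?_
    intro x hx
    exact hx.2
  obtain ⟨CI, hIL⟩ : ∃ C, LipschitzOnWith C I S :=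
    ⟨_, l1.lipschitzOnWith.prodMk (l2.lipschitzOnWith.prodMk
      ((hv.comp l3).lipschitzOnWith.prodMk (l4.prodMk (hδ.comp l3).lipschitzOnWith)))⟩
  have hdim : dimH ((Psi p ∘ I) '' S) ≤ dimH S := by
    apply dimH_image_le_of_locally_lipschitzOn
    intro x hx
    obtain ⟨K, U, hU, hK⟩ := (Psi_contDiff p).contDiffAt (x := I x) |>.exists_lipschitzOnWith
    refine ⟨K * CI, I ⁻¹' U ∩ S, Filter.inter_mem ?_ self_mem_nhdsWithin, ?_⟩
    · exact (hIL.continuousOn x hx).preimage_mem_nhdsWithin hU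
    · exact hK.comp (hIL.mono inter_subset_right) fun y hy => hy.1
  have hdim3 : dimH S ≤ 3 := by
    refine (dimH_mono (subset_univ S)).trans ?_
    rw [Real.dimH_univ_eq_finrank]
    simp
  have hlt : dimH ((Psi p ∘ I) '' S) < Module.finrank ℝ HQ := by
    rw [Quaternion.finrank_eq_four]
    refine lt_of_le_of_lt (hdim.trans hdim3) ?_
    norm_num
  refine (dense_compl_of_dimH_lt_finrank hlt).mono ?_
  intro P hP r t ht φ h
  exact hP ⟨(r, t, φ), ⟨trivial, ht, trivial⟩, h⟩

theorem deg_lift {deg : (V3 → V3) → ℤ} (hdeg : DegreeTheory deg) {p : V3} (hp : p ∈ sphereS) (m : ℤ)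
    (F : ℝ → ℝ → HQ) (v : ℝ → V3) (δ : ℝ → ℝ) {C1 C2 C3 : ℝ≥0}
    (hF : LipschitzOnWith C1 (fun q : ℝ × ℝ => F q.1 q.2) (Icc 0 1 ×ˢ univ))
    (hv : LipschitzWith C2 v) (hδ : LipschitzWith C3 δ)
    (hFn : ∀ t ∈ Icc (0:ℝ) 1, ∀ φ, ‖F t φ‖ = 1)
    (hFp : ∀ t φ, F t (φ + 2 * Real.pi) = F t φ)
    (hF0 : ∀ φ, F 0 φ = F 0 0)
    (hδp : ∀ φ, δ (φ + 2 * Real.pi) = δ φ)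
    (hvF : ∀ φ, rotq (F 1 φ) p = v φ) (hvp : ∀ φ, v φ ≠ -p)
    (hE : ∀ φ, F 1 φ = (‖Lam p 1 (v φ)‖⁻¹ • Lam p 1 (v φ)) * ex p (m * φ + δ φ))
    (θ : ℝ → ℝ) (hθ : Continuous θ) (hθp : ∀ φ, θ (φ + 2 * Real.pi) = θ φ + 2 * Real.pi)
    {f : V3 → V3} (hf : ∀ x ∈ sphereS, f x = glue (fun ρ φ => rotq (F ρ (θ φ)) p)
      (fun ρ φ => geo p (v (θ φ)) ρ) x) : deg f = -m := by
  have hFne : ∀ t ∈ Icc (0:ℝ) 1, ∀ φ, F t φ ≠ 0 := by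
    intro t ht φ h
    have := hFn t ht φ
    rw [h, norm_zero] at this
    norm_num at this
  have hvs : ∀ φ, v φ ∈ sphereS := fun φ => by
    rw [← hvF]; exact rotq_mem (hFne 1 o_mem φ) hp
  have hvper : ∀ φ, v (φ + 2 * Real.pi) = v φ := fun φ => by rw [← hvF, ← hvF, hFp]
  have hLpos : ∀ t ∈ Icc (0:ℝ) 1, ∀ φ, 0 < (Lam p t (v φ)).re := fun t ht φ =>
    Lam_re_pos hp (hvs φ) (hvp φ) ht
  have hLne : ∀ t ∈ Icc (0:ℝ) 1, ∀ φ, Lam p t (v φ) ≠ 0 := fun t ht φ => ne_zero_of_re (hLpos t ht φ)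
  have hqv : Continuous fun φ => qi (v φ) := qi.continuous.comp hv.continuous
  have hLc : Continuous fun q : ℝ × ℝ => Lam p q.1 (v q.2) := by
    unfold Lam
    have : Continuous fun q : ℝ × ℝ => qi (v q.2) := hqv.comp continuous_snd
    fun_prop
  -- stage one
  have step1 : deg f = deg (glue (fun ρ φ => rotq (F ρ φ) p)
      (fun ρ φ => rotq (Lam p ρ (v φ)) p)) := by
    have hθτ : Continuous fun q : ℝ × ℝ × ℝ => (1 - q.1) * θ q.2.2 + q.1 * q.2.2 := by fun_prop
    have hper : ∀ τ φ, (1 - τ) * θ (φ + 2 * Real.pi) + τ * (φ + 2 * Real.pi) =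
        ((1 - τ) * θ φ + τ * φ) + 2 * Real.pi := by
      intro τ φ; rw [hθp]; ring
    refine deg_rot hdeg hp (fun τ ρ φ => F ρ ((1 - τ) * θ φ + τ * φ))
      (fun τ ρ φ => (1 - τ) • geoq p (v ((1 - τ) * θ φ + τ * φ)) ρ +
        τ • Lam p ρ (v ((1 - τ) * θ φ + τ * φ))) ?_ ?_ ?_ ?_ ?_ ?_ ?_ ?_ ?_ ?_ ?_
    · exact hF.continuousOn.comp
        (f := fun q : ℝ × ℝ × ℝ => ((q.2.1, (1 - q.1) * θ q.2.2 + q.1 * q.2.2) : ℝ × ℝ))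
        (Continuous.continuousOn (by fun_prop)) (fun x hx => ⟨hx.2.1, trivial⟩)
    · have h1 : ContinuousOn (fun q : ℝ × ℝ × ℝ =>
          geoq p (v ((1 - q.1) * θ q.2.2 + q.1 * q.2.2)) q.2.1) dom3 :=
        geoq_cont (hv.continuous.comp hθτ).continuousOn (by fun_prop)
      have h2 : ContinuousOn (fun q : ℝ × ℝ × ℝ =>
          Lam p q.2.1 (v ((1 - q.1) * θ q.2.2 + q.1 * q.2.2))) dom3 :=
        (hLc.comp (by fun_prop : Continuous fun q : ℝ × ℝ × ℝ =>
          ((q.2.1, (1 - q.1) * θ q.2.2 + q.1 * q.2.2) : ℝ × ℝ))).continuousOn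
      fun_prop
    · intro τ ρ φ; rw [hper, hFp]
    · intro τ ρ φ; rw [hper, hvper]
    · intro τ hτ φ; rw [hF0, hF0 (_ + _)]
    · intro τ hτ φ
      have e : ∀ w : V3, (1 - τ) • geoq p w 0 + τ • Lam p 0 w =
          ((1 - τ) * Real.sinc (Real.arccos (p ⬝ᵥ w)) + τ) • (1:HQ) := by
        intro w; simp [geoq, Lam, add_smul, mul_smul]
      simp only [e]
      have hne : ∀ ψ, (1 - τ) * Real.sinc (Real.arccos (p ⬝ᵥ v ψ)) + τ ≠ 0 := by
        intro ψ
        have h := geoq_re_pos hp (hvs ψ) (hvp ψ) z_mem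
        have h2 : (geoq p (v ψ) 0).re = Real.sinc (Real.arccos (p ⬝ᵥ v ψ)) := by simp [geoq]
        rw [h2] at h
        have : 0 < (1 - τ) * Real.sinc (Real.arccos (p ⬝ᵥ v ψ)) + τ := by
          rcases eq_or_lt_of_le hτ.1 with h' | h'
          · rw [← h']; simpa using h
          · have := mul_nonneg (by linarith [hτ.2] : 0 ≤ 1 - τ) h.le
            linarith
        exact this.ne'
      rw [rotq_smul (hne _), rotq_smul (hne _)]
    · intro τ hτ φ
      generalize (1 - τ) * θ φ + τ * φ = ψ
      rw [hvF]
      symm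
      have hg := geoq_rot hp (hvs ψ) (hvp ψ) o_mem
      have hgne := ne_zero_of_re (geoq_re_pos hp (hvs ψ) (hvp ψ) o_mem)
      have hgeo1 : geo p (v ψ) 1 = v ψ := by
        unfold geo
        split_ifs with h
        · exact h
        · have hd : 0 < 1 + v ψ ⬝ᵥ p := dot_gt (hvs ψ) hp (hvp ψ)
          have hd2 : 0 < 1 + p ⬝ᵥ (-v ψ) := by
            refine dot_gt hp ?_ (by simpa using h)
            have := hvs ψ
            rw [mem_sph] at this ⊢; simpa using this
          rw [dotProduct_neg] at hd2
          rw [dotProduct_comm] at hd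
          have hs : 0 < Real.sin (Real.arccos (p ⬝ᵥ v ψ)) := by
            rw [Real.sin_arccos]; apply Real.sqrt_pos.2; nlinarith
          simp [hs.ne']
      rw [hgeo1] at hg
      have k1 := rotq_eq' hgne hg
      have k2 := rotq_eq' (hLne 1 o_mem ψ) (Lam_one_rot hp (hvs ψ) (hvp ψ))
      refine rotq_eq ?_ ?_
      · apply ne_zero_of_re
        have h1 := geoq_re_pos hp (hvs ψ) (hvp ψ) o_mem
        have h2 := hLpos 1 o_mem ψ
        simp only [Quaternion.re_add, Quaternion.re_smul, smul_eq_mul]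
        rcases eq_or_lt_of_le hτ.1 with h' | h'
        · rw [← h']; simpa using h1
        · nlinarith [mul_nonneg (by linarith [hτ.2] : 0 ≤ 1 - τ) h1.le, mul_pos h' h2]
      · rw [add_mul, mul_add, smul_mul_assoc, smul_mul_assoc, k1, k2, mul_smul_comm, mul_smul_comm]
    · intro τ hτ ρ hρ φ; exact hFne _ hρ _
    · intro τ hτ ρ hρ φ
      generalize (1 - τ) * θ φ + τ * φ = ψ
      apply ne_zero_of_re
      have h1 := geoq_re_pos hp (hvs ψ) (hvp ψ) hρ
      have h2 := hLpos ρ hρ ψ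
      simp only [Quaternion.re_add, Quaternion.re_smul, smul_eq_mul]
      rcases eq_or_lt_of_le hτ.1 with h' | h'
      · rw [← h']; simpa using h1
      · nlinarith [mul_nonneg (by linarith [hτ.2] : 0 ≤ 1 - τ) h1.le, mul_pos h' h2]
    · intro x hx
      rw [hf x hx]
      refine glue_congr ?_ ?_ x hx
      · intro ρ hρ φ; simp
      · intro ρ hρ φ
        have := geoq_rot hp (hvs (θ φ)) (hvp (θ φ)) hρ
        simp [this]
    · apply glue_congr
      · intro ρ hρ φ; simp
      · intro ρ hρ φ; simp
  have step2 : deg (glue (fun ρ φ => rotq (F ρ φ) p) (fun ρ φ => rotq (Lam p ρ (v φ)) p)) =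
      deg (glue (fun ρ φ => rotq ((Lam p ρ (v φ))⁻¹ * F ρ φ) p) (fun ρ φ => p)) := by
    have hXpos : ∀ τ ∈ Icc (0:ℝ) 1, ∀ ρ ∈ Icc (0:ℝ) 1, ∀ φ,
        ((1 - τ) • (1:HQ) + τ • (Lam p ρ (v φ))⁻¹) ≠ 0 := by
      intro τ hτ ρ hρ φ
      apply ne_zero_of_re
      have h2 := hLpos ρ hρ φ
      have h3 : 0 < ((Lam p ρ (v φ))⁻¹).re := by
        have e : (Lam p ρ (v φ))⁻¹ =
          (Quaternion.normSq (Lam p ρ (v φ)))⁻¹ • star (Lam p ρ (v φ)) := rfl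
        rw [e, Quaternion.re_smul, Quaternion.re_star, smul_eq_mul]
        have : 0 < Quaternion.normSq (Lam p ρ (v φ)) :=
          lt_of_le_of_ne Quaternion.normSq_nonneg (Quaternion.normSq_ne_zero.2 (hLne ρ hρ φ)).symm
        positivity
      simp only [Quaternion.re_add, Quaternion.re_smul, smul_eq_mul, hq_one_re, mul_one]
      rcases eq_or_lt_of_le hτ.1 with h' | h'
      · rw [← h']; simp
      · nlinarith [mul_pos h' h3, hτ.2]
    have hXc : ContinuousOn (fun q : ℝ × ℝ × ℝ =>
        (1 - q.1) • (1:HQ) + q.1 • (Lam p q.2.1 (v q.2.2))⁻¹) dom3 := by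
      have : ContinuousOn (fun q : ℝ × ℝ × ℝ => (Lam p q.2.1 (v q.2.2))⁻¹) dom3 := by
        refine ContinuousOn.inv₀ (hLc.comp continuous_snd).continuousOn ?_
        intro q hq; exact hLne _ hq.2.1 _
      fun_prop
    have hFc : ContinuousOn (fun q : ℝ × ℝ × ℝ => F q.2.1 q.2.2) dom3 :=
      hF.continuousOn.comp (f := fun q : ℝ × ℝ × ℝ => q.2) continuous_snd.continuousOn
        (fun q hq => hq.2)
    refine deg_rot hdeg hp
      (fun τ ρ φ => ((1 - τ) • (1:HQ) + τ • (Lam p ρ (v φ))⁻¹) * F ρ φ)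
      (fun τ ρ φ => ((1 - τ) • (1:HQ) + τ • (Lam p ρ (v φ))⁻¹) * Lam p ρ (v φ))
      (hXc.mul hFc) (hXc.mul (hLc.comp continuous_snd).continuousOn) ?_ ?_ ?_ ?_ ?_ ?_ ?_ ?_ ?_
    · intro τ ρ φ; simp only [hvper, hFp]
    · intro τ ρ φ; simp only [hvper]
    · intro τ hτ φ; simp only [Lam_zero, hF0 φ]
    · intro τ hτ φ; simp only [Lam_zero]
    · intro τ hτ φ
      rw [rotq_mul, rotq_mul, hvF, Lam_one_rot hp (hvs φ) (hvp φ)]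
    · intro τ hτ ρ hρ φ; exact mul_ne_zero (hXpos τ hτ ρ hρ φ) (hFne ρ hρ φ)
    · intro τ hτ ρ hρ φ; exact mul_ne_zero (hXpos τ hτ ρ hρ φ) (hLne ρ hρ φ)
    · apply glue_congr
      · intro ρ hρ φ; simp
      · intro ρ hρ φ; simp
    · apply glue_congr
      · intro ρ hρ φ; simp
      · intro ρ hρ φ; simp [inv_mul_cancel₀ (hLne ρ hρ φ), rotq_one]
  have hexn : ∀ a, ‖ex p a‖ = 1 := by
    intro a
    have := ex_normSq hp a
    rw [Quaternion.normSq_eq_norm_mul_self] at this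
    nlinarith [norm_nonneg (ex p a)]
  have hinv : ∀ x : HQ, x⁻¹ = (Quaternion.normSq x)⁻¹ • star x := fun x => rfl
  rw [step1, step2, ← deg_H3 hdeg hp m
    (fun t φ => (‖Lam p t (v φ)‖⁻¹ • star (Lam p t (v φ))) * F t φ * ex p (-(t * δ φ)))]
  · have : ∀ x ∈ sphereS, _ := glue_congr (U := fun ρ φ => rotq ((Lam p ρ (v φ))⁻¹ * F ρ φ) p)
      (L := fun ρ φ => p) (L' := fun ρ φ => p)
      (U' := fun ρ φ => rotq ((‖Lam p ρ (v φ)‖⁻¹ • star (Lam p ρ (v φ))) * F ρ φ *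
        ex p (-(ρ * δ φ))) p) ?_ ?_
    · refine deg_glue hdeg (fun τ ρ φ => rotq ((Lam p ρ (v φ))⁻¹ * F ρ φ) p) (fun τ ρ φ => p)
        ?_ continuousOn_const ?_ (fun _ _ _ => rfl) ?_ (fun _ _ _ => rfl) ?_ ?_ (fun _ _ _ _ _ => hp)
        (fun x hx => rfl) (fun x hx => (this x hx).symm)
      · refine ContinuousOn.rotq (ContinuousOn.mul (ContinuousOn.inv₀
          (hLc.comp continuous_snd).continuousOn ?_) ?_) continuousOn_const ?_
        · intro q hq; exact hLne _ hq.2.1 _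
        · exact hF.continuousOn.comp (f := fun q : ℝ × ℝ × ℝ => q.2) continuous_snd.continuousOn
            (fun q hq => hq.2)
        · intro q hq; exact mul_ne_zero (inv_ne_zero (hLne _ hq.2.1 _)) (hFne _ hq.2.1 _)
      · intro τ ρ φ; simp only [hvper, hFp]
      · intro τ hτ φ; simp only [Lam_zero, hF0 φ]
      · intro τ hτ φ
        rw [rotq_mul, hvF]
        have : rotq (Lam p 1 (v φ))⁻¹ (rotq (Lam p 1 (v φ)) p) = p := by
          rw [← rotq_mul, inv_mul_cancel₀ (hLne 1 o_mem φ), rotq_one]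
        rwa [Lam_one_rot hp (hvs φ) (hvp φ)] at this
      · intro τ hτ ρ hρ φ
        exact rotq_mem (mul_ne_zero (inv_ne_zero (hLne _ hρ _)) (hFne _ hρ _)) hp
    · intro ρ hρ φ
      rw [rotq_mul _ (ex p _), rotq_ex hp, smul_mul_assoc,
        rotq_smul (inv_ne_zero (norm_ne_zero_iff.2 (hLne ρ hρ φ))), hinv, smul_mul_assoc,
        rotq_smul (inv_ne_zero (Quaternion.normSq_ne_zero.2 (hLne ρ hρ φ)))]
    · intro ρ hρ φ; rfl
  · have h1 : ContinuousOn (fun q : ℝ × ℝ => ‖Lam p q.1 (v q.2)‖⁻¹) (Icc 0 1 ×ˢ univ) :=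
      ContinuousOn.inv₀ hLc.norm.continuousOn fun q hq => norm_ne_zero_iff.2 (hLne _ hq.1 _)
    have h2 : Continuous fun q : ℝ × ℝ => star (Lam p q.1 (v q.2)) := by
      have : Continuous fun q : ℝ × ℝ => qi (v q.2) := hqv.comp continuous_snd
      simp only [star_Lam]
      fun_prop
    have h3 : Continuous fun q : ℝ × ℝ => ex p (-(q.1 * δ q.2)) := by
      have := hδ.continuous
      exact (ex_continuous p).comp (by fun_prop)
    exact ((h1.smul h2.continuousOn).mul hF.continuousOn).mul h3.continuousOn
  · intro t ht φ
    rw [norm_mul, norm_mul, norm_smul, hexn, hFn t ht, norm_star, norm_inv, norm_norm,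
      inv_mul_cancel₀ (norm_ne_zero_iff.2 (hLne t ht φ))]
    norm_num
  · intro t φ; simp only [hvper, hFp, hδp]
  · intro φ; simp [Lam_zero, hF0 φ, ex_zero]
  · intro φ
    have hn := norm_ne_zero_iff.2 (hLne 1 o_mem φ)
    have e0 : star (Lam p 1 (v φ)) * Lam p 1 (v φ) =
        ((‖Lam p 1 (v φ)‖ * ‖Lam p 1 (v φ)‖ : ℝ) : HQ) := by
      rw [Quaternion.star_mul_self, Quaternion.normSq_eq_norm_mul_self]
    have e1 : (‖Lam p 1 (v φ)‖⁻¹ • star (Lam p 1 (v φ))) *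
        (‖Lam p 1 (v φ)‖⁻¹ • Lam p 1 (v φ)) = 1 := by
      rw [smul_mul_smul_comm, e0, ← Quaternion.coe_mul_eq_smul, ← Quaternion.coe_mul]
      rw [show ‖Lam p 1 (v φ)‖⁻¹ * ‖Lam p 1 (v φ)‖⁻¹ *
        (‖Lam p 1 (v φ)‖ * ‖Lam p 1 (v φ)‖) = 1 by field_simp]
      rfl
    rw [hE φ, ← mul_assoc, e1, one_mul, ← ex_add hp]
    congr 1; ring
  · refine (dense_cone p F v δ hF hv hδ).mono ?_
    intro P hP r t ht φ h
    refine hP (r * ‖Lam p t (v φ)‖⁻¹) t ht φ ?_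
    rw [← h, Psi, ← star_Lam, smul_mul_assoc, smul_mul_assoc, smul_smul]

theorem sph_close {v w : V3} (hv : v ∈ sphereS) (h : dist w v < 1) : w ≠ -v := by
  rintro rfl
  rw [mem_sph] at hv
  have h2 : ∀ i, |v i| < 1 / 2 := by
    intro i
    have := (dist_le_pi_dist (-v) v i).trans_lt h
    rw [Real.dist_eq, Pi.neg_apply, abs_lt] at this
    rw [abs_lt]; constructor <;> linarith [this.1, this.2]
  have h3 : ∀ i, v i * v i < 1 / 4 := by
    intro i
    have := h2 i
    rw [abs_lt] at this
    nlinarith [this.1, this.2]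
  linarith [h3 0, h3 1, h3 2]

theorem ContDiffOn.normalizeQ {X : Type*} [NormedAddCommGroup X] [NormedSpace ℝ X] {A : Set X}
    {f : X → HQ} (hf : ContDiffOn ℝ 1 f A) (h0 : ∀ x ∈ A, f x ≠ 0) :
    ContDiffOn ℝ 1 (fun x => ‖f x‖⁻¹ • f x) A := by
  have h1 : ContDiffOn ℝ 1 (fun x => ‖f x‖) A := hf.norm ℝ h0
  exact (h1.inv fun x hx => norm_ne_zero_iff.2 (h0 x hx)).smul hf

theorem norm_normalizeQ {x : HQ} (h : x ≠ 0) : ‖‖x‖⁻¹ • x‖ = 1 := by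
  rw [norm_smul, norm_inv, norm_norm, inv_mul_cancel₀ (norm_ne_zero_iff.2 h)]

theorem Lam_contDiffOn {X : Type*} [NormedAddCommGroup X] [NormedSpace ℝ X] {A : Set X}
    {f g : X → V3} (hf : ContDiffOn ℝ 1 f A) (hg : ContDiffOn ℝ 1 g A) :
    ContDiffOn ℝ 1 (fun x => Lam (f x) 1 (g x)) A := by
  unfold Lam
  simp only [one_smul]
  exact contDiffOn_const.sub ((qi.contDiff.comp_contDiffOn hg).mul (qi.contDiff.comp_contDiffOn hf))

theorem exists_lift {A : Set (ℝ × ℝ)} (hA : IsCompact A) (hAc : Convex ℝ A) (h0 : (0 : ℝ × ℝ) ∈ A)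
    {u : ℝ × ℝ → V3} (hu : ContDiffOn ℝ 1 u A) (hus : ∀ q ∈ A, u q ∈ sphereS)
    {p : V3} (hp : p ∈ sphereS) :
    ∃ F : ℝ × ℝ → HQ, ContDiffOn ℝ 1 F A ∧ ∀ q ∈ A, ‖F q‖ = 1 ∧ rotq (F q) p = u q := by
  have hstar : ∀ r ∈ Icc (0:ℝ) 1, ∀ q ∈ A, r • q ∈ A := by
    intro r hr q hq
    have := hAc h0 hq (sub_nonneg.2 hr.2) hr.1 (by ring)
    simpa using this
  obtain ⟨d, hd, hdu⟩ := Metric.uniformContinuousOn_iff.1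
    (hA.uniformContinuousOn_of_continuous hu.continuousOn) 1 one_pos
  obtain ⟨M, hM⟩ := hA.isBounded.exists_norm_le
  have hM0 : 0 ≤ M := (norm_nonneg _).trans (hM 0 h0)
  obtain ⟨N, hN⟩ := exists_nat_gt (M / d)
  have hNpos : (0:ℝ) < N := lt_of_le_of_lt (by positivity) hN
  have key : ∀ j : ℕ, j ≤ N → ∃ F : ℝ × ℝ → HQ, ContDiffOn ℝ 1 F A ∧
      ∀ q ∈ A, ‖F q‖ = 1 ∧ rotq (F q) p = u (((j:ℝ) / N) • q) := by
    intro j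
    induction j with
    | zero =>
      intro _
      obtain ⟨c, hc, -, hcr⟩ := exists_rot hp (hus 0 h0)
      refine ⟨fun _ => ‖c‖⁻¹ • c, contDiffOn_const, fun q hq => ⟨norm_normalizeQ hc, ?_⟩⟩
      rw [rotq_smul (inv_ne_zero (norm_ne_zero_iff.2 hc)), hcr]
      simp
    | succ j ih =>
      intro hj
      obtain ⟨F, hF, hF2⟩ := ih (by omega)
      have hj' : ((j + 1 : ℕ) : ℝ) ≤ N := by exact_mod_cast hj
      have r1 : ((j + 1 : ℕ) : ℝ) / N ∈ Icc (0:ℝ) 1 :=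
        ⟨by positivity, by rw [div_le_one hNpos]; exact hj'⟩
      have r0 : (j : ℝ) / N ∈ Icc (0:ℝ) 1 := by
        refine ⟨by positivity, ?_⟩
        rw [div_le_one hNpos]; push_cast at hj'; linarith
      set a : ℝ × ℝ → V3 := fun q => u (((j:ℝ) / N) • q) with ha
      set b : ℝ × ℝ → V3 := fun q => u ((((j + 1 : ℕ):ℝ) / N) • q) with hb
      have haC : ContDiffOn ℝ 1 a A := hu.comp (contDiff_const_smul _).contDiffOn (hstar _ r0)
      have hbC : ContDiffOn ℝ 1 b A := hu.comp (contDiff_const_smul _).contDiffOn (hstar _ r1)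
      have has : ∀ q ∈ A, a q ∈ sphereS := fun q hq => hus _ (hstar _ r0 q hq)
      have hbs : ∀ q ∈ A, b q ∈ sphereS := fun q hq => hus _ (hstar _ r1 q hq)
      have hab : ∀ q ∈ A, b q ≠ - a q := by
        intro q hq
        refine sph_close (has q hq) (hdu _ (hstar _ r1 q hq) _ (hstar _ r0 q hq) ?_)
        rw [dist_eq_norm, ← sub_smul, norm_smul]
        have : ((j + 1 : ℕ) : ℝ) / N - j / N = 1 / N := by push_cast; ring
        rw [this, Real.norm_of_nonneg (by positivity)]
        have h3 := hM q hq
        rw [div_lt_iff₀ hd] at hN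
        rw [div_mul_eq_mul_div, one_mul, div_lt_iff₀ hNpos]
        linarith
      have hL : ∀ q ∈ A, Lam (a q) 1 (b q) ≠ 0 := fun q hq =>
        ne_zero_of_re (Lam_re_pos (has q hq) (hbs q hq) (hab q hq) (by simp))
      refine ⟨fun q => (‖Lam (a q) 1 (b q)‖⁻¹ • Lam (a q) 1 (b q)) * F q, ?_, ?_⟩
      · exact ((Lam_contDiffOn haC hbC).normalizeQ hL).mul hF
      · intro q hq
        refine ⟨by rw [norm_mul, norm_normalizeQ (hL q hq), (hF2 q hq).1, one_mul], ?_⟩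
        rw [rotq_mul, (hF2 q hq).2, rotq_smul (inv_ne_zero (norm_ne_zero_iff.2 (hL q hq)))]
        exact Lam_one_rot (has q hq) (hbs q hq) (hab q hq)
  obtain ⟨F, hF, hF2⟩ := key N le_rfl
  refine ⟨F, hF, fun q hq => ?_⟩
  have := hF2 q hq
  rwa [div_self hNpos.ne', one_smul] at this

/-- clamp to the unit interval -/
def cl (t : ℝ) : ℝ := max 0 (min t 1)

theorem cl_mem (t : ℝ) : cl t ∈ Icc (0:ℝ) 1 := ⟨le_max_left _ _, max_le zero_le_one (min_le_right _ _)⟩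
theorem cl_eq {t : ℝ} (h : t ∈ Icc (0:ℝ) 1) : cl t = t := by
  unfold cl; rw [min_eq_left h.2, max_eq_right h.1]
theorem cl_cont : Continuous cl := by unfold cl; fun_prop

section stokes
variable {E : Type*} [NormedAddCommGroup E] [InnerProductSpace ℝ E]

theorem skew_of {J : E →L[ℝ] E} (hJ : ∀ x, inner ℝ x (J x) = 0) (x y : E) :
    inner ℝ x (J y) = - inner ℝ y (J x) := by
  have := hJ (x + y)
  simp only [map_add, inner_add_left, inner_add_right, hJ] at this
  linarith

theorem stokes_aux {A : Set (ℝ × ℝ)} (hA : IsCompact A) (hAc : Convex ℝ A)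
    (hAi : (interior A).Nonempty)
    {F : ℝ × ℝ → E} (hF : ContDiffOn ℝ 1 F A) {J : E →L[ℝ] E} (hJ : ∀ x, inner ℝ x (J x) = 0)
    {ζ : ℝ → ℝ × ℝ} {C : ℝ≥0} (hζ : LipschitzWith C ζ) (hζp : ∀ θ, ζ (θ + 2 * Real.pi) = ζ θ)
    (hζA : ∀ t ∈ Icc (0:ℝ) 1, ∀ θ, t • ζ θ ∈ A) :
    ∫ θ in (0:ℝ)..(2 * Real.pi), inner ℝ (deriv (fun θ => F (ζ θ)) θ) (J (F (ζ θ))) =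
    2 * ∫ θ in (0:ℝ)..(2 * Real.pi), ∫ t in (0:ℝ)..1,
      inner ℝ (fderivWithin ℝ F A (t • ζ θ) (t • deriv ζ θ))
        (J (fderivWithin ℝ F A (t • ζ θ) (ζ θ))) := by
  have hud : UniqueDiffOn ℝ A := uniqueDiffOn_convex hAc hAi
  have hDc : ContinuousOn (fderivWithin ℝ F A) A := hF.continuousOn_fderivWithin hud le_rfl
  have hFd : ∀ q ∈ A, HasFDerivWithinAt F (fderivWithin ℝ F A q) A q := fun q hq =>
    (hF.differentiableOn one_ne_zero q hq).hasFDerivWithinAt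
  obtain ⟨K, hK⟩ := (hA.image_of_continuousOn hDc).isBounded.exists_norm_le
  have hK' : ∀ q ∈ A, ‖fderivWithin ℝ F A q‖ ≤ K := fun q hq => hK _ (mem_image_of_mem _ hq)
  have hFL : ∀ x ∈ A, ∀ y ∈ A, ‖F x - F y‖ ≤ K * ‖x - y‖ := fun x hx y hy =>
    hAc.norm_image_sub_le_of_norm_hasFDerivWithin_le hFd hK' hy hx
  set G : ℝ → ℝ → E := fun t θ => F (cl t • ζ θ) with hG
  set D : ℝ → ℝ → E := fun t θ => fderivWithin ℝ F A (cl t • ζ θ) (ζ θ) with hD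
  have hζA' : ∀ t θ, cl t • ζ θ ∈ A := fun t θ => hζA _ (cl_mem t) θ
  have hζA1 : ∀ θ, ζ θ ∈ A := fun θ => by simpa using hζA 1 ⟨zero_le_one, le_rfl⟩ θ
  have hcz : Continuous fun q : ℝ × ℝ => cl q.1 • ζ q.2 :=
    (cl_cont.comp continuous_fst).smul (hζ.continuous.comp continuous_snd)
  have hGc : Continuous fun q : ℝ × ℝ => G q.1 q.2 :=
    hF.continuousOn.comp_continuous hcz fun q => hζA' _ _
  have hDcc : Continuous fun q : ℝ × ℝ => D q.1 q.2 :=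
    (hDc.comp_continuous hcz fun q => hζA' _ _).clm_apply (hζ.continuous.comp continuous_snd)
  obtain ⟨Z, hZ⟩ : ∃ Z, ∀ θ, ‖ζ θ‖ ≤ Z := by
    obtain ⟨Z, hZ⟩ := hA.isBounded.exists_norm_le
    exact ⟨Z, fun θ => hZ _ (hζA1 θ)⟩
  have hK0 : 0 ≤ K := (norm_nonneg _).trans (hK' _ (hζA1 0))
  have hGL : ∀ t θ θ', ‖G t θ - G t θ'‖ ≤ K * C * |θ - θ'| := by
    intro t θ θ'
    refine (hFL _ (hζA' t θ) _ (hζA' t θ')).trans ?_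
    rw [← smul_sub, norm_smul, mul_assoc]
    refine mul_le_mul_of_nonneg_left ?_ hK0
    have h1 : ‖ζ θ - ζ θ'‖ ≤ C * |θ - θ'| := by
      have := hζ.dist_le_mul θ θ'
      rwa [dist_eq_norm, Real.dist_eq] at this
    have h2 : ‖cl t‖ ≤ 1 := by
      rw [Real.norm_of_nonneg (cl_mem t).1]; exact (cl_mem t).2
    calc ‖cl t‖ * ‖ζ θ - ζ θ'‖ ≤ 1 * ‖ζ θ - ζ θ'‖ := by gcongr
      _ ≤ _ := by rw [one_mul]; exact h1
  have hDb : ∀ t θ, ‖D t θ‖ ≤ K * Z := by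
    intro t θ
    refine (ContinuousLinearMap.le_opNorm _ _).trans ?_
    gcongr
    · exact hK' _ (hζA' t θ)
    · exact hZ θ
  -- radial derivative
  have hGt : ∀ θ, ∀ t ∈ Ioo (0:ℝ) 1, HasDerivAt (fun t => G t θ) (D t θ) t := by
    intro θ t ht
    have ht' := Ioo_subset_Icc_self ht
    have h1 : HasDerivWithinAt (fun t : ℝ => t • ζ θ) ((1:ℝ) • ζ θ) (Icc 0 1) t :=
      ((hasDerivAt_id t).smul_const (ζ θ)).hasDerivWithinAt
    rw [one_smul] at h1
    have h2 := (hFd _ (hζA t ht' θ)).comp_hasDerivWithinAt t h1 (fun x hx => hζA x hx θ)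
    have h3 := h2.hasDerivAt (Icc_mem_nhds ht.1 ht.2)
    have h4 : (fun t => G t θ) =ᶠ[𝓝 t] F ∘ fun t => t • ζ θ := by
      filter_upwards [Icc_mem_nhds ht.1 ht.2] with x hx
      simp only [hG, cl_eq hx, Function.comp]
    refine HasDerivAt.congr_of_eventuallyEq ?_ h4
    simp only [hD, cl_eq ht']
    exact h3
  set a : ℝ → ℝ → ℝ := fun θ h => ∫ t in (0:ℝ)..1, inner ℝ (G t (θ + h)) (J (D t θ)) with ha
  have hac : ∀ h, Continuous fun θ => a θ h := by
    intro h
    refine intervalIntegral.continuous_parametric_intervalIntegral_of_continuous' ?_ 0 1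
    have e1 : Continuous fun q : ℝ × ℝ => G q.2 (q.1 + h) :=
      hGc.comp (by fun_prop : Continuous fun q : ℝ × ℝ => (q.2, q.1 + h))
    have e2 : Continuous fun q : ℝ × ℝ => D q.2 q.1 :=
      hDcc.comp (by fun_prop : Continuous fun q : ℝ × ℝ => (q.2, q.1))
    exact e1.inner (J.continuous.comp e2)
  have hGp : ∀ t θ, G t (θ + 2 * Real.pi) = G t θ := fun t θ => by simp only [hG, hζp]
  have hDp : ∀ t θ, D t (θ + 2 * Real.pi) = D t θ := fun t θ => by simp only [hD, hζp]
  have hap : ∀ h θ, a (θ + 2 * Real.pi) h = a θ h := by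
    intro h θ
    simp only [ha, hDp, show θ + 2 * Real.pi + h = (θ + h) + 2 * Real.pi by ring, hGp]
  have hcG : ∀ θ, Continuous fun t => G t θ := fun θ =>
    hGc.comp (by fun_prop : Continuous fun t : ℝ => (t, θ))
  have hcD : ∀ θ, Continuous fun t => D t θ := fun θ =>
    hDcc.comp (by fun_prop : Continuous fun t : ℝ => (t, θ))
  have hG0 : ∀ θ, G 0 θ = F 0 := fun θ => by
    simp only [hG, cl_eq (t := 0) ⟨le_rfl, zero_le_one⟩, zero_smul]
  have hG1 : ∀ θ, G 1 θ = F (ζ θ) := fun θ => by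
    simp only [hG, cl_eq (t := 1) ⟨zero_le_one, le_rfl⟩, one_smul]
  have hac' : ∀ θ h, inner ℝ (G 1 (θ + h)) (J (G 1 θ)) = a θ h - a (θ + h) (-h) := by
    intro θ h
    have hft := intervalIntegral.integral_eq_sub_of_hasDerivAt_of_le (a := 0) (b := 1)
      (f := fun t => inner ℝ (G t (θ + h)) (J (G t θ)))
      (f' := fun t => inner ℝ (G t (θ + h)) (J (D t θ)) + inner ℝ (D t (θ + h)) (J (G t θ)))
      zero_le_one ((hcG _).inner (J.continuous.comp (hcG _))).continuousOn
      (fun t ht => (hGt (θ + h) t ht).inner ℝ (J.hasFDerivAt.comp_hasDerivAt t (hGt θ t ht)))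
      ((((hcG _).inner (J.continuous.comp (hcD _))).add
        ((hcD _).inner (J.continuous.comp (hcG _)))).intervalIntegrable _ _)
    rw [intervalIntegral.integral_add (((hcG _).inner (J.continuous.comp (hcD _))).intervalIntegrable _ _)
      (((hcD _).inner (J.continuous.comp (hcG _))).intervalIntegrable _ _)] at hft
    simp only [hG0, hJ, sub_zero] at hft
    rw [← hft]
    simp only [ha]
    rw [sub_eq_add_neg, ← intervalIntegral.integral_neg]
    congr 1
    refine intervalIntegral.integral_congr fun t _ => ?_
    simp only [add_neg_cancel_right]
    rw [skew_of hJ]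
  -- integrated identity
  have hintg : ∀ h, ∫ θ in (0:ℝ)..(2 * Real.pi), inner ℝ (G 1 (θ + h)) (J (G 1 θ)) =
      ∫ θ in (0:ℝ)..(2 * Real.pi), (a θ h - a θ (-h)) := by
    intro h
    simp only [hac']
    have hsh : Continuous fun θ => a (θ + h) (-h) := (hac (-h)).comp (continuous_add_const h)
    rw [intervalIntegral.integral_sub ((hac _).intervalIntegrable _ _)
      (hsh.intervalIntegrable _ _),
      intervalIntegral.integral_sub ((hac _).intervalIntegrable _ _)
      ((hac (-h)).intervalIntegrable _ _)]
    congr 1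
    rw [intervalIntegral.integral_comp_add_right (fun θ => a θ (-h)) h]
    have hper : Function.Periodic (fun θ => a θ (-h)) (2 * Real.pi) := hap (-h)
    have := hper.intervalIntegral_add_eq (0 + h) 0
    rw [show 0 + h + 2 * Real.pi = 2 * Real.pi + h by ring, zero_add (2 * Real.pi)] at this
    exact this
  have hdiff : ∀ᵐ θ : ℝ, DifferentiableAt ℝ ζ θ := hζ.ae_differentiableAt
  -- left limit
  have hL : Filter.Tendsto (fun h : ℝ => ∫ θ in (0:ℝ)..(2 * Real.pi),
      h⁻¹ * inner ℝ (G 1 (θ + h)) (J (G 1 θ))) (𝓝[≠] 0)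
      (𝓝 (∫ θ in (0:ℝ)..(2 * Real.pi), inner ℝ (deriv (fun θ => F (ζ θ)) θ) (J (F (ζ θ))))) := by
    have e : ∀ h θ, h⁻¹ * inner ℝ (G 1 (θ + h)) (J (G 1 θ)) =
        inner ℝ (h⁻¹ • (F (ζ (θ + h)) - F (ζ θ))) (J (F (ζ θ))) := by
      intro h θ
      rw [hG1, hG1, real_inner_smul_left, inner_sub_left, hJ, sub_zero]
    refine intervalIntegral.tendsto_integral_filter_of_dominated_convergence
      (fun θ => K * C * ‖J (F (ζ θ))‖) ?_ ?_ ?_ ?_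
    · refine Filter.Eventually.of_forall fun h => ?_
      refine Continuous.aestronglyMeasurable ?_
      have e1 : Continuous fun θ => G 1 (θ + h) :=
        hGc.comp (by fun_prop : Continuous fun θ : ℝ => ((1:ℝ), θ + h))
      have e2 : Continuous fun θ => G 1 θ :=
        hGc.comp (by fun_prop : Continuous fun θ : ℝ => ((1:ℝ), θ))
      exact continuous_const.mul (e1.inner (J.continuous.comp e2))
    · filter_upwards [self_mem_nhdsWithin] with h hh
      refine Filter.Eventually.of_forall fun θ _ => ?_
      rw [e]
      refine (norm_inner_le_norm _ _).trans ?_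
      gcongr
      rw [norm_smul, norm_inv]
      have := hGL 1 (θ + h) θ
      rw [hG1, hG1, add_sub_cancel_left] at this
      have hh' : 0 < |h| := abs_pos.2 hh
      rw [Real.norm_eq_abs, inv_mul_le_iff₀ hh']
      linarith
    · refine Continuous.intervalIntegrable ?_ _ _
      have e2 : Continuous fun θ => G 1 θ :=
        hGc.comp (by fun_prop : Continuous fun θ : ℝ => ((1:ℝ), θ))
      simp only [hG1] at e2
      exact continuous_const.mul (J.continuous.comp e2).norm
    · filter_upwards [hdiff] with θ hθ _
      simp only [e]
      have h1 := (hFd _ (hζA1 θ)).comp_hasDerivWithinAt θ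
        (hθ.hasDerivAt.hasDerivWithinAt (s := univ)) (fun x _ => hζA1 x)
      rw [hasDerivWithinAt_univ] at h1
      have h2 : HasDerivAt (fun θ => F (ζ θ)) (deriv (fun θ => F (ζ θ)) θ) θ :=
        h1.differentiableAt.hasDerivAt
      have h3 := hasDerivAt_iff_tendsto_slope_zero.1 h2
      exact h3.inner tendsto_const_nhds
  have hR : Filter.Tendsto (fun h : ℝ => ∫ θ in (0:ℝ)..(2 * Real.pi),
      h⁻¹ * (a θ h - a θ (-h))) (𝓝[≠] 0)
      (𝓝 (∫ θ in (0:ℝ)..(2 * Real.pi), 2 * ∫ t in (0:ℝ)..1,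
      inner ℝ (fderivWithin ℝ F A (t • ζ θ) (t • deriv ζ θ))
        (J (fderivWithin ℝ F A (t • ζ θ) (ζ θ))))) := by
    have e : ∀ h θ, h⁻¹ * (a θ h - a θ (-h)) = ∫ t in (0:ℝ)..1,
        inner ℝ (h⁻¹ • (G t (θ + h) - G t (θ + -h))) (J (D t θ)) := by
      intro h θ
      simp only [ha]
      rw [← intervalIntegral.integral_sub
        (((hcG _).inner (J.continuous.comp (hcD _))).intervalIntegrable _ _)
        (((hcG _).inner (J.continuous.comp (hcD _))).intervalIntegrable _ _),
        ← intervalIntegral.integral_const_mul]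
      simp only [real_inner_smul_left, inner_sub_left]
    have bd : ∀ h θ t, h ≠ 0 → ‖inner ℝ (h⁻¹ • (G t (θ + h) - G t (θ + -h))) (J (D t θ))‖ ≤
        2 * K * C * (‖J‖ * (K * Z)) := by
      intro h θ t hh
      refine (norm_inner_le_norm _ _).trans ?_
      gcongr
      · rw [norm_smul, norm_inv]
        have := hGL t (θ + h) (θ + -h)
        rw [show θ + h - (θ + -h) = 2 * h by ring, abs_mul, abs_of_pos (two_pos)] at this
        have hh' : 0 < |h| := abs_pos.2 hh
        rw [Real.norm_eq_abs, inv_mul_le_iff₀ hh']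
        linarith
      · refine (J.le_opNorm _).trans ?_
        gcongr
        exact hDb t θ
    refine intervalIntegral.tendsto_integral_filter_of_dominated_convergence
      (fun θ => 2 * K * C * (‖J‖ * (K * Z))) ?_ ?_ ?_ ?_
    · refine Filter.Eventually.of_forall fun h => Continuous.aestronglyMeasurable ?_
      exact continuous_const.mul ((hac _).sub (hac _))
    · filter_upwards [self_mem_nhdsWithin] with h hh
      refine Filter.Eventually.of_forall fun θ _ => ?_
      rw [e]
      have := intervalIntegral.norm_integral_le_of_norm_le_const (a := (0:ℝ)) (b := 1)
        (fun t _ => bd h θ t hh)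
      simpa using this
    · exact continuous_const.intervalIntegrable _ _
    · filter_upwards [hdiff] with θ hθ _
      simp only [e]
      rw [← intervalIntegral.integral_const_mul]
      refine intervalIntegral.tendsto_integral_filter_of_dominated_convergence
        (fun t => 2 * K * C * (‖J‖ * (K * Z))) ?_ ?_ ?_ ?_
      · refine Filter.Eventually.of_forall fun h => Continuous.aestronglyMeasurable ?_
        exact (((hcG _).sub (hcG _)).const_smul _).inner (J.continuous.comp (hcD _))
      · filter_upwards [self_mem_nhdsWithin] with h hh
        exact Filter.Eventually.of_forall fun t _ => bd h θ t hh
      · exact continuous_const.intervalIntegrable _ _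
      · refine Filter.Eventually.of_forall fun t ht => ?_
        rw [uIoc_of_le zero_le_one] at ht
        have ht' := Ioc_subset_Icc_self ht
        have h1 := (hFd _ (hζA t ht' θ)).comp_hasDerivWithinAt θ
          ((hθ.hasDerivAt.const_smul t).hasDerivWithinAt (s := univ)) (fun x _ => hζA t ht' x)
        rw [hasDerivWithinAt_univ] at h1
        have h2 : HasDerivAt (fun θ => G t θ) (fderivWithin ℝ F A (t • ζ θ) (t • deriv ζ θ)) θ := by
          simp only [hG, cl_eq ht']
          exact h1
        have h3 := hasDerivAt_iff_tendsto_slope_zero.1 h2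
        have hneg : Filter.Tendsto (fun h : ℝ => -h) (𝓝[≠] 0) (𝓝[≠] 0) := by
          refine tendsto_nhdsWithin_iff.2 ⟨?_, ?_⟩
          · have : Filter.Tendsto (fun h : ℝ => -h) (𝓝 0) (𝓝 (-0)) := Filter.tendsto_id.neg
            rw [neg_zero] at this
            exact this.mono_left nhdsWithin_le_nhds
          · filter_upwards [self_mem_nhdsWithin] with h hh
            exact neg_ne_zero.2 hh
        have h4 := (h3.add (h3.comp hneg)).inner (𝕜 := ℝ)
          (tendsto_const_nhds (x := J (D t θ)) (f := 𝓝[≠] (0:ℝ)))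
        have h5 : 2 * inner ℝ (fderivWithin ℝ F A (t • ζ θ) (t • deriv ζ θ))
            (J (fderivWithin ℝ F A (t • ζ θ) (ζ θ))) =
            inner ℝ (fderivWithin ℝ F A (t • ζ θ) (t • deriv ζ θ) +
              fderivWithin ℝ F A (t • ζ θ) (t • deriv ζ θ)) (J (D t θ)) := by
          simp only [hD, cl_eq ht']
          rw [inner_add_left]; ring
        rw [h5]
        refine h4.congr fun h => ?_
        congr 1
        simp only [Function.comp]
        rw [inv_neg, neg_smul, ← sub_eq_add_neg, ← smul_sub]
        congr 1; abel
  have hEq : ∀ h : ℝ, (∫ θ in (0:ℝ)..(2 * Real.pi), h⁻¹ * inner ℝ (G 1 (θ + h)) (J (G 1 θ))) =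
      ∫ θ in (0:ℝ)..(2 * Real.pi), h⁻¹ * (a θ h - a θ (-h)) := by
    intro h
    rw [intervalIntegral.integral_const_mul, intervalIntegral.integral_const_mul, hintg]
  simp only [hEq] at hL
  rw [← intervalIntegral.integral_const_mul]
  exact tendsto_nhds_unique hL hR
end stokes

/-- unit circle -/
def cs (θ : ℝ) : ℝ × ℝ := (Real.cos θ, Real.sin θ)

/-- radius function of a star-shaped set -/
def Rad (A : Set (ℝ × ℝ)) (θ : ℝ) : ℝ := (gauge A (cs θ))⁻¹

/-- radial parameterization of the boundary -/
def zt (A : Set (ℝ × ℝ)) (θ : ℝ) : ℝ × ℝ := Rad A θ • cs θ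

theorem cs_cont : Continuous cs := by unfold cs; fun_prop

theorem cs_per (θ : ℝ) : cs (θ + 2 * Real.pi) = cs θ := by simp [cs]

theorem zt_per (A : Set (ℝ × ℝ)) (θ : ℝ) : zt A (θ + 2 * Real.pi) = zt A θ := by
  simp [zt, Rad, cs_per]

theorem cs_ne (θ : ℝ) : cs θ ≠ 0 := by
  intro h
  have h1 := congrArg Prod.fst h
  have h2 := congrArg Prod.snd h
  simp [cs] at h1 h2
  have := Real.sin_sq_add_cos_sq θ
  rw [h1, h2] at this; norm_num at this

theorem cs_norm_le (θ : ℝ) : ‖cs θ‖ ≤ 1 := by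
  rw [Prod.norm_def]
  exact max_le (Real.abs_cos_le_one θ) (Real.abs_sin_le_one θ)

theorem cs_lip : LipschitzWith 1 cs := by
  have := Real.lipschitzWith_cos.prodMk Real.lipschitzWith_sin
  rw [max_self] at this
  exact this

structure GoodSet (A : Set (ℝ × ℝ)) : Prop where
  cpt : IsCompact A
  cvx : Convex ℝ A
  nhd : A ∈ 𝓝 (0 : ℝ × ℝ)

namespace GoodSet

theorem zero_mem {A : Set (ℝ × ℝ)} (hA : GoodSet A) : (0 : ℝ × ℝ) ∈ A := mem_of_mem_nhds hA.nhd

theorem intNe {A : Set (ℝ × ℝ)} (hA : GoodSet A) : (interior A).Nonempty := ⟨0, mem_interior_iff_mem_nhds.2 hA.nhd⟩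

theorem gpos {A : Set (ℝ × ℝ)} (hA : GoodSet A) (θ : ℝ) : 0 < gauge A (cs θ) :=
  (gauge_pos (absorbent_nhds_zero hA.nhd) (NormedSpace.isVonNBounded_of_isBounded _ hA.cpt.isBounded)).2
    (cs_ne θ)

theorem Rpos {A : Set (ℝ × ℝ)} (hA : GoodSet A) (θ : ℝ) : 0 < Rad A θ := inv_pos.2 (hA.gpos θ)

theorem gcont {A : Set (ℝ × ℝ)} (hA : GoodSet A) : Continuous (gauge A) := continuous_gauge hA.cvx hA.nhd

theorem Rcont {A : Set (ℝ × ℝ)} (hA : GoodSet A) : Continuous (Rad A) :=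
  (hA.gcont.comp cs_cont).inv₀ fun θ => (hA.gpos θ).ne'

theorem mem_iff {A : Set (ℝ × ℝ)} (hA : GoodSet A) (x : ℝ × ℝ) : x ∈ A ↔ gauge A x ≤ 1 := by
  rw [gauge_le_one_iff_mem_closure hA.cvx hA.nhd, hA.cpt.isClosed.closure_eq]

theorem gauge_smul_cs {A : Set (ℝ × ℝ)} (_ : GoodSet A) {r : ℝ} (hr : 0 ≤ r) (θ : ℝ) : gauge A (r • cs θ) = r * gauge A (cs θ) := by
  rw [gauge_smul_of_nonneg hr, smul_eq_mul]

theorem mem_smul_iff {A : Set (ℝ × ℝ)} (hA : GoodSet A) {r : ℝ} (hr : 0 ≤ r) (θ : ℝ) : r • cs θ ∈ A ↔ r ≤ Rad A θ := by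
  rw [hA.mem_iff, hA.gauge_smul_cs hr, Rad, ← one_div, le_div_iff₀ (hA.gpos θ)]

theorem zt_frontier {A : Set (ℝ × ℝ)} (hA : GoodSet A) (θ : ℝ) : zt A θ ∈ frontier A := by
  rw [← gauge_eq_one_iff_mem_frontier hA.cvx hA.nhd, zt, hA.gauge_smul_cs (hA.Rpos θ).le, Rad,
    inv_mul_cancel₀ (hA.gpos θ).ne']

theorem smul_zt_mem {A : Set (ℝ × ℝ)} (hA : GoodSet A) {t : ℝ} (ht : t ∈ Icc (0:ℝ) 1) (θ : ℝ) : t • zt A θ ∈ A := by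
  rw [zt, smul_smul, hA.mem_smul_iff (mul_nonneg ht.1 (hA.Rpos θ).le)]
  exact mul_le_of_le_one_left (hA.Rpos θ).le ht.2

theorem frontier_eq {A : Set (ℝ × ℝ)} (hA : GoodSet A) {r : ℝ} (hr : 0 < r) {θ : ℝ} (h : r • cs θ ∈ frontier A) : r = Rad A θ := by
  rw [← gauge_eq_one_iff_mem_frontier hA.cvx hA.nhd, hA.gauge_smul_cs hr.le] at h
  exact eq_inv_of_mul_eq_one_left h

theorem Rbound {A : Set (ℝ × ℝ)} (hA : GoodSet A) : ∃ M : ℝ, 0 < M ∧ ∀ θ, Rad A θ ≤ M := by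
  have hper : ∀ θ, ∃ θ' ∈ Icc (0:ℝ) (2 * Real.pi), Rad A θ = Rad A θ' := by
    intro θ
    have hp : Function.Periodic (Rad A) (2 * Real.pi) := fun θ => by simp [Rad, cs_per]
    obtain ⟨y, hy, h⟩ := hp.exists_mem_Ico₀ Real.two_pi_pos θ
    exact ⟨y, Ico_subset_Icc_self hy, h⟩
  obtain ⟨M, hM⟩ := (isCompact_Icc (a := (0:ℝ)) (b := 2 * Real.pi)).bddAbove_image
    hA.Rcont.continuousOn
  have hb : ∀ θ, Rad A θ ≤ M := by
    intro θ
    obtain ⟨θ', h1, h2⟩ := hper θ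
    rw [h2]; exact hM (mem_image_of_mem _ h1)
  exact ⟨M, (hA.Rpos 0).trans_le (hb 0), hb⟩

theorem zt_lip {A : Set (ℝ × ℝ)} (hA : GoodSet A) : ∃ C : ℝ≥0, LipschitzWith C (zt A) := by
  obtain ⟨K, hK⟩ := hA.cvx.lipschitz_gauge hA.nhd
  obtain ⟨M, hM0, hM⟩ := hA.Rbound
  have hR : ∀ θ θ', |Rad A θ - Rad A θ'| ≤ M * M * K * |θ - θ'| := by
    intro θ θ'
    have h1 := (hK.comp cs_lip).dist_le_mul θ' θ
    rw [Real.dist_eq, Real.dist_eq] at h1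
    simp only [Function.comp, mul_one] at h1
    have h2 : Rad A θ - Rad A θ' = Rad A θ * Rad A θ' * (gauge A (cs θ') - gauge A (cs θ)) := by
      unfold Rad
      have := (hA.gpos θ).ne'
      have := (hA.gpos θ').ne'
      field_simp
    rw [h2, abs_mul, abs_mul, abs_of_pos (hA.Rpos θ), abs_of_pos (hA.Rpos θ'), mul_assoc (M * M),
      abs_sub_comm θ θ']
    have := hA.Rpos θ; have := hA.Rpos θ'
    gcongr
    · exact hM θ
    · exact hM θ'
  refine ⟨Real.toNNReal (M * M * K + M), LipschitzWith.of_dist_le_mul fun θ θ' => ?_⟩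
  rw [dist_eq_norm, Real.dist_eq]
  have e : zt A θ - zt A θ' = (Rad A θ - Rad A θ') • cs θ + Rad A θ' • (cs θ - cs θ') := by
    simp only [zt]; module
  rw [e]
  refine (norm_add_le _ _).trans ?_
  rw [norm_smul, norm_smul, Real.norm_eq_abs, Real.norm_eq_abs, abs_of_pos (hA.Rpos θ')]
  have h3 := cs_lip.dist_le_mul θ θ'
  rw [dist_eq_norm, Real.dist_eq] at h3
  simp only [NNReal.coe_one, one_mul] at h3
  have h4 := hR θ θ'
  have h5 := cs_norm_le θ
  have h6 := hM θ'
  have : ((Real.toNNReal (M * M * K + M) : ℝ≥0) : ℝ) = M * M * K + M :=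
    Real.coe_toNNReal _ (by positivity)
  rw [this, add_mul]
  refine add_le_add ?_ ?_
  · refine (mul_le_of_le_one_right (abs_nonneg _) h5).trans h4
  · exact mul_le_mul h6 h3 (norm_nonneg _) hM0.le

theorem polar {A : Set (ℝ × ℝ)} (hA : GoodSet A) {g : ℝ × ℝ → ℝ} (hg : ContinuousOn g A) :
    ∫ q in A, g q = ∫ θ in (0:ℝ)..(2 * Real.pi), ∫ t in (0:ℝ)..1,
      t * Rad A θ ^ 2 * g (t • zt A θ) := by
  obtain ⟨G, hG⟩ := ContinuousMap.exists_restrict_eq hA.cpt.isClosed ⟨A.domRestrict g, hg.domRestrict⟩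
  have hGg : ∀ q ∈ A, G q = g q := fun q hq => by
    have := DFunLike.congr_fun hG ⟨q, hq⟩
    exact this
  have hGc : Continuous G := G.continuous
  obtain ⟨M, hM0, hM⟩ := hA.Rbound
  have hmA := hA.cpt.isClosed.measurableSet
  rw [setIntegral_congr_fun hmA (fun q hq => (hGg q hq).symm), ← integral_indicator hmA,
    ← integral_comp_polarCoord_symm, polarCoord_target]
  have hsymm : ∀ p : ℝ × ℝ, polarCoord.symm p = p.1 • cs p.2 := by
    intro p; simp [cs]
  simp only [hsymm]
  set H : ℝ × ℝ → ℝ := fun p => p.1 • A.indicator (fun q => G q) (p.1 • cs p.2) with hH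
  have hHm : Measurable H := by
    have : Measurable fun p : ℝ × ℝ => p.1 • cs p.2 := by
      have := cs_cont
      exact (by fun_prop : Continuous fun p : ℝ × ℝ => p.1 • cs p.2).measurable
    exact measurable_fst.smul ((hGc.measurable.indicator hmA).comp this)
  have hH0 : ∀ r θ, 0 < r → M < r → H (r, θ) = 0 := by
    intro r θ hr hr2
    simp only [hH]
    rw [indicator_of_notMem, smul_zero]
    rw [hA.mem_smul_iff hr.le]
    have := hM θ
    linarith
  obtain ⟨B, hB⟩ := (hA.cpt.image hGc).isBounded.exists_norm_le
  have hB0 : 0 ≤ B := (norm_nonneg _).trans (hB _ (mem_image_of_mem _ hA.zero_mem))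
  have hInt1 : IntegrableOn H (Ioc 0 M ×ˢ Ioo (-Real.pi) Real.pi) := by
    refine Measure.integrableOn_of_bounded (M := M * B) ?_ hHm.aestronglyMeasurable ?_
    · rw [Measure.volume_eq_prod, Measure.prod_prod]
      simp [ENNReal.mul_eq_top]
    · rw [ae_restrict_iff' (measurableSet_Ioc.prod measurableSet_Ioo)]
      refine Filter.Eventually.of_forall fun p hp => ?_
      simp only [hH, norm_smul]
      have h1 : ‖p.1‖ ≤ M := by rw [Real.norm_of_nonneg hp.1.1.le]; exact hp.1.2
      refine mul_le_mul h1 ?_ (norm_nonneg _) hM0.le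
      by_cases h : p.1 • cs p.2 ∈ A
      · rw [indicator_of_mem h]; exact hB _ (mem_image_of_mem _ h)
      · rw [indicator_of_notMem h, norm_zero]; exact hB0
  have hInt : IntegrableOn H (Ioi 0 ×ˢ Ioo (-Real.pi) Real.pi) := by
    refine hInt1.of_forall_sdiff_eq_zero (measurableSet_Ioi.prod measurableSet_Ioo) ?_
    rintro ⟨r, θ⟩ ⟨⟨h1, h2⟩, h3⟩
    refine hH0 r θ h1 ?_
    by_contra h
    exact h3 ⟨⟨h1, not_lt.1 h⟩, h2⟩
  rw [Measure.volume_eq_prod] at hInt ⊢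
  have hsw : IntegrableOn (fun p : ℝ × ℝ => H p.swap) (Ioo (-Real.pi) Real.pi ×ˢ Ioi 0) (volume.prod volume) := by
    have := hInt.swap
    exact this
  rw [← setIntegral_prod_swap, setIntegral_prod _ hsw]
  have inner_eq : ∀ θ, ∫ r in Ioi (0:ℝ), H (r, θ) = ∫ t in (0:ℝ)..1,
      t * Rad A θ ^ 2 * g (t • zt A θ) := by
    intro θ
    have h1 : ∫ r in Ioi (0:ℝ), H (r, θ) = ∫ r in Ioc (0:ℝ) (Rad A θ), r * G (r • cs θ) := by
      have : ∫ r in Ioc (0:ℝ) (Rad A θ), r * G (r • cs θ) = ∫ r in Ioc (0:ℝ) (Rad A θ), H (r, θ) := by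
        refine setIntegral_congr_fun measurableSet_Ioc fun r hr => ?_
        simp only [hH]
        rw [indicator_of_mem ((hA.mem_smul_iff hr.1.le θ).2 hr.2), smul_eq_mul]
      rw [this]
      refine setIntegral_eq_of_subset_of_forall_sdiff_eq_zero measurableSet_Ioi Ioc_subset_Ioi_self ?_
      intro r hr
      simp only [hH]
      rw [indicator_of_notMem, smul_zero]
      rw [hA.mem_smul_iff (le_of_lt hr.1)]
      intro h
      exact hr.2 ⟨hr.1, h⟩
    rw [h1, ← intervalIntegral.integral_of_le (hA.Rpos θ).le]
    have h2 := intervalIntegral.integral_comp_mul_left (a := 0) (b := 1)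
      (fun r => r * G (r • cs θ)) (hA.Rpos θ).ne'
    rw [mul_zero, mul_one, eq_inv_smul_iff₀ (hA.Rpos θ).ne', smul_eq_mul,
      ← intervalIntegral.integral_const_mul] at h2
    rw [← h2]
    refine intervalIntegral.integral_congr fun t ht => ?_
    rw [uIcc_of_le zero_le_one] at ht
    rw [← hGg _ (hA.smul_zt_mem ht θ), zt, smul_smul, mul_comm t (Rad A θ)]
    ring
  simp only [Prod.swap_prod_mk, inner_eq]
  rw [← integral_Ioc_eq_integral_Ioo, ← intervalIntegral.integral_of_le (by linarith [Real.pi_pos])]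
  have hp : Function.Periodic (fun θ => ∫ t in (0:ℝ)..1, t * Rad A θ ^ 2 * g (t • zt A θ))
      (2 * Real.pi) := by
    intro θ
    simp only [zt_per, Rad, cs_per]
  have := hp.intervalIntegral_add_eq (-Real.pi) 0
  rw [show -Real.pi + 2 * Real.pi = Real.pi by ring, zero_add] at this
  exact this

end GoodSet

/-- right multiplication by the imaginary unit `p` -/
def Jp (p : V3) : HQ →L[ℝ] HQ := (ContinuousLinearMap.mul ℝ HQ).flip (qi p)

theorem Jp_apply (p : V3) (x : HQ) : Jp p x = x * qi p := rfl

theorem Jp_skew (p : V3) (x : HQ) : inner ℝ x (Jp p x) = 0 := by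
  rw [Jp_apply, Quaternion.inner_def]
  simp
  ring

theorem re_sandwich {F : HQ} (hF : Quaternion.normSq F = 1) (x : HQ) : (F * x * star F).re = x.re := by
  have h : ∀ a b : HQ, (a * b).re = (b * a).re := by intro a b; simp; ring
  rw [h, ← mul_assoc, Quaternion.star_mul_self, hF]; simp

theorem triple_re {a b c : HQ} (ha : a.re = 0) (hb : b.re = 0) (hc : c.re = 0) :
    qv a ⬝ᵥ crossProduct (qv b) (qv c) = -(a * b * c).re := by
  simp [dot3, qv_apply, cross_apply, ha, hb, hc]
  ring

theorem pull_alg {F : HQ} (hF : Quaternion.normSq F = 1) {p : V3} (hp : p ∈ sphereS) {F1 F2 : HQ}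
    (h1 : inner ℝ F F1 = 0) (h2 : inner ℝ F F2 = 0) :
    qv (F * qi p * star F) ⬝ᵥ crossProduct (qv (F1 * qi p * star F + F * qi p * star F1))
      (qv (F2 * qi p * star F + F * qi p * star F2)) = -4 * inner ℝ F2 (Jp p F1) := by
  have hFs : star F * F = 1 := by rw [Quaternion.star_mul_self, hF]; simp
  have hFs' : F * star F = 1 := by rw [Quaternion.self_mul_star, hF]; simp
  have hw : ∀ G : HQ, inner ℝ F G = 0 → ∃ w : V3, G = F * qi w := by
    intro G hG
    refine ⟨qv (star F * G), ?_⟩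
    rw [qi_qv, ← mul_assoc, hFs', one_mul]
    rw [Quaternion.inner_def] at hG
    simp at hG ⊢
    linarith
  obtain ⟨w1, rfl⟩ := hw F1 h1
  obtain ⟨w2, rfl⟩ := hw F2 h2
  have e : ∀ w : V3, F * qi w * qi p * star F + F * qi p * star (F * qi w) =
      F * (qi w * qi p - qi p * qi w) * star F := by
    intro w
    rw [star_mul, star_qi]
    noncomm_ring
  have hm : ∀ x y : HQ, F * x * star F * (F * y * star F) = F * (x * y) * star F := by
    intro x y
    calc F * x * star F * (F * y * star F) = F * x * (star F * F) * y * star F := by noncomm_ring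
      _ = _ := by rw [hFs]; noncomm_ring
  rw [e, e, triple_re, hm, hm, re_sandwich hF, Quaternion.inner_def, Jp_apply]
  · have : F * qi w2 * star (F * qi w1 * qi p) = F * (qi w2 * qi p * qi w1) * star F := by
      rw [star_mul, star_mul, star_qi, star_qi]
      noncomm_ring
    rw [this, re_sandwich hF]
    rw [mem_sph] at hp
    simp
    linear_combination (4 * (p 0 * (w1 1 * w2 2 - w1 2 * w2 1) + p 1 * (w1 2 * w2 0 - w1 0 * w2 2) +
      p 2 * (w1 0 * w2 1 - w1 1 * w2 0))) * hp
  · rw [re_sandwich hF]; simp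
  · rw [re_sandwich hF]; simp; ring
  · rw [re_sandwich hF]; simp; ring

theorem rotq_unit {F : HQ} (hF : ‖F‖ = 1) (p : V3) : rotq F p = qv (F * qi p * star F) := by
  have : F⁻¹ = star F := by
    rw [Quaternion.inv_def, Quaternion.normSq_eq_norm_mul_self, hF]; simp
  rw [rotq, this]

theorem normSq_one {F : HQ} (hF : ‖F‖ = 1) : Quaternion.normSq F = 1 := by
  rw [Quaternion.normSq_eq_norm_mul_self, hF, one_mul]

def starQ : HQ →L[ℝ] HQ :=
  LinearMap.toContinuousLinearMap
    { toFun := fun x => star x, map_add' := star_add, map_smul' := fun r x => Quaternion.star_smul r x }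

@[simp] theorem starQ_apply (x : HQ) : starQ x = star x := rfl

theorem pull_pt {A : Set (ℝ × ℝ)} {q : ℝ × ℝ} (hq : A ∈ 𝓝 q) {F : ℝ × ℝ → HQ} {u : ℝ × ℝ → V3}
    (hF : DifferentiableAt ℝ F q) (hu : DifferentiableAt ℝ u q) {p : V3} (hp : p ∈ sphereS)
    (hFu : ∀ q ∈ A, ‖F q‖ = 1 ∧ rotq (F q) p = u q) :
    pullA u q = -4 * inner ℝ (fderiv ℝ F q (0, 1)) (Jp p (fderiv ℝ F q (1, 0))) := by
  have hdir : ∀ e : ℝ × ℝ, HasDerivAt (fun t : ℝ => q + t • e) e 0 := by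
    intro e
    have := ((hasDerivAt_id (0:ℝ)).smul_const e).const_add q
    simpa using this
  have hq0 : ∀ e : ℝ × ℝ, q = q + (0:ℝ) • e := by intro e; simp
  have hdF : ∀ e, HasDerivAt (fun t : ℝ => F (q + t • e)) (fderiv ℝ F q e) 0 := by
    intro e
    exact hF.hasFDerivAt.comp_hasDerivAt_of_eq 0 (hdir e) (hq0 e)
  have hdu : ∀ e, HasDerivAt (fun t : ℝ => u (q + t • e)) (fderiv ℝ u q e) 0 := by
    intro e
    exact hu.hasFDerivAt.comp_hasDerivAt_of_eq 0 (hdir e) (hq0 e)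
  have hev : ∀ e : ℝ × ℝ, ∀ᶠ t in 𝓝 (0:ℝ), q + t • e ∈ A := by
    intro e
    refine (hdir e).continuousAt.eventually_mem ?_
    simpa using hq
  have hort : ∀ e, inner ℝ (F q) (fderiv ℝ F q e) = 0 := by
    intro e
    have h1 := (hdF e).inner ℝ (hdF e)
    have h2 : (fun t : ℝ => inner ℝ (F (q + t • e)) (F (q + t • e))) =ᶠ[𝓝 0] fun _ => (1:ℝ) := by
      filter_upwards [hev e] with t ht
      rw [real_inner_self_eq_norm_sq, (hFu _ ht).1]; norm_num
    have h3 := h1.unique ((hasDerivAt_const (0:ℝ) (1:ℝ)).congr_of_eventuallyEq h2)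
    simp only [zero_smul, add_zero] at h3
    rw [real_inner_comm (F q)] at h3
    linarith
  have hue : ∀ e, fderiv ℝ u q e =
      qv (fderiv ℝ F q e * qi p * star (F q) + F q * qi p * star (fderiv ℝ F q e)) := by
    intro e
    have h1 := ((hdF e).mul_const (qi p)).mul (starQ.hasFDerivAt.comp_hasDerivAt (0:ℝ) (hdF e))
    have h2 := qv.hasFDerivAt.comp_hasDerivAt (0:ℝ) h1
    have h3 : (fun t : ℝ => u (q + t • e)) =ᶠ[𝓝 0] (qv ∘ ((fun t : ℝ => F (q + t • e) * qi p) *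
        fun t : ℝ => star (F (q + t • e)))) := by
      filter_upwards [hev e] with t ht
      simp only [Function.comp, Pi.mul_apply]
      rw [← (hFu _ ht).2, rotq_unit (hFu _ ht).1]
    have h4 := (hdu e).unique (h2.congr_of_eventuallyEq h3)
    simpa using h4
  have hqA := hFu q (mem_of_mem_nhds hq)
  rw [pullA, hue, hue, ← hqA.2, rotq_unit hqA.1]
  exact pull_alg (normSq_one hqA.1) hp (hort _) (hort _)

theorem zt_det {A : Set (ℝ × ℝ)} {θ : ℝ} (h : DifferentiableAt ℝ (zt A) θ) :
    (zt A θ).1 * (deriv (zt A) θ).2 - (zt A θ).2 * (deriv (zt A) θ).1 = Rad A θ ^ 2 := by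
  have h1 : HasDerivAt (fun θ => (zt A θ).1) (deriv (zt A) θ).1 θ :=
    (ContinuousLinearMap.fst ℝ ℝ ℝ).hasFDerivAt.comp_hasDerivAt θ h.hasDerivAt
  have h2 : HasDerivAt (fun θ => (zt A θ).2) (deriv (zt A) θ).2 θ :=
    (ContinuousLinearMap.snd ℝ ℝ ℝ).hasFDerivAt.comp_hasDerivAt θ h.hasDerivAt
  have h3 := (h1.mul (Real.hasDerivAt_sin θ)).sub (h2.mul (Real.hasDerivAt_cos θ))
  have h4 : (((fun θ => (zt A θ).1) * Real.sin) - ((fun θ => (zt A θ).2) * Real.cos)) =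
      fun _ : ℝ => (0:ℝ) := by
    funext x
    simp [zt, cs]; ring
  rw [h4] at h3
  have h5 := h3.unique (hasDerivAt_const θ (0:ℝ))
  have h6 := Real.sin_sq_add_cos_sq θ
  simp only [zt, cs, Prod.smul_fst, Prod.smul_snd, smul_eq_mul] at h5 ⊢
  linear_combination (-Rad A θ) * h5 + Rad A θ ^ 2 * h6

theorem area_formula {A : Set (ℝ × ℝ)} (hA : GoodSet A) {F : ℝ × ℝ → HQ} {u : ℝ × ℝ → V3}
    (hF : ContDiffOn ℝ 1 F A) (hu : ContDiffOn ℝ 1 u A) {p : V3} (hp : p ∈ sphereS)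
    (hFu : ∀ q ∈ A, ‖F q‖ = 1 ∧ rotq (F q) p = u q) :
    ∫ q in A, pullA u q = -2 * ∫ θ in (0:ℝ)..(2 * Real.pi),
      inner ℝ (deriv (fun θ => F (zt A θ)) θ) (Jp p (F (zt A θ))) := by
  obtain ⟨C, hC⟩ := hA.zt_lip
  have hud : UniqueDiffOn ℝ A := uniqueDiffOn_convex hA.cvx hA.intNe
  have hDc : ContinuousOn (fderivWithin ℝ F A) A := hF.continuousOn_fderivWithin hud le_rfl
  set g : ℝ × ℝ → ℝ := fun q => inner ℝ (fderivWithin ℝ F A q (0, 1))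
    (Jp p (fderivWithin ℝ F A q (1, 0))) with hg
  have hgc : ContinuousOn g A := (hDc.clm_apply continuousOn_const).inner
    ((Jp p).continuous.comp_continuousOn (hDc.clm_apply continuousOn_const))
  have h1 : ∫ q in A, pullA u q = ∫ q in A, -4 * g q := by
    refine setIntegral_congr_ae hA.cpt.isClosed.measurableSet ?_
    have hfr : ∀ᵐ q : ℝ × ℝ, q ∉ frontier A := by
      rw [ae_iff]; simpa using hA.cvx.addHaar_frontier (volume : Measure (ℝ × ℝ))
    filter_upwards [hfr] with q hq hqA
    have hqi : A ∈ 𝓝 q := by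
      rw [← mem_interior_iff_mem_nhds]
      by_contra h
      exact hq ⟨subset_closure hqA, h⟩
    rw [pull_pt hqi ((hF.contDiffAt hqi).differentiableAt one_ne_zero)
      ((hu.contDiffAt hqi).differentiableAt one_ne_zero) hp hFu]
    simp only [hg, fderivWithin_of_mem_nhds hqi]
  rw [h1, integral_const_mul, hA.polar hgc, stokes_aux hA.cpt hA.cvx hA.intNe hF (Jp_skew p) hC
    (zt_per A) (fun t ht θ => hA.smul_zt_mem ht θ)]
  have h2 : ∫ θ in (0:ℝ)..(2 * Real.pi), ∫ t in (0:ℝ)..1, t * Rad A θ ^ 2 * g (t • zt A θ) =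
      ∫ θ in (0:ℝ)..(2 * Real.pi), ∫ t in (0:ℝ)..1,
      inner ℝ (fderivWithin ℝ F A (t • zt A θ) (t • deriv (zt A) θ))
        (Jp p (fderivWithin ℝ F A (t • zt A θ) (zt A θ))) := by
    refine intervalIntegral.integral_congr_ae ?_
    filter_upwards [hC.ae_differentiableAt] with θ hθ _
    refine intervalIntegral.integral_congr fun t _ => ?_
    have hdet := zt_det hθ
    set L := fderivWithin ℝ F A (t • zt A θ) with hL
    have dec : ∀ x : ℝ × ℝ, L x = x.1 • L (1, 0) + x.2 • L (0, 1) := by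
      intro x
      rw [← map_smul, ← map_smul, ← map_add]
      congr 1
      ext <;> simp
    have hs := skew_of (Jp_skew p) (L (1, 0)) (L (0, 1))
    simp only [hg, ← hL]
    rw [dec (t • deriv (zt A) θ), dec (zt A θ)]
    simp only [map_add, map_smul, inner_add_left, inner_add_right, real_inner_smul_left,
      real_inner_smul_right, Jp_skew, hs, Prod.smul_fst, Prod.smul_snd, smul_eq_mul]
    rw [← hdet]
    ring
  rw [h2]; ring

theorem comm_form {p : V3} (hp : p ∈ sphereS) {x : HQ} (hc : x * qi p = qi p * x) (hx : x.re = 0) :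
    ∃ b : ℝ, x = b • qi p := by
  rw [mem_sph] at hp
  have h1 := congrArg (fun q : HQ => q.imI) hc
  have h2 := congrArg (fun q : HQ => q.imJ) hc
  have h3 := congrArg (fun q : HQ => q.imK) hc
  simp at h1 h2 h3
  refine ⟨x.imI * p 0 + x.imJ * p 1 + x.imK * p 2, ?_⟩
  ext
  · simp [hx]
  · simp
    linear_combination (-x.imI) * hp - p 2 / 2 * h2 + p 1 / 2 * h3
  · simp
    linear_combination (-x.imJ) * hp + p 2 / 2 * h1 - p 0 / 2 * h3
  · simp
    linear_combination (-x.imK) * hp - p 1 / 2 * h1 + p 0 / 2 * h2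

theorem norm_Jp {p : V3} (hp : p ∈ sphereS) (x : HQ) : ‖Jp p x‖ = ‖x‖ := by
  rw [Jp_apply, norm_mul]
  have : ‖qi p‖ = 1 := by
    have h := normSq_qi p
    rw [Quaternion.normSq_eq_norm_mul_self, show p ⬝ᵥ p = 1 from hp] at h
    nlinarith [norm_nonneg (qi p)]
  rw [this, mul_one]

theorem ex_hasDerivAt {p : V3} (hp : p ∈ sphereS) (t : ℝ) : HasDerivAt (ex p) (ex p t * qi p) t := by
  have h := ((Real.hasDerivAt_cos t).smul_const (1 : HQ)).add ((Real.hasDerivAt_sin t).smul_const (qi p))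
  refine h.congr_deriv ?_
  rw [ex, add_mul, smul_mul_assoc, smul_mul_assoc, qi_mul_self hp]
  simp [add_comm]

theorem lip_mul {X : Type*} [PseudoMetricSpace X] {f g : X → HQ} {s : Set X} {C D : ℝ≥0}
    (hf : LipschitzOnWith C f s) (hg : LipschitzOnWith D g s)
    (hfb : ∀ x ∈ s, ‖f x‖ ≤ 1) (hgb : ∀ x ∈ s, ‖g x‖ ≤ 1) :
    LipschitzOnWith (C + D) (fun x => f x * g x) s := by
  refine LipschitzOnWith.of_dist_le_mul fun x hx y hy => ?_
  have h1 := hf.dist_le_mul x hx y hy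
  have h2 := hg.dist_le_mul x hx y hy
  rw [dist_eq_norm] at h1 h2 ⊢
  have e : f x * g x - f y * g y = (f x - f y) * g x + f y * (g x - g y) := by noncomm_ring
  rw [e]
  refine (norm_add_le _ _).trans ?_
  rw [norm_mul, norm_mul]
  have := mul_le_mul_of_nonneg_left (hgb x hx) (norm_nonneg (f x - f y))
  have := mul_le_mul_of_nonneg_right (hfb y hy) (norm_nonneg (g x - g y))
  push_cast
  linarith

theorem const_of_lip {E : Type*} [NormedAddCommGroup E] [NormedSpace ℝ E] {G : ℝ → E} {C : ℝ≥0}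
    (hG : LipschitzWith C G) (h0 : ∀ᵐ x, HasDerivAt G 0 x) (x : ℝ) : G x = G 0 := by
  have h1 : AbsolutelyContinuousOnInterval G 0 x :=
    (hG.lipschitzOnWith (s := uIcc 0 x)).absolutelyContinuousOnInterval
  obtain ⟨c, hc⟩ := h1.const_of_ae_hasDerivAt_zero (h0.mono fun y hy _ => hy)
  rw [hc x right_mem_uIcc, hc 0 left_mem_uIcc]

theorem unit_ort {E : ℝ → HQ} (hn : ∀ θ, ‖E θ‖ = 1) {θ : ℝ} {E' : HQ} (h : HasDerivAt E E' θ) :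
    inner ℝ (E θ) E' = 0 := by
  have h1 := h.inner ℝ h
  have h2 : (fun t : ℝ => inner ℝ (E t) (E t)) = fun _ => (1:ℝ) := by
    funext t
    rw [real_inner_self_eq_norm_sq, hn]; norm_num
  rw [h2] at h1
  have h3 := h1.unique (hasDerivAt_const θ (1:ℝ))
  rw [real_inner_comm (E θ)] at h3
  linarith

theorem deriv_form {p : V3} (hp : p ∈ sphereS) {E : ℝ → HQ} (hn : ∀ θ, ‖E θ‖ = 1)
    (hc : ∀ θ, E θ * qi p = qi p * E θ) {θ : ℝ} {E' : HQ} (h : HasDerivAt E E' θ) :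
    E' = (inner ℝ E' (Jp p (E θ)) : ℝ) • (E θ * qi p) := by
  have h1 : E' * qi p = qi p * E' := by
    have a := h.mul_const (qi p)
    have b := h.const_mul (qi p)
    have : (fun y => E y * qi p) = fun y => qi p * E y := funext hc
    rw [this] at a
    exact a.unique b
  have hs : E θ * star (E θ) = 1 := by rw [Quaternion.self_mul_star, normSq_one (hn θ)]; simp
  have hs' : star (E θ) * E θ = 1 := by rw [Quaternion.star_mul_self, normSq_one (hn θ)]; simp
  have h2 : star (E θ) * qi p = qi p * star (E θ) := by
    have := congrArg star (hc θ)
    rw [star_mul, star_mul, star_qi] at this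
    simpa using this.symm
  have h3 : (star (E θ) * E').re = 0 := by
    have := unit_ort hn h
    rw [Quaternion.inner_def] at this
    simp at this ⊢
    linarith
  obtain ⟨b, hb⟩ := comm_form hp (x := star (E θ) * E')
    (by rw [mul_assoc, h1, ← mul_assoc, h2, mul_assoc]) h3
  have h4 : E' = b • (E θ * qi p) := by
    rw [← mul_smul_comm, ← hb, ← mul_assoc, hs, one_mul]
  have h5 : inner ℝ E' (Jp p (E θ)) = b := by
    rw [h4, ← Jp_apply, real_inner_smul_left, real_inner_self_eq_norm_sq, norm_Jp hp, hn]; norm_num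
  rw [h5]; exact h4

theorem inner_bd {p : V3} (hp : p ∈ sphereS) {E : ℝ → HQ} {C : ℝ≥0} (hE : LipschitzWith C E)
    (hn : ∀ θ, ‖E θ‖ = 1) (θ : ℝ) : ‖(inner ℝ (deriv E θ) (Jp p (E θ)) : ℝ)‖ ≤ C := by
  refine (norm_inner_le_norm _ _).trans ?_
  rw [norm_Jp hp, hn, mul_one]
  exact norm_deriv_le_of_lipschitz hE

theorem inner_meas {p : V3} {E : ℝ → HQ} {C : ℝ≥0} (hE : LipschitzWith C E) :
    AEStronglyMeasurable (fun θ => (inner ℝ (deriv E θ) (Jp p (E θ)) : ℝ)) volume := by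
  have h1 : AEStronglyMeasurable (deriv E) volume := aestronglyMeasurable_deriv E _
  exact h1.inner ((Jp p).continuous.comp hE.continuous).aestronglyMeasurable

theorem ii_of_bdd {g : ℝ → ℝ} {C : ℝ} (hm : AEStronglyMeasurable g volume) (hb : ∀ θ, ‖g θ‖ ≤ C)
    (a b : ℝ) : IntervalIntegrable g volume a b :=
  (intervalIntegrable_const (c := C)).mono_fun hm.restrict
    (Filter.Eventually.of_forall fun θ => (hb θ).trans (le_abs_self C))

theorem exists_angle {p : V3} (hp : p ∈ sphereS) {E : ℝ → HQ} {C : ℝ≥0} (hE : LipschitzWith C E)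
    (hn : ∀ θ, ‖E θ‖ = 1) (hc : ∀ θ, E θ * qi p = qi p * E θ)
    (hper : ∀ θ, E (θ + 2 * Real.pi) = E θ) :
    ∃ (m : ℤ) (δ : ℝ → ℝ) (D : ℝ≥0), LipschitzWith D δ ∧ (∀ θ, δ (θ + 2 * Real.pi) = δ θ) ∧
      (∀ θ, E θ = ex p (m * θ + δ θ)) ∧
      ∫ θ in (0:ℝ)..(2 * Real.pi), (inner ℝ (deriv E θ) (Jp p (E θ)) : ℝ) = 2 * Real.pi * m := by
  set g : ℝ → ℝ := fun θ => inner ℝ (deriv E θ) (Jp p (E θ)) with hg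
  have hgb : ∀ θ, ‖g θ‖ ≤ C := inner_bd hp hE hn
  have hgi : ∀ a b, IntervalIntegrable g volume a b := ii_of_bdd (inner_meas hE) hgb
  have hgp : Function.Periodic g (2 * Real.pi) := by
    intro θ
    have : deriv E (θ + 2 * Real.pi) = deriv E θ := by
      rw [← deriv_comp_add_const]
      congr 1; funext x; exact hper x
    simp only [hg]
    rw [this, hper]
  set χ : ℝ → ℝ := fun θ => ∫ t in (0:ℝ)..θ, g t with hχ
  have hχsub : ∀ a b, χ a - χ b = ∫ t in b..a, g t := by
    intro a b
    rw [hχ]; simp only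
    rw [intervalIntegral.integral_interval_sub_left (hgi _ _) (hgi _ _)]
  have hχl : LipschitzWith C χ := by
    refine LipschitzWith.of_dist_le_mul fun a b => ?_
    rw [Real.dist_eq, hχsub, ← Real.norm_eq_abs, Real.dist_eq]
    exact intervalIntegral.norm_integral_le_of_norm_le_const fun x _ => hgb x
  have hexl : LipschitzWith 1 (ex p) := by
    refine lipschitzWith_of_nnnorm_deriv_le (fun t => (ex_hasDerivAt hp t).differentiableAt) ?_
    intro t
    rw [(ex_hasDerivAt hp t).deriv, ← Jp_apply]
    have : ‖ex p t‖ = 1 := by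
      have h := ex_normSq hp t
      rw [Quaternion.normSq_eq_norm_mul_self] at h
      nlinarith [norm_nonneg (ex p t)]
    have h2 := norm_Jp hp (ex p t)
    rw [this] at h2
    exact_mod_cast h2.le
  have hexn : ∀ t, ‖ex p t‖ = 1 := by
    intro t
    have h := ex_normSq hp t
    rw [Quaternion.normSq_eq_norm_mul_self] at h
    nlinarith [norm_nonneg (ex p t)]
  have hG : LipschitzWith (C + 1 * C) (fun θ => E θ * ex p (-χ θ)) := by
    have h1 : LipschitzWith (1 * C) (fun θ => ex p (-χ θ)) := hexl.comp hχl.neg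
    exact lipschitzOnWith_univ.1 (lip_mul (lipschitzOnWith_univ.2 hE) (lipschitzOnWith_univ.2 h1)
      (fun x _ => (hn x).le) (fun x _ => (hexn _).le))
  have hχd : ∀ᵐ θ, HasDerivAt χ (g θ) θ := by
    have hloc : LocallyIntegrable g volume := by
      refine (locallyIntegrable_const (C:ℝ)).mono (inner_meas hE) (Filter.Eventually.of_forall fun θ => ?_)
      exact (hgb θ).trans (le_abs_self _)
    filter_upwards [LocallyIntegrable.ae_hasDerivAt_integral hloc] with θ h using h 0
  have hconst := const_of_lip hG (by
    filter_upwards [hχd, hE.ae_differentiableAt] with θ h1 h2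
    have h3 := h2.hasDerivAt.mul ((ex_hasDerivAt hp (-χ θ)).scomp θ h1.neg)
    refine h3.congr_deriv ?_
    have h4 := deriv_form hp hn hc h2.hasDerivAt
    rw [h4]
    show g θ • (E θ * qi p) * ex p (-χ θ) + E θ * (-g θ • (ex p (-χ θ) * qi p)) = 0
    rw [ex_comm, smul_mul_assoc, mul_smul_comm, ← mul_assoc, neg_smul, add_neg_cancel])
  obtain ⟨κ, hκ⟩ := exists_ex hp (normSq_one (hn 0)) (hc 0)
  have hχ0 : χ 0 = 0 := by simp [hχ]
  have hEx : ∀ θ, E θ = ex p (κ + χ θ) := by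
    intro θ
    have h := hconst θ
    simp only [hχ0, neg_zero, ex_zero, mul_one] at h
    rw [ex_add hp, ← hκ, ← h, mul_assoc, ex_neg_mul hp, mul_one]
  have h2π : ex p (χ (2 * Real.pi)) = 1 := by
    have h := hper 0
    rw [zero_add, hEx, hEx 0, hχ0, add_zero, ex_add hp] at h
    have := congrArg (fun x => ex p (-κ) * x) h
    rwa [← mul_assoc, ex_neg_mul hp, one_mul] at this
  have hcos : Real.cos (χ (2 * Real.pi)) = 1 := by
    have := congrArg (fun q : HQ => q.re) h2π
    simpa [ex] using this
  obtain ⟨m, hm⟩ := (Real.cos_eq_one_iff _).1 hcos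
  refine ⟨m, fun θ => χ θ - m * θ + κ, C + ‖(m:ℝ)‖₊, ?_, ?_, ?_, ?_⟩
  · refine LipschitzWith.of_dist_le_mul fun a b => ?_
    have h1 := hχl.dist_le_mul a b
    rw [Real.dist_eq] at h1 ⊢
    rw [show χ a - m * a + κ - (χ b - m * b + κ) = (χ a - χ b) - m * (a - b) by ring]
    refine (abs_sub _ _).trans ?_
    rw [abs_mul]
    push_cast
    rw [Real.norm_eq_abs, add_mul, ← Real.dist_eq a b]
    linarith
  · intro θ
    have h1 := hχsub (θ + 2 * Real.pi) θ
    have h2 := hgp.intervalIntegral_add_eq θ 0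
    rw [zero_add] at h2
    have h3 : χ (2 * Real.pi) = ∫ t in (0:ℝ)..(2 * Real.pi), g t := rfl
    simp only
    linarith
  · intro θ
    rw [hEx]; congr 1; ring
  · rw [mul_comm _ (m:ℝ), hm]

/-- the primitive one-form on the sphere minus `-p` -/
def gam (p v w : V3) : ℝ := (p ⬝ᵥ crossProduct v w) / (1 + v ⬝ᵥ p)

theorem lip_normalize {f : ℝ → HQ} {C : ℝ≥0} (hf : LipschitzWith C f) {r : ℝ} (hr : 0 < r)
    (hb : ∀ x, r ≤ ‖f x‖) : ∃ D : ℝ≥0, LipschitzWith D (fun x => ‖f x‖⁻¹ • f x) := by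
  refine ⟨Real.toNNReal (2 * C / r), LipschitzWith.of_dist_le_mul fun a b => ?_⟩
  rw [Real.coe_toNNReal _ (by positivity)]
  have h1 := hf.dist_le_mul a b
  have ha := hb a
  have hb' := hb b
  have ha0 : 0 < ‖f a‖ := hr.trans_le ha
  have hb0 : 0 < ‖f b‖ := hr.trans_le hb'
  have h2 := abs_norm_sub_norm_le (f a) (f b)
  rw [dist_eq_norm] at h1 ⊢
  have e : ‖f a‖⁻¹ • f a - ‖f b‖⁻¹ • f b =
      ‖f a‖⁻¹ • ((f a - f b) + ((‖f b‖ - ‖f a‖) * ‖f b‖⁻¹) • f b) := by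
    rw [smul_add, smul_sub, smul_smul]
    have : ‖f a‖⁻¹ * ((‖f b‖ - ‖f a‖) * ‖f b‖⁻¹) = ‖f a‖⁻¹ - ‖f b‖⁻¹ := by field_simp
    rw [this, sub_smul]; abel
  rw [e, norm_smul, norm_inv, norm_norm]
  have h3 : ‖(f a - f b) + ((‖f b‖ - ‖f a‖) * ‖f b‖⁻¹) • f b‖ ≤ 2 * (C * dist a b) := by
    refine (norm_add_le _ _).trans ?_
    rw [norm_smul, norm_mul, norm_inv, norm_norm, mul_assoc, inv_mul_cancel₀ hb0.ne', mul_one,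
      Real.norm_eq_abs, abs_sub_comm]
    linarith
  calc ‖f a‖⁻¹ * _ ≤ r⁻¹ * (2 * (C * dist a b)) := by gcongr
    _ = _ := by ring

theorem Lam_normSq {p v : V3} (hp : p ∈ sphereS) (hv : v ∈ sphereS) :
    ‖Lam p 1 v‖ ^ 2 = 2 * (1 + v ⬝ᵥ p) := by
  rw [pow_two, ← Quaternion.normSq_eq_norm_mul_self]
  rw [mem_sph] at hp hv
  simp only [Lam, dot3, Quaternion.normSq_def', one_smul]
  simp
  linear_combination (v 0 * v 0 + v 1 * v 1 + v 2 * v 2) * hp + hv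

theorem Lam_inner {p : V3} (hp : p ∈ sphereS) (v w : V3) :
    inner ℝ (-(qi w * qi p)) (Jp p (Lam p 1 v)) = -(p ⬝ᵥ crossProduct v w) := by
  have e : Jp p (Lam p 1 v) = qi p + qi v := by
    rw [Jp_apply, Lam, one_smul, sub_mul, mul_assoc, qi_mul_self hp]; simp
  rw [e, Quaternion.inner_def]
  rw [dot3]
  simp [cross_apply]
  ring

theorem inner_prod {σ E : HQ} (hσ : Quaternion.normSq σ = 1) (hE : Quaternion.normSq E = 1) {p : V3}
    (hc : E * qi p = qi p * E) (a b : HQ) :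
    inner ℝ (a * E + σ * b) (Jp p (σ * E)) = inner ℝ a (Jp p σ) + inner ℝ b (Jp p E) := by
  rw [inner_add_left]
  congr 1
  · have e : Jp p (σ * E) = Jp p σ * E := by
      rw [Jp_apply, Jp_apply, mul_assoc, hc, ← mul_assoc]
    have : E * star E = 1 := by rw [Quaternion.self_mul_star, hE]; simp
    rw [e, Quaternion.inner_def, Quaternion.inner_def, star_mul]
    rw [show a * E * (star E * star (Jp p σ)) = a * (E * star E) * star (Jp p σ) by noncomm_ring,
      this, mul_one]
  · have e : Jp p (σ * E) = σ * Jp p E := by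
      rw [Jp_apply, Jp_apply, mul_assoc]
    rw [e, Quaternion.inner_def, Quaternion.inner_def, star_mul]
    rw [show σ * b * (star (Jp p E) * star σ) = σ * (b * star (Jp p E)) * star σ by noncomm_ring,
      re_sandwich hσ]

theorem boundary {p : V3} (hp : p ∈ sphereS) {v : ℝ → V3} {W : ℝ → HQ} {Cv Cw : ℝ≥0}
    (hv : LipschitzWith Cv v) (hvs : ∀ θ, v θ ∈ sphereS) (hvn : ∀ θ, v θ ≠ -p)
    (hvp : ∀ θ, v (θ + 2 * Real.pi) = v θ) (hW : LipschitzWith Cw W) (hWn : ∀ θ, ‖W θ‖ = 1)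
    (hWp : ∀ θ, W (θ + 2 * Real.pi) = W θ) (hWv : ∀ θ, rotq (W θ) p = v θ) :
    ∃ (m : ℤ) (δ : ℝ → ℝ) (D : ℝ≥0), LipschitzWith D δ ∧ (∀ θ, δ (θ + 2 * Real.pi) = δ θ) ∧
      (∀ θ, W θ = (‖Lam p 1 (v θ)‖⁻¹ • Lam p 1 (v θ)) * ex p (m * θ + δ θ)) ∧
      -2 * ∫ θ in (0:ℝ)..(2 * Real.pi), (inner ℝ (deriv W θ) (Jp p (W θ)) : ℝ) =
        (∫ θ in (0:ℝ)..(2 * Real.pi), gam p (v θ) (deriv v θ)) - 4 * Real.pi * m := by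
  -- lower bound
  obtain ⟨c, hc, hcb⟩ : ∃ c : ℝ, 0 < c ∧ ∀ θ, c ≤ ‖Lam p 1 (v θ)‖ := by
    have hcont : Continuous fun θ => ‖Lam p 1 (v θ)‖ := by
      unfold Lam
      have := hv.continuous
      fun_prop
    obtain ⟨θ0, -, h0⟩ := isCompact_Icc.exists_isMinOn (s := Icc (0:ℝ) (2 * Real.pi))
      ⟨0, by simp [Real.pi_pos.le]⟩ hcont.continuousOn
    refine ⟨‖Lam p 1 (v θ0)‖,
      norm_pos_iff.2 (ne_zero_of_re (Lam_re_pos hp (hvs θ0) (hvn θ0) (by simp))), fun θ => ?_⟩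
    have hper : Function.Periodic (fun θ => ‖Lam p 1 (v θ)‖) (2 * Real.pi) := by
      intro θ; simp only [hvp]
    obtain ⟨y, hy, hyy⟩ := hper.exists_mem_Ico₀ (by positivity) θ
    rw [hyy]
    exact h0 (Ico_subset_Icc_self hy)
  have hL0 : ∀ θ, Lam p 1 (v θ) ≠ 0 := fun θ => norm_pos_iff.1 (hc.trans_le (hcb θ))
  have hLT : ∀ θ, Lam p 1 (v θ) = 1 - ((Jp p).comp qi) (v θ) := by
    intro θ; simp [Lam, Jp_apply]
  have hLl : ∃ C : ℝ≥0, LipschitzWith C (fun θ => Lam p 1 (v θ)) := by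
    simp only [hLT]
    exact ⟨_, (LipschitzWith.const (1:HQ)).sub (((Jp p).comp qi).lipschitz.comp hv)⟩
  obtain ⟨CL, hCL⟩ := hLl
  obtain ⟨Cσ, hσ⟩ := lip_normalize hCL hc hcb
  set σ : ℝ → HQ := fun θ => ‖Lam p 1 (v θ)‖⁻¹ • Lam p 1 (v θ) with hσd
  have hσn : ∀ θ, ‖σ θ‖ = 1 := by
    intro θ
    simp only [hσd]
    rw [norm_smul, norm_inv, norm_norm, inv_mul_cancel₀ (norm_ne_zero_iff.2 (hL0 θ))]
  have hss : ∀ θ, star (σ θ) * σ θ = 1 := by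
    intro θ; rw [Quaternion.star_mul_self, normSq_one (hσn θ)]; simp
  have hss' : ∀ θ, σ θ * star (σ θ) = 1 := by
    intro θ; rw [Quaternion.self_mul_star, normSq_one (hσn θ)]; simp
  have hσp : ∀ θ, σ θ * qi p = qi (v θ) * σ θ := by
    intro θ
    refine rotq_eq' (norm_ne_zero_iff.1 (by rw [hσn]; norm_num)) ?_
    simp only [hσd]
    rw [rotq_smul (inv_ne_zero (norm_ne_zero_iff.2 (hL0 θ))), Lam_one_rot hp (hvs θ) (hvn θ)]
  have hWq : ∀ θ, W θ * qi p = qi (v θ) * W θ := by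
    intro θ
    exact rotq_eq' (norm_ne_zero_iff.1 (by rw [hWn]; norm_num)) (hWv θ)
  set E : ℝ → HQ := fun θ => star (σ θ) * W θ with hEd
  have hEl : LipschitzWith (‖starQ‖₊ * Cσ + Cw) E := by
    have h1 : LipschitzWith (‖starQ‖₊ * Cσ) (fun θ => star (σ θ)) := starQ.lipschitz.comp hσ
    exact lipschitzOnWith_univ.1 (lip_mul (lipschitzOnWith_univ.2 h1) (lipschitzOnWith_univ.2 hW)
      (fun x _ => by rw [norm_star, hσn]) (fun x _ => (hWn _).le))
  have hEn : ∀ θ, ‖E θ‖ = 1 := by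
    intro θ; simp only [hEd]; rw [norm_mul, norm_star, hσn, hWn, one_mul]
  have hEc : ∀ θ, E θ * qi p = qi p * E θ := by
    intro θ
    have h1 : qi p * star (σ θ) = star (σ θ) * qi (v θ) := by
      calc qi p * star (σ θ) = (star (σ θ) * σ θ) * qi p * star (σ θ) := by rw [hss, one_mul]
        _ = star (σ θ) * (σ θ * qi p) * star (σ θ) := by noncomm_ring
        _ = star (σ θ) * qi (v θ) * (σ θ * star (σ θ)) := by rw [hσp]; noncomm_ring
        _ = _ := by rw [hss', mul_one]
    simp only [hEd]
    rw [mul_assoc, hWq, ← mul_assoc, ← mul_assoc, h1]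
  have hEp : ∀ θ, E (θ + 2 * Real.pi) = E θ := by
    intro θ; simp only [hEd, hσd, hvp, hWp]
  have hWE : ∀ θ, W θ = σ θ * E θ := by
    intro θ; simp only [hEd]; rw [← mul_assoc, hss', one_mul]
  obtain ⟨m, δ, D, hδ, hδp, hEe, hintg⟩ := exists_angle hp hEl hEn hEc hEp
  refine ⟨m, δ, D, hδ, hδp, fun θ => by rw [← hEe]; exact hWE θ, ?_⟩
  have key1 : ∀ᵐ θ, (inner ℝ (deriv W θ) (Jp p (W θ)) : ℝ) =
      inner ℝ (deriv σ θ) (Jp p (σ θ)) + inner ℝ (deriv E θ) (Jp p (E θ)) := by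
    filter_upwards [hσ.ae_differentiableAt, hEl.ae_differentiableAt] with θ h1 h2
    have h3 : HasDerivAt W (deriv σ θ * E θ + σ θ * deriv E θ) θ := by
      have := h1.hasDerivAt.mul h2.hasDerivAt
      have e : W = σ * E := funext hWE
      rw [e]; exact this
    rw [h3.deriv, hWE θ]
    exact inner_prod (normSq_one (hσn θ)) (normSq_one (hEn θ)) (hEc θ) _ _
  have key2 : ∀ᵐ θ, (inner ℝ (deriv σ θ) (Jp p (σ θ)) : ℝ) = -(1/2) * gam p (v θ) (deriv v θ) := by
    filter_upwards [hv.ae_differentiableAt] with θ h1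
    have hL : HasDerivAt (fun θ => Lam p 1 (v θ)) (-(qi (deriv v θ) * qi p)) θ := by
      have h2 := ((Jp p).comp qi).hasFDerivAt.comp_hasDerivAt θ h1.hasDerivAt
      have h3 := h2.const_sub (1:HQ)
      have e : (fun θ => Lam p 1 (v θ)) = fun x => (1:HQ) - (⇑((Jp p).comp qi) ∘ v) x := funext hLT
      rw [e]; exact h3
    have hν : DifferentiableAt ℝ (fun θ => ‖Lam p 1 (v θ)‖⁻¹) θ :=
      (hL.differentiableAt.norm ℝ (hL0 θ)).inv (norm_ne_zero_iff.2 (hL0 θ))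
    have h4 := hν.hasDerivAt.smul hL
    have h5 : deriv σ θ = _ := h4.deriv
    rw [h5]
    simp only [hσd]
    rw [map_smul, inner_add_left, real_inner_smul_left, real_inner_smul_left, real_inner_smul_right,
      real_inner_smul_right, Jp_skew, Lam_inner hp, gam]
    have h6 := Lam_normSq hp (hvs θ)
    have h7 := dot_gt (hvs θ) hp (hvn θ)
    have h8 := norm_ne_zero_iff.2 (hL0 θ)
    have h9 : ‖Lam p 1 (v θ)‖⁻¹ * ‖Lam p 1 (v θ)‖⁻¹ = (2 * (1 + v θ ⬝ᵥ p))⁻¹ := by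
      rw [← h6, pow_two, _root_.mul_inv_rev]
    rw [← mul_assoc, h9]
    field_simp
    ring
  have i1 := ii_of_bdd (inner_meas (p := p) hσ) (inner_bd hp hσ hσn) 0 (2 * Real.pi)
  have i2 := ii_of_bdd (inner_meas (p := p) hEl) (inner_bd hp hEl hEn) 0 (2 * Real.pi)
  rw [intervalIntegral.integral_congr_ae (key1.mono fun x hx _ => hx),
    intervalIntegral.integral_add i1 i2, hintg,
    intervalIntegral.integral_congr_ae (key2.mono fun x hx _ => hx),
    intervalIntegral.integral_const_mul]
  ring

theorem lipOn_of_C1 {E : Type*} [NormedAddCommGroup E] [NormedSpace ℝ E] {A : Set (ℝ × ℝ)}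
    (hA : GoodSet A) {F : ℝ × ℝ → E} (hF : ContDiffOn ℝ 1 F A) :
    ∃ K : ℝ≥0, LipschitzOnWith K F A := by
  have hud : UniqueDiffOn ℝ A := uniqueDiffOn_convex hA.cvx hA.intNe
  have hDc : ContinuousOn (fderivWithin ℝ F A) A := hF.continuousOn_fderivWithin hud le_rfl
  have hFd : ∀ q ∈ A, HasFDerivWithinAt F (fderivWithin ℝ F A q) A q := fun q hq =>
    (hF.differentiableOn one_ne_zero q hq).hasFDerivWithinAt
  obtain ⟨K, hK⟩ := (hA.cpt.image_of_continuousOn hDc).isBounded.exists_norm_le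
  have hK' : ∀ q ∈ A, ‖fderivWithin ℝ F A q‖ ≤ max K 0 := fun q hq =>
    (hK _ (mem_image_of_mem _ hq)).trans (le_max_left _ _)
  refine ⟨Real.toNNReal (max K 0), LipschitzOnWith.of_dist_le_mul fun x hx y hy => ?_⟩
  rw [Real.coe_toNNReal _ (le_max_right _ _), dist_eq_norm, dist_eq_norm]
  exact hA.cvx.norm_image_sub_le_of_norm_hasFDerivWithin_le hFd hK' hy hx

theorem zt_mem {A : Set (ℝ × ℝ)} (hA : GoodSet A) (θ : ℝ) : zt A θ ∈ A := by
  simpa using hA.smul_zt_mem (t := 1) (by simp) θ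

theorem cone_lip {A : Set (ℝ × ℝ)} (hA : GoodSet A) : ∃ K : ℝ≥0,
    LipschitzOnWith K (fun q : ℝ × ℝ => q.1 • zt A q.2) (Icc 0 1 ×ˢ univ) := by
  obtain ⟨C, hC⟩ := hA.zt_lip
  obtain ⟨B, hB⟩ := hA.cpt.isBounded.exists_norm_le
  have hB0 : 0 ≤ B := (norm_nonneg _).trans (hB _ (zt_mem hA 0))
  refine ⟨Real.toNNReal (B + C), LipschitzOnWith.of_dist_le_mul fun x hx y hy => ?_⟩
  rw [Real.coe_toNNReal _ (by positivity), dist_eq_norm]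
  have e : x.1 • zt A x.2 - y.1 • zt A y.2 = (x.1 - y.1) • zt A x.2 + y.1 • (zt A x.2 - zt A y.2) := by
    module
  rw [e]
  refine (norm_add_le _ _).trans ?_
  rw [norm_smul, norm_smul, ← dist_eq_norm, ← dist_eq_norm]
  have h1 : dist x.1 y.1 ≤ dist x y := by rw [Prod.dist_eq]; exact le_max_left _ _
  have h2 : dist x.2 y.2 ≤ dist x y := by rw [Prod.dist_eq]; exact le_max_right _ _
  have h3 := hC.dist_le_mul x.2 y.2
  have h4 : ‖y.1‖ ≤ 1 := by
    have := hy.1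
    rw [Real.norm_eq_abs, abs_of_nonneg this.1]; exact this.2
  have h5 := hB _ (zt_mem hA x.2)
  have h6 : dist x.1 y.1 * ‖zt A x.2‖ ≤ dist x y * B := by gcongr
  have h7 : ‖y.1‖ * dist (zt A x.2) (zt A y.2) ≤ 1 * (C * dist x y) := by
    gcongr
    exact h3.trans (by gcongr)
  linarith

theorem disk_formula {deg : (V3 → V3) → ℤ} (hdeg : DegreeTheory deg) {A : Set (ℝ × ℝ)}
    (hA : GoodSet A) {u : ℝ × ℝ → V3} (hu : ContDiffOn ℝ 1 u A) (hus : ∀ q ∈ A, u q ∈ sphereS)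
    {p : V3} (hp : p ∈ sphereS) (hbd : ∀ θ, u (zt A θ) ≠ -p)
    {θ : ℝ → ℝ} (hθ : Continuous θ) (hθp : ∀ φ, θ (φ + 2 * Real.pi) = θ φ + 2 * Real.pi)
    {f : V3 → V3} (hf : ∀ x ∈ sphereS, f x = glue (fun ρ φ => u (ρ • zt A (θ φ)))
      (fun ρ φ => geo p (u (zt A (θ φ))) ρ) x) :
    ∫ q in A, pullA u q = (∫ t in (0:ℝ)..(2 * Real.pi),
      gam p (u (zt A t)) (deriv (fun t => u (zt A t)) t)) + 4 * Real.pi * deg f := by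
  obtain ⟨F, hF, hFu⟩ := exists_lift hA.cpt hA.cvx hA.zero_mem hu hus hp
  obtain ⟨C, hC⟩ := hA.zt_lip
  obtain ⟨Ku, hKu⟩ := lipOn_of_C1 hA hu
  obtain ⟨KF, hKF⟩ := lipOn_of_C1 hA hF
  obtain ⟨Kc, hKc⟩ := cone_lip hA
  have hvl : LipschitzWith (Ku * C) (fun t => u (zt A t)) :=
    lipschitzOnWith_univ.1 (hKu.comp (lipschitzOnWith_univ.2 hC) (fun t _ => zt_mem hA t))
  have hWl : LipschitzWith (KF * C) (fun t => F (zt A t)) :=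
    lipschitzOnWith_univ.1 (hKF.comp (lipschitzOnWith_univ.2 hC) (fun t _ => zt_mem hA t))
  have hper := zt_per (A := A)
  obtain ⟨m, δ, D, hδ, hδp, hE, hintg⟩ := boundary hp hvl (fun t => hus _ (zt_mem hA t)) hbd
    (fun t => by simp only [hper]) hWl (fun t => (hFu _ (zt_mem hA t)).1)
    (fun t => by simp only [hper]) (fun t => (hFu _ (zt_mem hA t)).2)
  have hd : deg f = -m := by
    refine deg_lift hdeg hp m (fun t φ => F (t • zt A φ)) (fun t => u (zt A t)) δ
      (hKF.comp hKc (fun q hq => hA.smul_zt_mem hq.1 q.2)) hvl hδ ?_ ?_ ?_ hδp ?_ hbd ?_ θ hθ hθp ?_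
    · intro t ht φ; exact (hFu _ (hA.smul_zt_mem ht φ)).1
    · intro t φ; simp only [hper]
    · intro φ; simp
    · intro φ; simp only [one_smul]; exact (hFu _ (zt_mem hA φ)).2
    · intro φ; simp only [one_smul]; exact hE φ
    · intro x hx
      rw [hf x hx]
      refine glue_congr ?_ (fun _ _ _ => rfl) x hx
      intro ρ hρ φ
      exact (hFu _ (hA.smul_zt_mem hρ _)).2.symm
  rw [area_formula hA hF hu hp hFu, hintg, hd]
  push_cast
  ring

theorem reparam {v : ℝ → V3} {C : ℝ≥0} (hv : LipschitzWith C v)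
    (hvp : ∀ t, v (t + 2 * Real.pi) = v t) {G : V3 → V3 → ℝ}
    (hG : ∀ (c : ℝ) (x w : V3), G x (c • w) = c * G x w) {θ : ℝ → ℝ} (hθ : Continuous θ)
    (hθm : Monotone θ) (hθp : ∀ φ, θ (φ + 2 * Real.pi) = θ φ + 2 * Real.pi) {D : Set ℝ}
    (hD : D.Finite) (hθd : ∀ φ ∈ Icc 0 (2 * Real.pi) \ D, DifferentiableAt ℝ θ φ) :
    ∫ φ in Icc 0 (2 * Real.pi), G (v (θ φ)) (deriv (fun ψ => v (θ ψ)) φ) =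
      ∫ t in (0:ℝ)..(2 * Real.pi), G (v t) (deriv v t) := by
  have hπ : (0:ℝ) ≤ 2 * Real.pi := by positivity
  set g : ℝ → ℝ := fun t => G (v t) (deriv v t) with hg
  have hgp : Function.Periodic g (2 * Real.pi) := by
    intro t
    have : deriv v (t + 2 * Real.pi) = deriv v t := by
      rw [← deriv_comp_add_const]
      congr 1; funext x; exact hvp x
    simp only [hg]
    rw [this, hvp]
  set s : Set ℝ := Icc 0 (2 * Real.pi) \ D with hs
  have hsm : MeasurableSet s := measurableSet_Icc.diff hD.measurableSet
  have hder : ∀ x ∈ s, HasDerivWithinAt θ (deriv θ x) s x := fun x hx =>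
    (hθd x hx).hasDerivAt.hasDerivWithinAt
  have hs_ae : (s : Set ℝ) =ᵐ[volume] Icc 0 (2 * Real.pi) :=
    sdiff_null_ae_eq_self (hD.measure_zero _)
  have himg : θ '' Icc 0 (2 * Real.pi) = Icc (θ 0) (θ 0 + 2 * Real.pi) := by
    have h2 : θ (2 * Real.pi) = θ 0 + 2 * Real.pi := by rw [← hθp, zero_add]
    rw [← h2]
    refine Subset.antisymm ?_ (intermediate_value_Icc hπ hθ.continuousOn)
    rintro _ ⟨x, hx, rfl⟩
    exact ⟨hθm hx.1, hθm hx.2⟩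
  have himg_ae : (θ '' s : Set ℝ) =ᵐ[volume] Icc (θ 0) (θ 0 + 2 * Real.pi) := by
    rw [← himg]
    have h1 : (θ '' Icc 0 (2 * Real.pi) \ θ '' D : Set ℝ) =ᵐ[volume] θ '' Icc 0 (2 * Real.pi) :=
      sdiff_null_ae_eq_self ((hD.image θ).measure_zero _)
    refine Filter.EventuallyLE.antisymm (Filter.Eventually.of_forall (image_mono sdiff_subset)) ?_
    refine h1.symm.le.trans (Filter.Eventually.of_forall ?_)
    rintro _ ⟨⟨x, hx, rfl⟩, hxD⟩
    exact ⟨x, ⟨hx, fun h => hxD ⟨x, h, rfl⟩⟩, rfl⟩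
  have hcv := integral_image_eq_integral_deriv_smul_of_monotoneOn hsm hder (hθm.monotoneOn s) g
  have hN : volume {t | ¬ DifferentiableAt ℝ v t} = 0 := hv.ae_differentiableAt
  have hNm : MeasurableSet {t | ¬ DifferentiableAt ℝ v t} :=
    (measurableSet_of_differentiableAt ℝ v).compl
  have hae : ∀ᵐ x ∂(volume.restrict s), DifferentiableAt ℝ v (θ x) ∨ deriv θ x = 0 := by
    have h1 := lintegral_image_eq_lintegral_deriv_mul_of_monotoneOn hsm hder (hθm.monotoneOn s)
      ({t | ¬ DifferentiableAt ℝ v t}.indicator 1)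
    have h2 : ∫⁻ x in θ '' s, ({t | ¬ DifferentiableAt ℝ v t}.indicator 1 : ℝ → ENNReal) x = 0 := by
      refine le_antisymm ((setLIntegral_le_lintegral _ _).trans ?_) bot_le
      rw [lintegral_indicator_one hNm, hN]
    rw [h2] at h1
    have hmeas : Measurable (fun x => ENNReal.ofReal (deriv θ x) *
        ({t | ¬ DifferentiableAt ℝ v t}.indicator 1 : ℝ → ENNReal) (θ x)) := by
      refine (measurable_deriv θ).ennreal_ofReal.mul ?_
      exact (measurable_one.indicator hNm).comp hθ.measurable
    have h3 := (lintegral_eq_zero_iff hmeas).1 h1.symm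
    filter_upwards [h3] with x hx
    by_cases hd : DifferentiableAt ℝ v (θ x)
    · exact Or.inl hd
    · right
      have h4 : θ x ∈ {t | ¬ DifferentiableAt ℝ v t} := hd
      simp only [indicator_of_mem h4, Pi.one_apply, mul_one, Pi.zero_apply, ENNReal.ofReal_eq_zero] at hx
      exact le_antisymm hx (hθm.deriv_nonneg)
  have hlhs : ∫ φ in s, G (v (θ φ)) (deriv (fun ψ => v (θ ψ)) φ) = ∫ x in s, deriv θ x • g (θ x) := by
    refine integral_congr_ae ?_
    filter_upwards [hae, ae_restrict_mem hsm] with x hx hxs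
    have hdx := (hθd x hxs).hasDerivAt
    have : deriv (fun ψ => v (θ ψ)) x = deriv θ x • deriv v (θ x) := by
      rcases hx with hx | hx
      · exact (hx.hasDerivAt.scomp x hdx).deriv
      · rw [hx, zero_smul]
        rw [hx] at hdx
        refine HasDerivAt.deriv ?_
        rw [hasDerivAt_iff_isLittleO] at hdx ⊢
        simp only [smul_zero, sub_zero] at hdx ⊢
        refine Asymptotics.IsBigO.trans_isLittleO ?_ hdx
        refine Asymptotics.IsBigO.of_bound C (Filter.Eventually.of_forall fun y => ?_)
        have := hv.dist_le_mul (θ y) (θ x)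
        rwa [dist_eq_norm, dist_eq_norm] at this
    rw [this, hG, smul_eq_mul]
  calc _ = ∫ φ in s, G (v (θ φ)) (deriv (fun ψ => v (θ ψ)) φ) := (setIntegral_congr_set hs_ae).symm
    _ = ∫ x in θ '' s, g x := by rw [hlhs, hcv]
    _ = ∫ x in Icc (θ 0) (θ 0 + 2 * Real.pi), g x := setIntegral_congr_set himg_ae
    _ = ∫ x in (θ 0)..(θ 0 + 2 * Real.pi), g x := by
        rw [intervalIntegral.integral_of_le (by linarith), integral_Icc_eq_integral_Ioc]
    _ = _ := by
        have := hgp.intervalIntegral_add_eq (θ 0) 0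
        rw [this, zero_add]

theorem onb_expand {e₁ e₂ : V3} (h1 : e₁ ⬝ᵥ e₁ = 1) (h2 : e₂ ⬝ᵥ e₂ = 1) (h12 : e₁ ⬝ᵥ e₂ = 0) {N : V3}
    (hN : crossProduct e₁ e₂ = N) (x : V3) :
    x = (x ⬝ᵥ e₁) • e₁ + (x ⬝ᵥ e₂) • e₂ + (x ⬝ᵥ N) • N := by
  have hNN : N ⬝ᵥ N = 1 := by
    rw [← hN, cross_dot_cross, h1, h2, h12, dotProduct_comm e₂ e₁, h12]; norm_num
  have h1N : e₁ ⬝ᵥ N = 0 := by rw [← hN]; exact dot_self_cross _ _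
  have h2N : e₂ ⬝ᵥ N = 0 := by rw [← hN]; exact dot_cross_self _ _
  set M : Matrix (Fin 3) (Fin 3) ℝ := Matrix.of ![e₁, e₂, N] with hM
  have hMM : M * Mᵀ = 1 := by
    ext i j
    have : (M * Mᵀ) i j = M i ⬝ᵥ M j := rfl
    rw [this]
    have h21 : e₂ ⬝ᵥ e₁ = 0 := by rw [dotProduct_comm, h12]
    have hN1 : N ⬝ᵥ e₁ = 0 := by rw [dotProduct_comm, h1N]
    have hN2 : N ⬝ᵥ e₂ = 0 := by rw [dotProduct_comm, h2N]
    have m0 : M 0 = e₁ := rfl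
    have m1 : M 1 = e₂ := rfl
    have m2 : M 2 = N := rfl
    clear_value M
    fin_cases i <;> fin_cases j <;>
      simp [m0, m1, m2, h1, h2, h12, h1N, h2N, hNN, h21, hN1, hN2]
  have hMM' : Mᵀ * M = 1 := mul_eq_one_comm.1 hMM
  have : x = Mᵀ *ᵥ (M *ᵥ x) := by rw [Matrix.mulVec_mulVec, hMM', Matrix.one_mulVec]
  conv_lhs => rw [this]
  ext i
  simp only [Matrix.mulVec, dotProduct, Fin.sum_univ_three, hM, Matrix.transpose_apply, Matrix.of_apply]
  simp
  ring

theorem cross_rot {e₁ e₂ : V3} (h1 : e₁ ⬝ᵥ e₁ = 1) (h2 : e₂ ⬝ᵥ e₂ = 1) (h12 : e₁ ⬝ᵥ e₂ = 0) {N : V3}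
    (hN : crossProduct e₁ e₂ = N) : crossProduct N e₁ = e₂ ∧ crossProduct N e₂ = -e₁ := by
  have h21 : e₂ ⬝ᵥ e₁ = 0 := by rw [dotProduct_comm, h12]
  rw [← hN, cross_cross_eq_smul_sub_smul, cross_cross_eq_smul_sub_smul, h1, h2, h12, h21]
  simp

theorem exists_cs {c d : ℝ} (h : c ^ 2 + d ^ 2 = 1) : ∃ β, c = Real.cos β ∧ d = Real.sin β := by
  have hn : ‖(⟨c, d⟩ : ℂ)‖ = 1 := by
    rw [Complex.norm_def, Complex.normSq_mk, ← pow_two, ← pow_two, h, Real.sqrt_one]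
  have h0 : (⟨c, d⟩ : ℂ) ≠ 0 := norm_ne_zero_iff.1 (by rw [hn]; norm_num)
  refine ⟨Complex.arg ⟨c, d⟩, ?_, ?_⟩
  · rw [Complex.cos_arg h0, hn]; simp
  · rw [Complex.sin_arg, hn]; simp

theorem frame_rot {e₁ e₂ a b : V3} (h1 : e₁ ⬝ᵥ e₁ = 1) (h2 : e₂ ⬝ᵥ e₂ = 1) (h12 : e₁ ⬝ᵥ e₂ = 0) {N : V3}
    (hN : crossProduct e₁ e₂ = N) (k1 : a ⬝ᵥ a = 1) (k2 : b ⬝ᵥ b = 1) (k12 : a ⬝ᵥ b = 0)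
    (kN : crossProduct a b = N) :
    ∃ β, a = Real.cos β • e₁ + Real.sin β • e₂ ∧ b = -Real.sin β • e₁ + Real.cos β • e₂ := by
  have haN : a ⬝ᵥ N = 0 := by rw [← kN]; exact dot_self_cross _ _
  have ha := onb_expand h1 h2 h12 hN a
  rw [haN, zero_smul, add_zero] at ha
  have hcd : (a ⬝ᵥ e₁) ^ 2 + (a ⬝ᵥ e₂) ^ 2 = 1 := by
    have := congrArg (fun x => a ⬝ᵥ x) ha
    simp only [dotProduct_add, dotProduct_smul, smul_eq_mul, k1] at this
    linarith
  obtain ⟨β, hc, hd⟩ := exists_cs hcd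
  rw [hc, hd] at ha
  refine ⟨β, ha, ?_⟩
  obtain ⟨r1, r2⟩ := cross_rot h1 h2 h12 hN
  rw [← (cross_rot k1 k2 k12 kN).1, ha, map_add, map_smul, map_smul, r1, r2]
  module

theorem gamma_eq {s f₁ f₂ : V3} (hs : s ∈ sphereS) (hf₁ : f₁ ⬝ᵥ f₁ = 1) (hf₂ : f₂ ⬝ᵥ f₂ = 1)
    (hf₁₂ : f₁ ⬝ᵥ f₂ = 0) (hff : crossProduct f₁ f₂ = -s) {v : V3} (hv : v ∈ sphereS) (h1 : v ≠ s)
    (h2 : v ≠ -s) (w : V3) : gammaForm s f₁ f₂ v w = gam (-s) v w := by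
  have hns : -s ∈ sphereS := by
    show (-s) ⬝ᵥ (-s) = 1
    rw [neg_dotProduct_neg]; exact hs
  have e := congrArg (fun x => v ⬝ᵥ x) (onb_expand hf₁ hf₂ hf₁₂ hff v)
  simp only [dotProduct_add, dotProduct_smul, smul_eq_mul, show v ⬝ᵥ v = 1 from hv, dotProduct_neg] at e
  have p1 := dot_gt hv hs h2
  have p2 := dot_gt hv hns (by simpa using h1)
  rw [dotProduct_neg] at p2
  have e2 : (v ⬝ᵥ f₁) ^ 2 + (v ⬝ᵥ f₂) ^ 2 = (1 + v ⬝ᵥ s) * (1 + -(v ⬝ᵥ s)) := by linarith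
  have e3 : (v ⬝ᵥ f₁) * (w ⬝ᵥ f₂) - (v ⬝ᵥ f₂) * (w ⬝ᵥ f₁) = (-s) ⬝ᵥ crossProduct v w := by
    rw [← hff, cross_dot_cross, dotProduct_comm f₁, dotProduct_comm f₂, dotProduct_comm f₁,
      dotProduct_comm f₂]
    ring
  rw [gammaForm, gam, if_neg (by rw [e2]; positivity), e2, e3, dotProduct_neg]
  field_simp

theorem angle_diff {c1 c2 Θ r : ℝ → ℝ} (hΘ : Continuous Θ) (hr : ∀ φ, 0 < r φ)
    (h1 : ∀ φ, c1 φ = r φ * Real.cos (Θ φ)) (h2 : ∀ φ, c2 φ = r φ * Real.sin (Θ φ)) {φ : ℝ}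
    (d1 : DifferentiableAt ℝ c1 φ) (d2 : DifferentiableAt ℝ c2 φ) : DifferentiableAt ℝ Θ φ := by
  have key : Θ =ᶠ[𝓝 φ] fun ψ => Θ φ + Real.arctan
      ((c2 ψ * Real.cos (Θ φ) - c1 ψ * Real.sin (Θ φ)) /
        (c1 ψ * Real.cos (Θ φ) + c2 ψ * Real.sin (Θ φ))) := by
    have hev : ∀ᶠ ψ in 𝓝 φ, Θ ψ ∈ Ioo (Θ φ - Real.pi / 2) (Θ φ + Real.pi / 2) :=
      hΘ.continuousAt.eventually_mem (Ioo_mem_nhds (by linarith [Real.pi_pos]) (by linarith [Real.pi_pos]))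
    filter_upwards [hev] with ψ hψ
    have e1 : c2 ψ * Real.cos (Θ φ) - c1 ψ * Real.sin (Θ φ) = r ψ * Real.sin (Θ ψ - Θ φ) := by
      rw [h1, h2, Real.sin_sub]; ring
    have e2 : c1 ψ * Real.cos (Θ φ) + c2 ψ * Real.sin (Θ φ) = r ψ * Real.cos (Θ ψ - Θ φ) := by
      rw [h1, h2, Real.cos_sub]; ring
    rw [e1, e2, mul_div_mul_left _ _ (hr ψ).ne', ← Real.tan_eq_sin_div_cos,
      Real.arctan_tan (by linarith [hψ.1]) (by linarith [hψ.2])]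
    ring
  refine DifferentiableAt.congr_of_eventuallyEq ?_ key
  have hne : c1 φ * Real.cos (Θ φ) + c2 φ * Real.sin (Θ φ) ≠ 0 := by
    have := Real.sin_sq_add_cos_sq (Θ φ)
    rw [h1, h2, show r φ * Real.cos (Θ φ) * Real.cos (Θ φ) + r φ * Real.sin (Θ φ) * Real.sin (Θ φ) =
      r φ * (Real.sin (Θ φ) ^ 2 + Real.cos (Θ φ) ^ 2) by ring, this, mul_one]
    exact (hr φ).ne'
  exact (((d2.mul_const _).sub (d1.mul_const _)).div ((d1.mul_const _).add (d2.mul_const _))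
    hne).arctan.const_add _

theorem final (P : PolyCtx) (deg : (V3 → V3) → ℤ) (hdeg : DegreeTheory deg)
    (s : V3) (hs : P.AdmissibleS s)
    (n : V3 → V3) (hn : P.MemC0Phat n) (hC1 : ContDiffOn ℝ 1 n P.PhatSet)
    (a : Fin P.nv) (w : ℤ)
    (ctr : V3) (hctr : ctr ∈ P.Chat a) (hctr' : ctr ∉ P.bdChat a)
    (z : ℝ → V3) (hz : PosLoopParam (P.Cnormal a) ctr z)
    (hzr : Set.range z = P.bdChat a)
    (hzpw : ∃ D : Set ℝ, D.Finite ∧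
      ∀ φ ∈ Set.Icc 0 (2 * Real.pi) \ D, DifferentiableAt ℝ z φ)
    (hw : deg (wrapMap n z ctr s) = w)
    (e₁ e₂ : V3) (he₁ : e₁ ⬝ᵥ e₁ = 1) (he₂ : e₂ ⬝ᵥ e₂ = 1) (he₁₂ : e₁ ⬝ᵥ e₂ = 0)
    (hee : crossProduct e₁ e₂ = P.Cnormal a)
    (f₁ f₂ : V3) (hf₁ : f₁ ⬝ᵥ f₁ = 1) (hf₂ : f₂ ⬝ᵥ f₂ = 1) (hf₁₂ : f₁ ⬝ᵥ f₂ = 0)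
    (hff : crossProduct f₁ f₂ = -s) :
    (w : ℝ) = (1 / (4 * Real.pi)) *
      (faceInt n ctr e₁ e₂ (P.Chat a) -
        ∫ φ in Set.Icc 0 (2 * Real.pi),
          gammaForm s f₁ f₂ (n (z φ)) (deriv (fun ψ => n (z ψ)) φ)) := by
  have hclosed : IsClosed P.Pbar := P.compact.isClosed
  have he₂₁ : e₂ ⬝ᵥ e₁ = 0 := by rw [dotProduct_comm, he₁₂]
  have hN1 : e₁ ⬝ᵥ P.Cnormal a = 0 := by rw [← hee]; exact dot_self_cross _ _
  have hN2 : e₂ ⬝ᵥ P.Cnormal a = 0 := by rw [← hee]; exact dot_cross_self _ _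
  -- the cleaved face
  have hchat : ∀ x, x ∈ P.Chat a ↔ (x - P.cpt a) ⬝ᵥ P.Cnormal a = 0 ∧ x ∈ P.Pbar := by
    intro x
    constructor
    · rintro ⟨h1, h2⟩; exact ⟨h1, h2.1⟩
    · rintro ⟨h1, h2⟩
      refine ⟨h1, h2, ?_⟩
      rintro ⟨b, rfl⟩
      by_cases hb : b = a
      · subst hb; exact (P.sep_vert b).ne' h1
      · exact (P.sep_other a b hb).ne h1
  have hrall : ∀ x ∈ P.Chat a, x ∈ P.Rall := by
    intro x hx
    refine mem_iInter.2 fun b => ?_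
    exact P.cleave_sub a b x hx.2.1 hx.1
  have hphat : P.Chat a ⊆ P.PhatSet := fun x hx => ⟨hx.2, hrall x hx⟩
  have hctrP : ctr ∈ P.Pbar := hctr.2.1
  have hctrF : ∀ c, ctr ⬝ᵥ P.Fnormal c < P.foffset c := by
    intro c
    refine lt_of_le_of_ne (P.face_supp c ctr hctrP) fun h => hctr' ?_
    refine mem_iUnion.2 ⟨c, hctr, ?_, hrall _ hctr⟩
    rw [P.face_def]; exact ⟨hctrP, h⟩
  have hctrI : ctr ∈ interior P.Pbar := by
    by_contra h
    have : ctr ∈ frontier P.Pbar := by rw [hclosed.frontier_eq]; exact ⟨hctrP, h⟩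
    rw [P.frontier_eq] at this
    obtain ⟨c, hc⟩ := mem_iUnion.1 this
    rw [P.face_def] at hc
    exact (hctrF c).ne hc.2
  -- the chart
  set emb : ℝ × ℝ → V3 := fun q => ctr + q.1 • e₁ + q.2 • e₂ with hemb
  set A : Set (ℝ × ℝ) := {q | emb q ∈ P.Chat a} with hAdef
  have hembC : ContDiff ℝ 1 emb := by rw [hemb]; fun_prop
  have hembc : Continuous emb := hembC.continuous
  have hplane : ∀ q, (emb q - P.cpt a) ⬝ᵥ P.Cnormal a = 0 := by
    intro q
    have h0 : (ctr - P.cpt a) ⬝ᵥ P.Cnormal a = 0 := hctr.1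
    have : emb q - P.cpt a = (ctr - P.cpt a) + q.1 • e₁ + q.2 • e₂ := by simp only [hemb]; abel
    rw [this, add_dotProduct, add_dotProduct, smul_dotProduct, smul_dotProduct, h0, hN1, hN2]; simp
  have hAP : ∀ q, q ∈ A ↔ emb q ∈ P.Pbar := fun q =>
    ⟨fun h => ((hchat _).1 h).2, fun h => (hchat _).2 ⟨hplane q, h⟩⟩
  have hAeq : A = emb ⁻¹' P.Pbar := by ext q; exact hAP q
  have hd1 : ∀ q, (emb q - ctr) ⬝ᵥ e₁ = q.1 := by
    intro q
    have : emb q - ctr = q.1 • e₁ + q.2 • e₂ := by simp only [hemb]; abel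
    rw [this, add_dotProduct, smul_dotProduct, smul_dotProduct, he₁, he₂₁]; simp
  have hd2 : ∀ q, (emb q - ctr) ⬝ᵥ e₂ = q.2 := by
    intro q
    have : emb q - ctr = q.1 • e₁ + q.2 • e₂ := by simp only [hemb]; abel
    rw [this, add_dotProduct, smul_dotProduct, smul_dotProduct, he₁₂, he₂]; simp
  have hdotc : ∀ e : V3, Continuous fun x : V3 => (x - ctr) ⬝ᵥ e := by
    intro e; simp only [dotProduct, Pi.sub_apply]; fun_prop
  have hcomb : ∀ (t t' : ℝ) (q q' : ℝ × ℝ), t + t' = 1 → emb (t • q + t' • q') = t • emb q + t' • emb q' := by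
    intro t t' q q' h
    have h' : t' = 1 - t := by linarith
    subst h'
    simp only [hemb, Prod.fst_add, Prod.snd_add, Prod.smul_fst, Prod.smul_snd, smul_eq_mul]
    module
  have hemb0 : emb 0 = ctr := by simp [hemb]
  have hA : GoodSet A := by
    refine ⟨?_, ?_, ?_⟩
    · have hK : IsCompact ((fun x : V3 => ((x - ctr) ⬝ᵥ e₁, (x - ctr) ⬝ᵥ e₂)) '' P.Pbar) :=
        P.compact.image ((hdotc e₁).prodMk (hdotc e₂))
      refine hK.of_isClosed_subset ?_ ?_
      · rw [hAeq]; exact hclosed.preimage hembc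
      · intro q hq
        refine ⟨emb q, (hAP q).1 hq, ?_⟩
        simp only [hd1, hd2]
    · intro q hq q' hq' t t' ht ht' htt
      rw [hAP] at hq hq' ⊢
      rw [hcomb t t' q q' htt]
      exact P.convex hq hq' ht ht' htt
    · rw [hAeq]
      refine hembc.continuousAt.preimage_mem_nhds ?_
      rw [hemb0]
      exact mem_interior_iff_mem_nhds.1 hctrI
  -- the boundary
  have hfr : ∀ q ∈ A, (∃ c, emb q ⬝ᵥ P.Fnormal c = P.foffset c) → q ∈ frontier A := by
    rintro q hq ⟨c, hc⟩
    rw [hA.cpt.isClosed.frontier_eq]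
    refine ⟨hq, fun hi => ?_⟩
    have hnb : A ∈ 𝓝 ((1:ℝ) • q) := by rw [one_smul]; exact mem_interior_iff_mem_nhds.1 hi
    have hcont : Continuous fun t : ℝ => t • q := by fun_prop
    have hev : ∀ᶠ t in 𝓝 (1:ℝ), t • q ∈ A := hcont.continuousAt.preimage_mem_nhds hnb
    obtain ⟨ε, hε, hball⟩ := Metric.eventually_nhds_iff.1 hev
    have hmem : (1 + ε / 2) • q ∈ A := by
      apply hball
      rw [Real.dist_eq, add_sub_cancel_left, abs_of_pos (by linarith)]; linarith
    have hle := P.face_supp c _ ((hAP _).1 hmem)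
    have hx : emb ((1 + ε / 2) • q) = (1 + ε / 2) • emb q + (-(ε / 2)) • ctr := by
      have := hcomb (1 + ε / 2) (-(ε / 2)) q 0 (by ring)
      rwa [smul_zero, add_zero, hemb0] at this
    rw [hx, add_dotProduct, smul_dotProduct, smul_dotProduct, hc, smul_eq_mul, smul_eq_mul] at hle
    nlinarith [hctrF c]
  have hfr' : ∀ q ∈ frontier A, ∃ c, emb q ∈ P.Fhat c ∧ emb q ∈ P.Chat a := by
    intro q hq
    rw [hA.cpt.isClosed.frontier_eq] at hq
    have hqP := (hAP q).1 hq.1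
    have hni : emb q ∉ interior P.Pbar := by
      intro h
      apply hq.2
      rw [mem_interior_iff_mem_nhds, hAeq]
      exact hembc.continuousAt.preimage_mem_nhds (mem_interior_iff_mem_nhds.1 h)
    have : emb q ∈ frontier P.Pbar := by rw [hclosed.frontier_eq]; exact ⟨hqP, hni⟩
    rw [P.frontier_eq] at this
    obtain ⟨c, hc⟩ := mem_iUnion.1 this
    exact ⟨c, ⟨hc, hrall _ hq.1⟩, hq.1⟩
  set u : ℝ × ℝ → V3 := fun q => n (emb q) with hudef
  have hus : ∀ q ∈ A, u q ∈ sphereS := fun q hq => hn.2.1 _ (hphat hq)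
  have huC : ContDiffOn ℝ 1 u A := hC1.comp hembC.contDiffOn (fun q hq => hphat hq)
  have hbdF : ∀ t, ∃ c, u (zt A t) ⬝ᵥ P.Fnormal c = 0 := by
    intro t
    obtain ⟨c, hc, -⟩ := hfr' _ (hA.zt_frontier t)
    exact ⟨c, hn.2.2 c _ hc⟩
  have hne1 : ∀ t, u (zt A t) ≠ s := by
    intro t h
    obtain ⟨c, hc⟩ := hbdF t
    rw [h] at hc
    exact hs.2 c hc
  have hne2 : ∀ t, u (zt A t) ≠ -s := by
    intro t h
    obtain ⟨c, hc⟩ := hbdF t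
    rw [h, neg_dotProduct, neg_eq_zero] at hc
    exact hs.2 c hc
  -- the parameterization
  obtain ⟨hzc, hzp, b₁, b₂, hb₁, hb₂, hb₁₂, hbb, θ, r, hθ, hθm, hθp, hr, hzθ⟩ := hz
  obtain ⟨β, hβ1, hβ2⟩ := frame_rot he₁ he₂ he₁₂ hee hb₁ hb₂ hb₁₂ hbb
  set Θ : ℝ → ℝ := fun φ => θ φ + β with hΘ
  have hΘc : Continuous Θ := hθ.add continuous_const
  have hΘm : Monotone Θ := hθm.add_const β
  have hΘp : ∀ φ, Θ (φ + 2 * Real.pi) = Θ φ + 2 * Real.pi := by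
    intro φ; simp only [hΘ, hθp]; ring
  have hz1 : ∀ φ, z φ = emb (r φ • cs (Θ φ)) := by
    intro φ
    rw [hzθ, hβ1, hβ2]
    simp only [hemb, hΘ, cs, Prod.smul_fst, Prod.smul_snd, smul_eq_mul, Real.cos_add, Real.sin_add]
    module
  have hzbd : ∀ φ, z φ ∈ P.bdChat a := fun φ => hzr ▸ mem_range_self φ
  have hz2 : ∀ φ, z φ = emb (zt A (Θ φ)) := by
    intro φ
    obtain ⟨c, hc1, hc2⟩ := mem_iUnion.1 (hzbd φ)
    have hf2 := hc2.1
    rw [P.face_def] at hf2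
    rw [hz1] at hc1 hf2
    have := hA.frontier_eq (hr φ) (hfr _ hc1 ⟨c, hf2.2⟩)
    rw [hz1, zt, ← this]
  obtain ⟨D, hD, hDd⟩ := hzpw
  have hΘd : ∀ φ ∈ Icc 0 (2 * Real.pi) \ D, DifferentiableAt ℝ Θ φ := by
    intro φ hφ
    have hdz := hDd φ hφ
    have hdd : ∀ e : V3, DifferentiableAt ℝ (fun ψ => (z ψ - ctr) ⬝ᵥ e) φ := by
      intro e
      simp only [dotProduct, Pi.sub_apply, Fin.sum_univ_three]
      have hp := differentiableAt_pi.1 hdz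
      have h0 := hp 0
      have h1 := hp 1
      have h2 := hp 2
      fun_prop
    refine angle_diff hΘc hr (c1 := fun ψ => (z ψ - ctr) ⬝ᵥ e₁) (c2 := fun ψ => (z ψ - ctr) ⬝ᵥ e₂)
      ?_ ?_ (hdd e₁) (hdd e₂)
    · intro ψ; simp only [hz1, hd1]; simp [cs]
    · intro ψ; simp only [hz1, hd2]; simp [cs]
  have hf : ∀ x ∈ sphereS, wrapMap n z ctr s x = glue (fun ρ φ => u (ρ • zt A (Θ φ)))
      (fun ρ φ => geo (-s) (u (zt A (Θ φ))) ρ) x := by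
    intro x hx
    have hx' : x 0 ^ 2 + x 1 ^ 2 = 1 - x 2 ^ 2 := by
      have : x ⬝ᵥ x = 1 := hx
      simp only [dotProduct, Fin.sum_univ_three] at this
      linarith
    have hcone : ∀ ρ φ : ℝ, ρ • z φ + (1 - ρ) • ctr = emb (ρ • zt A (Θ φ)) := by
      intro ρ φ
      have := hcomb ρ (1 - ρ) (zt A (Θ φ)) 0 (by ring)
      rw [smul_zero, add_zero, hemb0] at this
      rw [this, hz2]
    simp only [wrapMap, glue, hx', hcone, lon, hudef]
    simp only [hz2]
  have hns : -s ∈ sphereS := by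
    show (-s) ⬝ᵥ (-s) = 1
    rw [neg_dotProduct_neg]; exact hs.1
  have hmain := disk_formula hdeg hA huC hus hns (fun t => by rw [neg_neg]; exact hne1 t) hΘc hΘp hf
  obtain ⟨C, hC⟩ := hA.zt_lip
  obtain ⟨Ku, hKu⟩ := lipOn_of_C1 hA huC
  have hvl : LipschitzWith (Ku * C) (fun t => u (zt A t)) :=
    lipschitzOnWith_univ.1 (hKu.comp (lipschitzOnWith_univ.2 hC) (fun t _ => zt_mem hA t))
  have hrep := reparam (G := gam (-s)) hvl (fun t => by simp only [zt_per])
    (fun c x w => by simp only [gam, map_smul, dotProduct_smul, smul_eq_mul, mul_div_assoc])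
    hΘc hΘm hΘp hD hΘd
  have hintg : ∫ φ in Set.Icc 0 (2 * Real.pi), gammaForm s f₁ f₂ (n (z φ)) (deriv (fun ψ => n (z ψ)) φ)
      = ∫ t in (0:ℝ)..(2 * Real.pi), gam (-s) (u (zt A t)) (deriv (fun t => u (zt A t)) t) := by
    rw [← hrep]
    congr 1
    funext φ
    simp only [hz2]
    exact gamma_eq hs.1 hf₁ hf₂ hf₁₂ hff (hus _ (zt_mem hA _)) (hne1 _) (hne2 _) _
  have hface : faceInt n ctr e₁ e₂ (P.Chat a) = ∫ q in A, pullA u q := rfl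
  rw [hface, hintg, hmain, hw]
  field_simp
  ring

/-- Integral formula for the wrapping number of a continuously
differentiable field: `w^a(n̂) = (1/4π)(∫_{Ĉ^a} n̂*ω - ∫_{∂Ĉ^a} n̂*γ)`,
where `γ = (1 - cos α) dβ` in spherical polar coordinates with south pole at `s`. -/
theorem stmt_10 (P : PolyCtx) (deg : (V3 → V3) → ℤ) (hdeg : DegreeTheory deg)
    (s : V3) (hs : P.AdmissibleS s)
    (n : V3 → V3) (hn : P.MemC0Phat n) (hC1 : ContDiffOn ℝ 1 n P.PhatSet)
    (a : Fin P.nv) (w : ℤ)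
    (ctr : V3) (hctr : ctr ∈ P.Chat a) (hctr' : ctr ∉ P.bdChat a)
    (z : ℝ → V3) (hz : PosLoopParam (P.Cnormal a) ctr z)
    (hzr : Set.range z = P.bdChat a)
    (hzpw : ∃ D : Set ℝ, D.Finite ∧
      ∀ φ ∈ Set.Icc 0 (2 * Real.pi) \ D, DifferentiableAt ℝ z φ)
    (hw : deg (wrapMap n z ctr s) = w)
    (e₁ e₂ : V3) (he₁ : e₁ ⬝ᵥ e₁ = 1) (he₂ : e₂ ⬝ᵥ e₂ = 1) (he₁₂ : e₁ ⬝ᵥ e₂ = 0)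
    (hee : crossProduct e₁ e₂ = P.Cnormal a)
    (f₁ f₂ : V3) (hf₁ : f₁ ⬝ᵥ f₁ = 1) (hf₂ : f₂ ⬝ᵥ f₂ = 1) (hf₁₂ : f₁ ⬝ᵥ f₂ = 0)
    (hff : crossProduct f₁ f₂ = -s) :
    (w : ℝ) = (1 / (4 * Real.pi)) *
      (faceInt n ctr e₁ e₂ (P.Chat a) -
        ∫ φ in Set.Icc 0 (2 * Real.pi),
          gammaForm s f₁ f₂ (n (z φ)) (deriv (fun ψ => n (z ψ)) φ)) := by
  exact final P deg hdeg s hs n hn hC1 a w ctr hctr hctr' z hz hzr hzpw hw e₁ e₂ he₁ he₂ he₁₂ hee f₁ f₂ hf₁ hf₂ hf₁₂ hff
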